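/- Restriction theorem for tameness of multiarrangements: Let (A,m) be a multiarrangement on an essential arrangement A in K^ℓ and H ∈ A. Assume that (A,m) and (A, m−δ_H) are both tame and that (A,m) is locally free along H. Then the Euler restriction (A^H, m^*) is tame. -/

import Mathlib

noncomputable section
open Classical MvPolynomial

/-- `pdLE R n M` : the `R`-module `M` has projective dimension at most `n`. -/
def pdLE (R : Type) [CommRing R] : ℕ → (M : Type) → [AddCommGroup M] → [Module R M] → Prop
  | 0, M, _, _ => Module.Projective R M
  | n + 1, M, _, _ => ∃ (ι : Type) (f : (ι →₀ R) →ₗ[R] M),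
      Function.Surjective f ∧ pdLE R n (LinearMap.ker f)

/-- Projective dimension as an element of `ℕ∞`. -/
def pdim (R : Type) [CommRing R] (M : Type) [AddCommGroup M] [Module R M] : ℕ∞ :=
  sInf {n : ℕ∞ | ∃ k : ℕ, pdLE R k M ∧ n = (k : ℕ∞)}

/-- The coordinate ring `S = K[x_1, …, x_ℓ]`. -/
abbrev PS (K : Type) [Field K] (ℓ : ℕ) : Type := MvPolynomial (Fin ℓ) K

/-- The free `S`-module of polynomial differential forms of all degrees, realized as the
exterior algebra over `S` on the free module `S^ℓ` (with `dx_i` the standard basis). -/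
abbrev ExtF (K : Type) [Field K] (ℓ : ℕ) : Type :=
  ExteriorAlgebra (PS K ℓ) (Fin ℓ → PS K ℓ)

variable {K : Type} [Field K] {ℓ : ℕ}

/-- The module `Ω^p_V` of polynomial differential `p`-forms. -/
def formsP (K : Type) [Field K] (ℓ : ℕ) (p : ℕ) : Submodule (PS K ℓ) (ExtF K ℓ) :=
  (LinearMap.range (ExteriorAlgebra.ι (PS K ℓ) :
      (Fin ℓ → PS K ℓ) →ₗ[PS K ℓ] ExtF K ℓ)) ^ p

/-- The defining linear form `α = ∑ c_i x_i` of the hyperplane with coefficient vector `c`. -/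
def linP (c : Fin ℓ → K) : PS K ℓ := ∑ i, MvPolynomial.C (c i) * MvPolynomial.X i

/-- The constant one-form `dα = ∑ c_i dx_i`. -/
def dP (c : Fin ℓ → K) : ExtF K ℓ :=
  ExteriorAlgebra.ι (PS K ℓ) (fun i => MvPolynomial.C (c i))

/-- A central hyperplane arrangement in `K^ℓ`: a finite set of (pairwise non-proportional,
nonzero) coefficient vectors of defining linear forms, each representing the hyperplane
`{x : ∑ c_i x_i = 0}`. -/
structure Arrangement (K : Type) [Field K] (ℓ : ℕ) : Type where
  hyps : Finset (Fin ℓ → K)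
  ne_zero : ∀ c ∈ hyps, c ≠ 0
  nonprop : ∀ c ∈ hyps, ∀ c' ∈ hyps, c ≠ c' → ∀ t : K, c ≠ t • c'

/-- The polynomial model of the module `Ω^p(A,m)` of logarithmic `p`-forms of the
multiarrangement `(A,m)`; it is `Q(A,m)·Ω^p(A,m)`, i.e. the image of `Ω^p(A,m)` under the
degree-shifting isomorphism given by multiplication with `Q(A,m)`, so that
`η = Q(A,m)·ω` ranges over polynomial `p`-forms with `dα_H ∧ η ∈ α_H^{m(H)} Ω^{p+1}_V`
for all `H ∈ A`. -/
def Omega (A : Arrangement K ℓ) (m : (Fin ℓ → K) → ℕ) (p : ℕ) :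
    Submodule (PS K ℓ) (ExtF K ℓ) :=
  formsP K ℓ p ⊓ ⨅ c ∈ A.hyps,
    Submodule.comap (LinearMap.mulLeft (PS K ℓ) (dP c))
      (Submodule.map (LinearMap.lsmul (PS K ℓ) (ExtF K ℓ) (linP c ^ m c))
        (formsP K ℓ (p + 1)))

/-- Tameness of a multiarrangement: `pd_S Ω^p(A,m) ≤ p` for all `0 ≤ p ≤ ℓ`. -/
def TameM (A : Arrangement K ℓ) (m : (Fin ℓ → K) → ℕ) : Prop :=
  ∀ p : ℕ, p ≤ ℓ → pdLE (PS K ℓ) p (Omega A m p)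

/-- Tameness of a simple arrangement (constant multiplicity `1`). -/
def Tame (A : Arrangement K ℓ) : Prop := TameM A (fun _ => 1)

/-- Freeness of a multiarrangement: `Ω^1(A,m)` is a free `S`-module. -/
def FreeM (A : Arrangement K ℓ) (m : (Fin ℓ → K) → ℕ) : Prop :=
  Module.Free (PS K ℓ) (Omega A m 1)

/-- An arrangement is essential when the intersection of its hyperplanes is `{0}`,
equivalently the defining forms span the dual space. -/
def Essential (A : Arrangement K ℓ) : Prop :=
  Submodule.span K (A.hyps : Set (Fin ℓ → K)) = ⊤

/-- The localization `A_x = {H ∈ A : x ∈ H}` of an arrangement at a point `x`. -/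
def locArr (A : Arrangement K ℓ) (x : Fin ℓ → K) : Arrangement K ℓ where
  hyps := A.hyps.filter (fun c => ∑ i, c i * x i = 0)
  ne_zero := fun c hc => A.ne_zero c (Finset.mem_filter.mp hc).1
  nonprop := fun c hc c' hc' =>
    A.nonprop c (Finset.mem_filter.mp hc).1 c' (Finset.mem_filter.mp hc').1

/-- `(A,m)` is locally free along the hyperplane `{x : ∑ (c0)_i x_i = 0}` :
`(A_x, m_x)` is free for every nonzero point `x` of this hyperplane. -/
def LocallyFreeAlong (A : Arrangement K ℓ) (m : (Fin ℓ → K) → ℕ) (c0 : Fin ℓ → K) : Prop :=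
  ∀ x : Fin ℓ → K, x ≠ 0 → (∑ i, c0 i * x i = 0) → FreeM (locArr A x) m

/-- The deletion `A ∖ {H}`. -/
def delArr (A : Arrangement K ℓ) (c0 : Fin ℓ → K) : Arrangement K ℓ where
  hyps := A.hyps.erase c0
  ne_zero := fun c hc => A.ne_zero c (Finset.mem_of_mem_erase hc)
  nonprop := fun c hc c' hc' =>
    A.nonprop c (Finset.mem_of_mem_erase hc) c' (Finset.mem_of_mem_erase hc')

/-- The coefficient vector of the restriction of the linear form `c` to the hyperplane `H`
along the linear identification `e : K^{ℓ-1} ≃ H`. -/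
def restrictForm (e : (Fin (ℓ - 1) → K) →ₗ[K] (Fin ℓ → K)) (c : Fin ℓ → K) :
    Fin (ℓ - 1) → K := fun i => ∑ j, c j * e (Pi.single i 1) j

/-- The linear form on `K^ℓ` with coefficient vector `c`. -/
def dotLin (c : Fin ℓ → K) : (Fin ℓ → K) →ₗ[K] K := ∑ i, c i • LinearMap.proj i

/-- `e` identifies `K^{ℓ-1}` with the hyperplane `ker(α_{c0})`. -/
def IsHypEmbedding (c0 : Fin ℓ → K) (e : (Fin (ℓ - 1) → K) →ₗ[K] (Fin ℓ → K)) : Prop :=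
  Function.Injective e ∧ LinearMap.range e = LinearMap.ker (dotLin c0)

/-- `B` (an arrangement in `K^{ℓ-1}`) represents the restriction `A^H` of `A` to the
hyperplane `H` determined by `c0 ∈ A`, via the identification `e : K^{ℓ-1} ≃ H`:
its hyperplanes are exactly the restrictions to `H` of the hyperplanes of `A ∖ {H}`. -/
def IsRestrictionOf (B : Arrangement K (ℓ - 1)) (A : Arrangement K ℓ) (c0 : Fin ℓ → K)
    (e : (Fin (ℓ - 1) → K) →ₗ[K] (Fin ℓ → K)) : Prop :=
  (∀ c ∈ A.hyps, c ≠ c0 → ∃ c' ∈ B.hyps, ∃ t : K, t ≠ 0 ∧ restrictForm e c = t • c') ∧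
  (∀ c' ∈ B.hyps, ∃ c ∈ A.hyps, c ≠ c0 ∧ ∃ t : K, t ≠ 0 ∧ restrictForm e c = t • c')
/-- The Ziegler multiplicity `m^H` on the restriction: `m^H(X) = #{L ∈ A∖{H} : L ∩ H = X}`. -/
def zieglerMult (A : Arrangement K ℓ) (c0 : Fin ℓ → K)
    (e : (Fin (ℓ - 1) → K) →ₗ[K] (Fin ℓ → K)) (c' : Fin (ℓ - 1) → K) : ℕ :=
  (A.hyps.filter (fun c => c ≠ c0 ∧ ∃ t : K, t ≠ 0 ∧ restrictForm e c = t • c')).card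

/-- The wedge `dx_{i_1} ∧ ⋯ ∧ dx_{i_p}` for a list of indices. -/
def wedgeList (l : List (Fin ℓ)) : ExtF K ℓ :=
  (l.map (fun i => ExteriorAlgebra.ι (PS K ℓ) (Pi.single i (1 : PS K ℓ)))).prod

/-- A polynomial `p`-form is homogeneous of (coefficient) degree `d` if it is a sum of
terms `f · dx_{i_1} ∧ ⋯ ∧ dx_{i_p}` with `f` homogeneous of degree `d`. -/
def IsHomogForm (p d : ℕ) (η : ExtF K ℓ) : Prop :=
  η ∈ AddSubgroup.closure {ξ : ExtF K ℓ | ∃ (f : PS K ℓ) (l : List (Fin ℓ)),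
    f.IsHomogeneous d ∧ l.length = p ∧ ξ = f • wedgeList l}

/-- `|m| = ∑_{H ∈ A} m(H)`. -/
def msum (A : Arrangement K ℓ) (m : (Fin ℓ → K) → ℕ) : ℕ := ∑ c ∈ A.hyps, m c

/-- The multiarrangement `(A,m)` is free with exponents `(d_1, …, d_ℓ)`: the polynomial
model of `Ω^1(A,m)` has a homogeneous basis whose `i`-th member has coefficient degree
`|m| - d_i`. -/
def FreeWithExp (A : Arrangement K ℓ) (m : (Fin ℓ → K) → ℕ) (d : Fin ℓ → ℕ) : Prop :=
  ∃ b : Fin ℓ → ExtF K ℓ,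
    (∀ i, b i ∈ Omega A m 1) ∧
    (∀ i, IsHomogForm 1 (msum A m - d i) (b i)) ∧
    LinearIndependent (PS K ℓ) b ∧
    Omega A m 1 ≤ Submodule.span (PS K ℓ) (Set.range b)

/-- The exponent vector `(d_1, d_2, 0, …, 0)`. -/
def expVec (d1 d2 : ℕ) : Fin ℓ → ℕ := fun i =>
  if (i : ℕ) = 0 then d1 else if (i : ℕ) = 1 then d2 else 0

/-- The localization `A_X` of `A` at the lattice element `X = H ∩ L` corresponding,
via the identification `e` of `H` with `K^{ℓ-1}`, to the hyperplane of `H`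
with coefficient vector `c'`. -/
def locOnRestr (A : Arrangement K ℓ) (e : (Fin (ℓ - 1) → K) →ₗ[K] (Fin ℓ → K))
    (c' : Fin (ℓ - 1) → K) : Arrangement K ℓ where
  hyps := A.hyps.filter (fun c => ∃ t : K, restrictForm e c = t • c')
  ne_zero := fun c hc => A.ne_zero c (Finset.mem_filter.mp hc).1
  nonprop := fun c hc c'' hc'' =>
    A.nonprop c (Finset.mem_filter.mp hc).1 c'' (Finset.mem_filter.mp hc'').1

/-- The multiplicity `m - δ_H`. -/
def mdel (m : (Fin ℓ → K) → ℕ) (c0 : Fin ℓ → K) : (Fin ℓ → K) → ℕ :=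
  fun c => if c = c0 then m c - 1 else m c

/-- `ms` is the Euler multiplicity `m^*` on the restriction `B = A^H` (presented via the
identification `e`): for each `X ∈ A^H` the rank-two localization `(A_X, m_X)` is free
with exponents `(d_1^X, d_2^X, 0, …, 0)` ordered so that `(A_X, m_X - δ_H)` is free with
exponents `(d_1^X - 1, d_2^X, 0, …, 0)`, and `m^*(X) = d_2^X`. -/
def IsEulerMult (A : Arrangement K ℓ) (m : (Fin ℓ → K) → ℕ) (c0 : Fin ℓ → K)
    (e : (Fin (ℓ - 1) → K) →ₗ[K] (Fin ℓ → K)) (B : Arrangement K (ℓ - 1))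
    (ms : (Fin (ℓ - 1) → K) → ℕ) : Prop :=
  ∀ c' ∈ B.hyps, ∃ d1 d2 : ℕ,
    FreeWithExp (locOnRestr A e c') m (expVec d1 d2) ∧
    FreeWithExp (locOnRestr A e c') (mdel m c0) (expVec (d1 - 1) d2) ∧
    ms c' = d2

/-- An arrangement is generic if any `k ≤ ℓ-1` of its hyperplanes intersect in
codimension `k`, i.e. any `≤ ℓ-1` of its defining forms are linearly independent. -/
def GenericArr (A : Arrangement K ℓ) : Prop :=
  ∀ s : Finset (Fin ℓ → K), s ⊆ A.hyps → s.card ≤ ℓ - 1 →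
    LinearIndependent K (fun x : {c // c ∈ s} => (x : Fin ℓ → K))

/-- An arrangement is irreducible if it is not a product of two lower-dimensional
arrangements, i.e. its defining forms cannot be split into two complementary proper
subspaces of the dual space. -/
def IrreducibleArr (A : Arrangement K ℓ) : Prop :=
  ¬ ∃ U1 U2 : Submodule K (Fin ℓ → K), U1 ≠ ⊥ ∧ U2 ≠ ⊥ ∧ U1 ⊓ U2 = ⊥ ∧ U1 ⊔ U2 = ⊤ ∧
      ∀ c ∈ A.hyps, c ∈ U1 ∨ c ∈ U2

/-- The defining polynomial `Q(A,m) = ∏_{H ∈ A} α_H^{m(H)}`. -/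
def Qpoly (A : Arrangement K ℓ) (m : (Fin ℓ → K) → ℕ) : PS K ℓ :=
  ∏ c ∈ A.hyps, linP c ^ m c

section ProjectiveDimension

open CategoryTheory

/-- `pdLT R M n`: the `R`-module `M` has projective dimension less than `n`. -/
abbrev pdLT (R : Type) [CommRing R] (M : Type) [AddCommGroup M] [Module R M] (n : ℕ) : Prop :=
  HasProjectiveDimensionLT (ModuleCat.of R M) n

variable {R : Type} [CommRing R] {M N L : Type} [AddCommGroup M] [Module R M]
  [AddCommGroup N] [Module R N] [AddCommGroup L] [Module R L]

lemma pdLT.mono {n k : ℕ} (h : pdLT R M n) (hk : n ≤ k) : pdLT R M k :=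
  hasProjectiveDimensionLT_of_ge _ n k hk

lemma pdLT.of_equiv {n : ℕ} (h : pdLT R M n) (e : M ≃ₗ[R] N) : pdLT R N n :=
  hasProjectiveDimensionLT_of_iso e.toModuleIso n

lemma pdLT_one_iff : pdLT R M 1 ↔ Module.Projective R M := by
  rw [pdLT, ← projective_iff_hasProjectiveDimensionLT_one, ← IsProjective.iff_projective]

lemma shortExact_ofHom {f : M →ₗ[R] N} {g : N →ₗ[R] L} (hf : Function.Injective f)
    (hfg : Function.Exact f g) (hg : Function.Surjective g) :
    (ModuleCat.shortComplexOfCompEqZero f g hfg.linearMap_comp_eq_zero).ShortExact :=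
  ModuleCat.shortComplex_shortExact _ hfg hf hg

lemma pdLT.middle {n : ℕ} {f : M →ₗ[R] N} {g : N →ₗ[R] L} (hf : Function.Injective f)
    (hfg : Function.Exact f g) (hg : Function.Surjective g)
    (h₁ : pdLT R M n) (h₃ : pdLT R L n) : pdLT R N n :=
  (shortExact_ofHom hf hfg hg).hasProjectiveDimensionLT_X₂ n h₁ h₃

lemma pdLT.right {n : ℕ} {f : M →ₗ[R] N} {g : N →ₗ[R] L} (hf : Function.Injective f)
    (hfg : Function.Exact f g) (hg : Function.Surjective g)
    (h₁ : pdLT R M n) (h₂ : pdLT R N (n + 1)) : pdLT R L (n + 1) :=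
  (shortExact_ofHom hf hfg hg).hasProjectiveDimensionLT_X₃ n h₁ h₂

lemma pdLT.left {n : ℕ} {f : M →ₗ[R] N} {g : N →ₗ[R] L} (hf : Function.Injective f)
    (hfg : Function.Exact f g) (hg : Function.Surjective g)
    (h₂ : pdLT R N n) (h₃ : pdLT R L (n + 1)) : pdLT R M n :=
  (shortExact_ofHom hf hfg hg).hasProjectiveDimensionLT_X₁ n h₂ h₃

lemma pdLT.ker_of_projective {n : ℕ} {g : N →ₗ[R] L} (hg : Function.Surjective g)
    (hN : Module.Projective R N) (h : pdLT R L (n + 2)) : pdLT R (LinearMap.ker g) (n + 1) :=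
  pdLT.left (f := (LinearMap.ker g).subtype) (Submodule.injective_subtype _)
    (LinearMap.exact_subtype_ker_map g) hg ((pdLT_one_iff.2 hN).mono (by omega)) h

lemma pdLT.of_ker {n : ℕ} {g : N →ₗ[R] L} (hg : Function.Surjective g)
    (hN : pdLT R N (n + 1)) (h : pdLT R (LinearMap.ker g) n) : pdLT R L (n + 1) :=
  pdLT.right (f := (LinearMap.ker g).subtype) (Submodule.injective_subtype _)
    (LinearMap.exact_subtype_ker_map g) hg h hN

lemma pdLT.of_subsingleton [Subsingleton M] (n : ℕ) : pdLT R M n := by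
  have : HasProjectiveDimensionLT (ModuleCat.of R M) 0 :=
    (ModuleCat.isZero_of_subsingleton _).hasProjectiveDimensionLT_zero
  exact pdLT.mono this (Nat.zero_le n)

lemma pdLT.range_of_projective {n : ℕ} {g : N →ₗ[R] L} (hL : Module.Projective R L)
    (h : pdLT R (L ⧸ LinearMap.range g) (n + 2)) : pdLT R (LinearMap.range g) (n + 1) :=
  pdLT.left (f := (LinearMap.range g).subtype) (Submodule.injective_subtype _)
    (LinearMap.exact_subtype_mkQ _) (Submodule.mkQ_surjective _)
    ((pdLT_one_iff.2 hL).mono (by omega)) h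

theorem pdLE_iff_pdLT (n : ℕ) : ∀ {M : Type} [AddCommGroup M] [Module R M],
    pdLE R n M ↔ pdLT R M (n + 1) := by
  induction n with
  | zero => intro M _ _; exact pdLT_one_iff.symm
  | succ n ih =>
    intro M _ _
    constructor
    · rintro ⟨ι, f, hf, h⟩
      exact pdLT.of_ker hf ((pdLT_one_iff.2 inferInstance).mono (by omega)) (ih.1 h)
    · intro h
      refine ⟨M, Finsupp.linearCombination R id, Finsupp.linearCombination_id_surjective R M, ?_⟩
      exact ih.2 (pdLT.ker_of_projective (Finsupp.linearCombination_id_surjective R M)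
        inferInstance h)

lemma exact_baseChange_ker (B : Type) [CommRing B] [Algebra R B] {g : N →ₗ[R] L}
    (hg : Function.Surjective g) :
    Function.Exact ((LinearMap.ker g).subtype.baseChange B) (g.baseChange B) :=
  lTensor_exact B (LinearMap.exact_subtype_ker_map g) hg

open TensorProduct in
theorem pdLT.baseChange {B : Type} [CommRing B] [Algebra R B] [Module.Flat R B] (n : ℕ) :
    ∀ {M : Type} [AddCommGroup M] [Module R M], pdLT R M (n + 1) → pdLT B (B ⊗[R] M) (n + 1) := by
  induction n with
  | zero =>
    intro M _ _ h
    have := pdLT_one_iff.1 h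
    exact pdLT_one_iff.2 inferInstance
  | succ n ih =>
    intro M _ _ h
    have hs := Finsupp.linearCombination_id_surjective R M
    set g : (M →₀ R) →ₗ[R] M := Finsupp.linearCombination R id
    have hk := ih (pdLT.ker_of_projective hs inferInstance h)
    refine pdLT.right (f := (LinearMap.ker g).subtype.baseChange B) (g := g.baseChange B)
      ?_ ?_ ?_ hk ((pdLT_one_iff.2 inferInstance).mono (by omega))
    · exact Module.Flat.lTensor_preserves_injective_linearMap (M := B) (LinearMap.ker g).subtype
        (Submodule.injective_subtype _)
    · exact exact_baseChange_ker B hs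
    · exact LinearMap.lTensor_surjective B hs

/-- Every `R`-module has projective dimension at most `n`. -/
def gldimLE (R : Type) [CommRing R] (n : ℕ) : Prop :=
  ∀ (M : Type) [AddCommGroup M] [Module R M], pdLT R M (n + 1)

lemma gldimLE.of_ringEquiv {A B : Type} [CommRing A] [CommRing B] (e : A ≃+* B) {n : ℕ}
    (h : gldimLE A n) : gldimLE B n := by
  intro M _ _
  have := RingHomInvPair.of_ringEquiv e
  have := RingHomInvPair.symm (RingHomClass.toRingHom e) (RingHomClass.toRingHom e.symm)
  let _ : Module A M := Module.compHom M (e : A →+* B)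
  have h1 : HasProjectiveDimensionLE (ModuleCat.of A M) n := h M
  let e' : (ModuleCat.of A M) ≃ₛₗ[RingHomClass.toRingHom e] (ModuleCat.of B M) :=
    { AddEquiv.refl M with map_smul' := fun r m => rfl }
  exact ModuleCat.hasProjectiveDimensionLE_of_semiLinearEquiv e e' n

open TensorProduct Polynomial in
theorem gldimLE.polynomial {A : Type} [CommRing A] {n : ℕ} (h : gldimLE A n) :
    gldimLE A[X] (n + 1) := by
  intro M _ _
  let _ : Module A M := Module.compHom M (Polynomial.C : A →+* A[X])
  have : IsScalarTower A A[X] M := ⟨fun a p m => by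
    change (a • p) • m = (Polynomial.C a) • p • m
    rw [smul_smul, Polynomial.smul_eq_C_mul]⟩
  let ev : A[X] ⊗[A] M →ₗ[A[X]] M := TensorProduct.AlgebraTensorModule.lift
    { toFun := fun p => p • (LinearMap.id : M →ₗ[A] M)
      map_add' := fun p q => by ext; simp [add_smul]
      map_smul' := fun p q => by ext; simp [mul_smul] }
  have ev_tmul : ∀ p m, ev (p ⊗ₜ m) = p • m := fun p m => rfl
  let xM : M →ₗ[A] M := (LinearMap.lsmul A[X] M (Polynomial.X)).restrictScalars A
  let D : A[X] ⊗[A] M →ₗ[A[X]] A[X] ⊗[A] M :=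
    (Polynomial.X : A[X]) • LinearMap.id - xM.baseChange A[X]
  have D_tmul : ∀ p m, D (p ⊗ₜ m) = (Polynomial.X * p) ⊗ₜ m - p ⊗ₜ ((Polynomial.X : A[X]) • m) :=
    fun p m => by simp [D, xM, TensorProduct.smul_tmul']
  let φ := TensorProduct.equivFinsuppOfBasisLeft (N := M) (Polynomial.basisMonomials A)
  have φ_tmul : ∀ p m i, φ (p ⊗ₜ[A] m) i = p.coeff i • m := fun p m i => by
    simp [φ, Polynomial.basisMonomials]
    rfl
  have hD : ∀ t i, φ (D t) (i + 1) = φ t i - (Polynomial.X : A[X]) • φ t (i + 1) := by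
    intro t i
    induction t using TensorProduct.induction_on with
    | zero => simp
    | tmul p m =>
      simp only [D_tmul, map_sub, Finsupp.sub_apply, φ_tmul, Polynomial.coeff_X_mul]
      rw [smul_comm]
    | add x y hx hy => simp only [map_add, Finsupp.add_apply, hx, hy, smul_add]; abel
  have hinj : Function.Injective D := by
    rw [injective_iff_map_eq_zero]
    intro t ht
    have key : ∀ i, φ t i = (Polynomial.X : A[X]) • φ t (i + 1) := fun i => by
      have := hD t i
      rw [ht, map_zero, Finsupp.zero_apply] at this
      exact (sub_eq_zero.1 this.symm)
    have key2 : ∀ k i, φ t i = (Polynomial.X : A[X]) ^ k • φ t (i + k) := by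
      intro k
      induction k with
      | zero => simp
      | succ k ih => intro i; rw [ih i, key (i + k), pow_succ, mul_smul]; rfl
    apply φ.injective
    rw [map_zero]
    ext i
    obtain ⟨b, hb⟩ := (φ t).support.bddAbove
    rw [key2 (b + 1) i, Finsupp.zero_apply]
    have : φ t (i + (b + 1)) = 0 := by
      by_contra hne
      have := hb (Finset.mem_coe.2 (Finsupp.mem_support_iff.2 hne))
      omega
    rw [this, smul_zero]
  have hex : Function.Exact D ev := by
    have comp0 : ∀ t, ev (D t) = 0 := by
      intro t
      induction t using TensorProduct.induction_on with
      | zero => simp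
      | tmul p m => simp [D_tmul, ev_tmul, smul_smul, mul_comm]
      | add x y hx hy => simp only [map_add, hx, hy, add_zero]
    have mono : ∀ (k : ℕ) (m : M), ∃ g, (Polynomial.X ^ k : A[X]) ⊗ₜ[A] m =
        D g + 1 ⊗ₜ ((Polynomial.X ^ k : A[X]) • m) := by
      intro k
      induction k with
      | zero => intro m; exact ⟨0, by simp⟩
      | succ k ih =>
        intro m
        obtain ⟨g, hg⟩ := ih ((Polynomial.X : A[X]) • m)
        refine ⟨(Polynomial.X ^ k : A[X]) ⊗ₜ m + g, ?_⟩
        rw [map_add, D_tmul, hg, ← pow_succ', pow_succ, mul_smul]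
        abel
    have gen : ∀ t, ∃ g, t = D g + 1 ⊗ₜ (ev t) := by
      intro t
      induction t using TensorProduct.induction_on with
      | zero => exact ⟨0, by simp⟩
      | tmul p m =>
        induction p using Polynomial.induction_on' with
        | add p q hp hq =>
          obtain ⟨g, hg⟩ := hp
          obtain ⟨g', hg'⟩ := hq
          refine ⟨g + g', ?_⟩
          rw [TensorProduct.add_tmul, map_add, map_add, TensorProduct.tmul_add]
          nth_rewrite 1 [hg, hg']
          abel
        | monomial k a =>
          obtain ⟨g, hg⟩ := mono k (a • m)
          refine ⟨g, ?_⟩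
          have : (Polynomial.monomial k a) ⊗ₜ[A] m = (Polynomial.X ^ k : A[X]) ⊗ₜ[A] (a • m) := by
            rw [← TensorProduct.smul_tmul, Polynomial.smul_X_eq_monomial]
          rw [this, ev_tmul, hg]
      | add x y hx hy =>
        obtain ⟨g, hg⟩ := hx
        obtain ⟨g', hg'⟩ := hy
        refine ⟨g + g', ?_⟩
        rw [map_add, map_add, TensorProduct.tmul_add]
        nth_rewrite 1 [hg, hg']
        abel
    intro t
    constructor
    · intro ht
      obtain ⟨g, hg⟩ := gen t
      exact ⟨g, by rw [hg, ht]; simp⟩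
    · rintro ⟨g, rfl⟩; exact comp0 g
  have hsurj : Function.Surjective ev := fun m => ⟨1 ⊗ₜ m, by simp [ev_tmul]⟩
  have hb : pdLT A[X] (A[X] ⊗[A] M) (n + 1) := pdLT.baseChange n (h M)
  exact pdLT.right hinj hex hsurj hb (hb.mono (by omega))

theorem gldimLE_mvPolynomial (K : Type) [Field K] (n : ℕ) :
    gldimLE (MvPolynomial (Fin n) K) n := by
  induction n with
  | zero =>
    refine gldimLE.of_ringEquiv (MvPolynomial.isEmptyRingEquiv K (Fin 0)).symm ?_
    intro M _ _
    exact pdLT_one_iff.2 inferInstance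
  | succ n ih =>
    exact gldimLE.of_ringEquiv (MvPolynomial.finSuccEquiv K n).symm.toRingEquiv ih.polynomial

end ProjectiveDimension

section ChangeOfRings

open TensorProduct

variable {S R : Type} [CommRing S] [CommRing R] [Algebra S R]

/-- An `S`-linear map between modules over a quotient ring `R` of `S` is `R`-linear. -/
def LinearMap.liftScalars (hs : Function.Surjective (algebraMap S R)) {M N : Type}
    [AddCommGroup M] [Module S M] [Module R M] [IsScalarTower S R M]
    [AddCommGroup N] [Module S N] [Module R N] [IsScalarTower S R N] (f : M →ₗ[S] N) :
    M →ₗ[R] N :=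
  { f with
    map_smul' := fun r x => by
      obtain ⟨s, rfl⟩ := hs r
      simp [algebraMap_smul] }

variable {a : S}

lemma one_tmul_eq_zero_iff (hs : Function.Surjective (algebraMap S R))
    (hk : ∀ s, algebraMap S R s = 0 ↔ a ∣ s) {P : Type} [AddCommGroup P] [Module S P] (x : P) :
    (1 : R) ⊗ₜ[S] x = 0 ↔ ∃ y, x = a • y := by
  constructor
  · intro h
    have hex : Function.Exact (LinearMap.lsmul S S a) (Algebra.linearMap S R) := by
      intro s
      simp only [Algebra.linearMap_apply, hk, Set.mem_range, LinearMap.lsmul_apply, smul_eq_mul]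
      exact ⟨fun ⟨t, ht⟩ => ⟨t, ht.symm⟩, fun ⟨t, ht⟩ => ⟨t, ht.symm⟩⟩
    have h2 := rTensor_exact P hex hs
    obtain ⟨t, ht⟩ := (h2 ((1 : S) ⊗ₜ x)).1 (by simpa using h)
    refine ⟨TensorProduct.lid S P t, ?_⟩
    have h3 : ∀ t : S ⊗[S] P, TensorProduct.lid S P ((LinearMap.lsmul S S a).rTensor P t) =
        a • TensorProduct.lid S P t := by
      intro t
      induction t using TensorProduct.induction_on with
      | zero => simp
      | tmul r m => simp [mul_smul]
      | add x y hx hy => simp only [map_add, smul_add, hx, hy]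
    rw [← h3, ht]; simp
  · rintro ⟨y, rfl⟩
    rw [← TensorProduct.smul_tmul, Algebra.smul_def, (hk a).2 dvd_rfl, zero_mul,
      TensorProduct.zero_tmul]

lemma exists_one_tmul (hs : Function.Surjective (algebraMap S R)) {P : Type} [AddCommGroup P]
    [Module S P] (t : R ⊗[S] P) : ∃ x : P, t = 1 ⊗ₜ x := by
  induction t using TensorProduct.induction_on with
  | zero => exact ⟨0, by simp⟩
  | tmul r m =>
    obtain ⟨s, rfl⟩ := hs r
    exact ⟨s • m, by rw [← TensorProduct.smul_tmul, Algebra.smul_def, mul_one]⟩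
  | add x y hx hy =>
    obtain ⟨x', rfl⟩ := hx
    obtain ⟨y', rfl⟩ := hy
    exact ⟨x' + y', by rw [TensorProduct.tmul_add]⟩

variable [IsDomain S] (hs : Function.Surjective (algebraMap S R)) (hk : ∀ s, algebraMap S R s = 0 ↔ a ∣ s)
  (ha : a ≠ 0)

include hs hk ha

lemma pdLT.two_step_of_presentation {N P : Type} [AddCommGroup N] [Module S N] [Module R N]
    [IsScalarTower S R N] [AddCommGroup P] [Module S P] [Module.IsTorsionFree S P]
    [Module.Projective S P] {g : P →ₗ[S] N} (hg : Function.Surjective g)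
    (h : pdLT S N 2) {d : ℕ} (hd : pdLT R N (d + 3)) : pdLT R N (d + 1) := by
  have ha0 : ∀ x : N, a • x = 0 := fun x => by
    rw [← algebraMap_smul R a x, (hk a).2 dvd_rfl, zero_smul]
  have hP1 : Module.Projective S (LinearMap.ker g) :=
    pdLT_one_iff.1 (pdLT.ker_of_projective hg inferInstance h)
  let φ := (LinearMap.ker g).subtype.baseChange R
  let ψ : R ⊗[S] P →ₗ[R] N := (TensorProduct.AlgebraTensorModule.lift
    { toFun := fun r => r • g
      map_add' := fun p q => by ext; simp [add_smul]
      map_smul' := fun p q => by ext; simp [mul_smul] })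
  have ψ_tmul : ∀ x, ψ (1 ⊗ₜ x) = g x := fun x => by
    change (1 : R) • g x = g x
    rw [one_smul]
  have hψ : Function.Surjective ψ := fun n => by
    obtain ⟨x, hx⟩ := hg n
    exact ⟨1 ⊗ₜ x, by rw [ψ_tmul, hx]⟩
  have hex : LinearMap.ker ψ = LinearMap.range φ := by
    apply le_antisymm
    · intro t ht
      obtain ⟨x, rfl⟩ := exists_one_tmul hs t
      rw [LinearMap.mem_ker, ψ_tmul] at ht
      exact ⟨1 ⊗ₜ ⟨x, ht⟩, by simp [φ]⟩
    · rintro _ ⟨t, rfl⟩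
      obtain ⟨x, rfl⟩ := exists_one_tmul hs t
      simp only [φ, LinearMap.baseChange_tmul, LinearMap.mem_ker, ψ_tmul]
      exact x.2
  let aP : P →ₗ[S] LinearMap.ker g :=
    (a • LinearMap.id).codRestrict (LinearMap.ker g) (fun x => by simp [ha0])
  let j0 : P →ₗ[S] R ⊗[S] LinearMap.ker g :=
    (TensorProduct.mk S R (LinearMap.ker g) 1).comp aP
  have hj0 : LinearMap.ker j0 = LinearMap.ker g := by
    ext x
    rw [LinearMap.mem_ker]
    change (1 : R) ⊗ₜ[S] (aP x) = 0 ↔ _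
    rw [one_tmul_eq_zero_iff hs hk]
    constructor
    · rintro ⟨y, hy⟩
      have h2 : a • x = a • (y : P) := congrArg Subtype.val hy
      rw [smul_right_injective _ ha h2]
      exact y.2
    · intro hx
      exact ⟨⟨x, hx⟩, rfl⟩
  let j : N →ₗ[S] R ⊗[S] LinearMap.ker g :=
    ((LinearMap.ker g).liftQ j0 hj0.ge).comp (g.quotKerEquivOfSurjective hg).symm.toLinearMap
  have hj : ∀ x, j (g x) = 1 ⊗ₜ (aP x) := fun x => by
    have : (g.quotKerEquivOfSurjective hg).symm (g x) = (LinearMap.ker g).mkQ x := by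
      rw [LinearEquiv.symm_apply_eq]; rfl
    simp only [j, LinearMap.comp_apply, LinearEquiv.coe_coe, this]
    rfl
  have hjinj : Function.Injective (LinearMap.liftScalars hs j) := by
    rw [injective_iff_map_eq_zero]
    intro n hn
    obtain ⟨x, rfl⟩ := hg n
    have h1 : j0 x = 0 := (hj x).symm.trans hn
    rw [← LinearMap.mem_ker, hj0] at h1
    exact h1
  have hjex : Function.Exact (LinearMap.liftScalars hs j) φ.rangeRestrict := by
    intro t
    rw [← Subtype.coe_inj]
    change φ t = 0 ↔ _
    constructor
    · obtain ⟨x, rfl⟩ := exists_one_tmul hs t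
      intro h0
      simp only [φ, LinearMap.baseChange_tmul, one_tmul_eq_zero_iff hs hk] at h0
      obtain ⟨y, hy⟩ := h0
      refine ⟨g y, (hj y).trans ?_⟩
      congr 1
      exact Subtype.ext hy.symm
    · rintro ⟨n, rfl⟩
      obtain ⟨x, rfl⟩ := hg n
      change φ (j (g x)) = 0
      rw [hj]
      simp only [φ, LinearMap.baseChange_tmul, one_tmul_eq_zero_iff hs hk]
      exact ⟨x, rfl⟩
  have h2 : pdLT R (LinearMap.range φ) (d + 2) := by
    rw [← hex]
    exact pdLT.ker_of_projective hψ inferInstance hd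
  exact pdLT.left hjinj hjex φ.surjective_rangeRestrict
    ((pdLT_one_iff.2 inferInstance).mono (by omega)) h2

lemma pdLT.two_step {N : Type} [AddCommGroup N] [Module S N] [Module R N] [IsScalarTower S R N]
    (h : pdLT S N 2) {d : ℕ} (hd : pdLT R N (d + 3)) : pdLT R N (d + 1) :=
  pdLT.two_step_of_presentation hs hk ha (Finsupp.linearCombination_id_surjective S N) h hd

lemma pdLT.two_of_free (ι : Type) : pdLT S (ι →₀ R) 2 := by
  have hex : Function.Exact (Finsupp.mapRange.linearMap (LinearMap.lsmul S S a) : (ι →₀ S) →ₗ[S] _)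
      (Finsupp.mapRange.linearMap (Algebra.linearMap S R)) := by
    intro x
    constructor
    · intro hx
      have h1 : ∀ i, ∃ t, x i = a * t := fun i => by
        have := DFunLike.congr_fun hx i
        exact (hk _).1 (by simpa using this)
      choose t ht using h1
      refine ⟨Finsupp.onFinset x.support t fun i hi => ?_, ?_⟩
      · rw [Finsupp.mem_support_iff, ht]
        exact mul_ne_zero ha hi
      · ext i; simp [ht]
    · rintro ⟨y, rfl⟩
      ext i
      simp [(hk a).2 dvd_rfl]
  refine pdLT.right ?_ hex ?_ (pdLT_one_iff.2 inferInstance)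
    ((pdLT_one_iff.2 inferInstance).mono (by omega))
  · exact Finsupp.mapRange_injective _ (map_zero _) (mul_right_injective₀ ha)
  · exact Finsupp.mapRange_surjective _ (map_zero _) hs

theorem pdLT.change_rings (k : ℕ) : ∀ {N : Type} [AddCommGroup N] [Module S N] [Module R N]
    [IsScalarTower S R N], pdLT S N (k + 2) → ∀ d, pdLT R N (d + 1) → pdLT R N (k + 1) := by
  induction k with
  | zero =>
    intro N _ _ _ _ h d
    induction d using Nat.strong_induction_on with
    | _ d ih =>
      intro hd
      match d, ih, hd with
      | 0, _, hd => exact hd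
      | 1, _, hd => exact pdLT.two_step (d := 0) hs hk ha h (hd.mono (by omega))
      | d + 2, ih, hd => exact ih d (by omega) (pdLT.two_step hs hk ha h hd)
  | succ k ih =>
    intro N _ _ _ _ h d hd
    have hg := Finsupp.linearCombination_id_surjective R N
    set g : (N →₀ R) →ₗ[R] N := Finsupp.linearCombination R id
    have h1 : pdLT R (LinearMap.ker g) (d + 1) :=
      pdLT.ker_of_projective hg inferInstance (hd.mono (by omega))
    have h2 : pdLT S (LinearMap.ker g) (k + 2) := by
      refine pdLT.left (f := (LinearMap.ker g).subtype.restrictScalars S)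
        (g := g.restrictScalars S) (Submodule.injective_subtype _)
        (LinearMap.exact_subtype_ker_map g) hg ?_ h
      exact (pdLT.two_of_free hs hk ha N).mono (by omega)
    exact pdLT.of_ker hg ((pdLT_one_iff.2 inferInstance).mono (by omega)) (ih h2 d h1)

end ChangeOfRings

section ExtVanishing

open CategoryTheory Abelian

/-- The vanishing of `Ext^i(S/P, M)`. -/
def extVanish {S : Type} [CommRing S] (P : Ideal S) (M : Type) [AddCommGroup M] [Module S M]
    (i : ℕ) : Prop :=
  Subsingleton (Ext (ModuleCat.of S (S ⧸ P)) (ModuleCat.of S M) i)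

variable {S : Type} [CommRing S] {P : Ideal S}
  {M N L : Type} [AddCommGroup M] [Module S M] [AddCommGroup N] [Module S N]
  [AddCommGroup L] [Module S L]

lemma extVanish_zero_iff : extVanish P M 0 ↔ ∀ x : M, (∀ s ∈ P, s • x = 0) → x = 0 := by
  rw [extVanish, (Ext.addEquiv₀.trans ModuleCat.homAddEquiv).subsingleton_congr]
  constructor
  · intro h x hx
    have hle : P ≤ LinearMap.ker (LinearMap.toSpanSingleton S M x) := fun s hs => by
      simpa using hx s hs
    have h0 := Subsingleton.elim (P.liftQ (LinearMap.toSpanSingleton S M x) hle) 0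
    have h1 := LinearMap.congr_fun h0 (P.mkQ 1)
    have h2 : P.liftQ (LinearMap.toSpanSingleton S M x) hle (P.mkQ 1) = (1 : S) • x := rfl
    rw [← one_smul S x, ← h2, h1]
    rfl
  · intro h
    refine ⟨fun f g => ?_⟩
    rw [← sub_eq_zero]
    generalize f - g = f
    refine LinearMap.ext fun t => ?_
    refine h _ fun s hs => ?_
    obtain ⟨t, rfl⟩ := P.mkQ_surjective t
    rw [← map_smul, ← map_smul]
    have : P.mkQ (s • t) = 0 := by
      rw [Submodule.mkQ_apply, Submodule.Quotient.mk_eq_zero]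
      exact P.mul_mem_right t hs
    rw [this, map_zero]

lemma extVanish.right {f : M →ₗ[S] N} {g : N →ₗ[S] L} (hf : Function.Injective f)
    (hfg : Function.Exact f g) (hg : Function.Surjective g) {i : ℕ}
    (h2 : extVanish P N i) (h1 : extVanish P M (i + 1)) : extVanish P L i := by
  refine subsingleton_of_forall_eq 0 fun x => ?_
  obtain ⟨y, rfl⟩ := Ext.covariant_sequence_exact₃ _ (shortExact_ofHom hf hfg hg) x rfl
    (h1.elim _ _)
  rw [h2.elim y 0, Ext.zero_comp]

lemma extVanish.left {f : M →ₗ[S] N} {g : N →ₗ[S] L} (hf : Function.Injective f)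
    (hfg : Function.Exact f g) (hg : Function.Surjective g) {i : ℕ}
    (h3 : extVanish P L i) (h2 : extVanish P N (i + 1)) : extVanish P M (i + 1) := by
  refine subsingleton_of_forall_eq 0 fun x => ?_
  obtain ⟨y, rfl⟩ := Ext.covariant_sequence_exact₁ _ (shortExact_ofHom hf hfg hg) x
    (h2.elim _ _) rfl
  rw [h3.elim y 0, Ext.zero_comp]

lemma extVanish.middle {f : M →ₗ[S] N} {g : N →ₗ[S] L} (hf : Function.Injective f)
    (hfg : Function.Exact f g) (hg : Function.Surjective g) {i : ℕ}
    (h1 : extVanish P M i) (h3 : extVanish P L i) : extVanish P N i := by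
  refine subsingleton_of_forall_eq 0 fun x => ?_
  obtain ⟨y, rfl⟩ := Ext.covariant_sequence_exact₂ _ (shortExact_ofHom hf hfg hg) x
    (h3.elim _ _)
  rw [h1.elim y 0, Ext.zero_comp]

lemma extVanish.of_retract {f : M →ₗ[S] N} {g : N →ₗ[S] M} (hfg : g.comp f = LinearMap.id)
    {i : ℕ} (h : extVanish P N i) : extVanish P M i := by
  refine subsingleton_of_forall_eq 0 fun x => ?_
  have h1 : x = (x.comp (Ext.mk₀ (ModuleCat.ofHom f)) (add_zero i)).comp
      (Ext.mk₀ (ModuleCat.ofHom g)) (add_zero i) := by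
    rw [Ext.comp_assoc_of_second_deg_zero, Ext.mk₀_comp_mk₀, ← ModuleCat.ofHom_comp, hfg,
      ModuleCat.ofHom_id, Ext.comp_mk₀_id]
  rw [h1, h.elim (x.comp _ _) 0, Ext.zero_comp]

lemma extVanish.of_equiv (e : M ≃ₗ[S] N) {i : ℕ} (h : extVanish P N i) : extVanish P M i :=
  extVanish.of_retract (f := e.toLinearMap) (g := e.symm.toLinearMap) (by ext; simp) h

lemma extVanish.of_subsingleton [Subsingleton M] (i : ℕ) : extVanish P M i := by
  refine subsingleton_of_forall_eq 0 fun x => ?_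
  have h1 : x = x.comp (Ext.mk₀ (ModuleCat.ofHom (LinearMap.id : M →ₗ[S] M))) (add_zero i) := by
    rw [ModuleCat.ofHom_id, Ext.comp_mk₀_id]
  rw [h1, show (LinearMap.id : M →ₗ[S] M) = 0 from LinearMap.ext fun _ => Subsingleton.elim _ _]
  rw [show ModuleCat.ofHom (0 : M →ₗ[S] M) = 0 from rfl, Ext.mk₀_zero, Ext.comp_zero]

lemma extVanish.pi {i : ℕ} (h : extVanish P S i) (n : ℕ) : extVanish P (Fin n → S) i := by
  induction n with
  | zero => exact extVanish.of_subsingleton i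
  | succ n ih =>
    have e : (Fin (n + 1) → S) ≃ₗ[S] S × (Fin n → S) := (Fin.consLinearEquiv S fun _ => S).symm
    exact extVanish.of_equiv e (extVanish.middle LinearMap.inl_injective
      (by intro x; simp [Prod.ext_iff, eq_comm]) LinearMap.snd_surjective h ih)

lemma extVanish.of_projective [Module.Finite S M] [Module.Projective S M] {i : ℕ}
    (h : extVanish P S i) : extVanish P M i := by
  obtain ⟨n, g, hg⟩ := Module.Finite.exists_fin' S M
  obtain ⟨f, hf⟩ := Module.projective_lifting_property g LinearMap.id hg
  exact extVanish.of_retract hf (h.pi n)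

theorem extVanish.of_pdLT [IsNoetherianRing S] {r : ℕ} (h : ∀ i < r, extVanish P S i) (q : ℕ) :
    ∀ {M : Type} [AddCommGroup M] [Module S M] [Module.Finite S M], pdLT S M (q + 1) →
      ∀ i, i + q < r → extVanish P M i := by
  induction q with
  | zero =>
    intro M _ _ _ hM i hi
    have := pdLT_one_iff.1 hM
    exact extVanish.of_projective (h i hi)
  | succ q ih =>
    intro M _ _ _ hM i hi
    obtain ⟨n, g, hg⟩ := Module.Finite.exists_fin' S M
    have hk := pdLT.ker_of_projective hg inferInstance hM
    exact extVanish.right (f := (LinearMap.ker g).subtype) (Submodule.injective_subtype _)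
      (LinearMap.exact_subtype_ker_map g) hg ((h i (by omega)).pi n) (ih hk (i + 1) (by omega))

/-- A second syzygy has vanishing `Ext^1` from quotients by ideals of grade at least two. -/
lemma extVanish.ker [Module.Finite S M] [Module.Projective S M]
    [Module.Finite S N] [Module.Projective S N] (f : M →ₗ[S] N)
    (h : ∀ i < 2, extVanish P S i) : extVanish P (LinearMap.ker f) 1 := by
  refine extVanish.left (f := (LinearMap.ker f).subtype) (g := f.rangeRestrict)
    (Submodule.injective_subtype _) (fun x => ?_) f.surjective_rangeRestrict ?_
    (extVanish.of_projective (h 1 (by omega)))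
  · simp [Subtype.ext_iff]
  · have h0 : extVanish P N 0 := extVanish.of_projective (h 0 (by omega))
    rw [extVanish_zero_iff] at h0 ⊢
    intro x hx
    exact Subtype.ext (h0 x fun s hs => congrArg Subtype.val (hx s hs))

open RingTheory.Sequence in
lemma extVanish_of_isRegular [IsNoetherianRing S] (hP : P ≠ ⊤) (rs : List S)
    (hrs : ∀ s ∈ rs, s ∈ P) (hreg : IsRegular S rs) (i : ℕ) (hi : i < rs.length) :
    extVanish P S i :=
  ModuleCat.subsingleton_ext_of_exists_isRegular P (ModuleCat.of S (S ⧸ P))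
    (by rw [Module.support_eq_zeroLocus, Ideal.annihilator_quotient])
    (ModuleCat.of S S) (by simpa [lt_top_iff_ne_top] using hP) rs hrs hreg i hi

end ExtVanishing

section Alternating

variable {K : Type} [CommRing K] {W M N : Type} [AddCommGroup W] [Module K W]
  [AddCommGroup M] [Module K M] [AddCommGroup N] [Module K N]

/-- The projection `w ↦ w - c w • v` of `W` along `v`. -/
def projAlong (c : W →ₗ[K] K) (v : W) : W →ₗ[K] W := LinearMap.id - c.smulRight v

@[simp] lemma projAlong_apply (c : W →ₗ[K] K) (v w : W) : projAlong c v w = w - c w • v := rfl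

lemma apply_projAlong {c : W →ₗ[K] K} {v : W} (hv : c v = 1) (w : W) :
    c (projAlong c v w) = 0 := by
  simp [hv]

/-- An alternating map killing all tuples that contain `v` factors through the projection
along `v`. -/
lemma AlternatingMap.apply_projAlong_comp {p : ℕ} (h : W [⋀^Fin p]→ₗ[K] M) (c : W →ₗ[K] K) (v : W)
    (hv : ∀ w : Fin p → W, (∃ i, w i = v) → h w = 0) (w : Fin p → W) :
    h (fun i => projAlong c v (w i)) = h w := by
  have key : ∀ s : Finset (Fin p),
      h (fun i => if i ∈ s then projAlong c v (w i) else w i) = h w := by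
    intro s
    induction s using Finset.induction_on with
    | empty => simp
    | insert a s ha ih =>
      have e1 : (fun i => if i ∈ insert a s then projAlong c v (w i) else w i) =
          Function.update (fun i => if i ∈ s then projAlong c v (w i) else w i) a
            (w a - c (w a) • v) := by
        ext i
        by_cases hi : i = a
        · subst hi; simp
        · simp [hi]
      have e2 : (fun i => if i ∈ s then projAlong c v (w i) else w i) =
          Function.update (fun i => if i ∈ s then projAlong c v (w i) else w i) a (w a) := by
        ext i
        by_cases hi : i = a
        · subst hi; simp [ha]
        · simp [hi]
      rw [e1, h.map_update_sub, h.map_update_smul, hv (Function.update _ a v)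
        ⟨a, by simp⟩, smul_zero, sub_zero, ← e2, ih]
  simpa using key Finset.univ

lemma AlternatingMap.curryLeft_projAlong_comp {p : ℕ} (h : W [⋀^Fin (p + 1)]→ₗ[K] M)
    (c : W →ₗ[K] K) (v : W) (w : Fin p → W) :
    h.curryLeft v (fun i => projAlong c v (w i)) = h.curryLeft v w := by
  refine AlternatingMap.apply_projAlong_comp _ c v ?_ w
  rintro w ⟨i, hi⟩
  rw [AlternatingMap.curryLeft_apply_apply]
  exact h.map_eq_zero_of_eq _ (i := 0) (j := i.succ) (by simp [hi]) (Fin.succ_ne_zero i).symm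

lemma AlternatingMap.apply_eq_curryLeft {p : ℕ} (h : W [⋀^Fin (p + 1)]→ₗ[K] M) (w : Fin (p + 1) → W)
    (i : Fin (p + 1)) : h w = (-1 : ℤ) ^ (i : ℕ) • h.curryLeft (w i) (i.removeNth w) := by
  have := AlternatingMap.map_insertNth h i (w i) (i.removeNth w)
  rwa [Fin.insertNth_self_removeNth] at this

/-- Splitting off the part of an alternating map that does not factor through the projection
along `v`. -/
lemma AlternatingMap.apply_eq_add_alternatize {p : ℕ} (g : W [⋀^Fin (p + 1)]→ₗ[K] M)
    {c : W →ₗ[K] K} {v : W} (hv : c v = 1) (w : Fin (p + 1) → W) :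
    g w = g (fun i => projAlong c v (w i)) +
      AlternatingMap.alternatizeUncurryFin (c.smulRight (g.curryLeft v)) w := by
  set θ := AlternatingMap.alternatizeUncurryFin (c.smulRight (g.curryLeft v)) with hθ
  have h0 : ∀ w : Fin (p + 1) → W, (∃ i, w i = v) → (g - θ) w = 0 := by
    rintro w ⟨i, hi⟩
    rw [AlternatingMap.sub_apply, sub_eq_zero, hθ, AlternatingMap.alternatizeUncurryFin_apply,
      Finset.sum_eq_single i]
    · rw [g.apply_eq_curryLeft w i, LinearMap.smulRight_apply, hi, hv, one_smul]
    · intro j _ hj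
      obtain ⟨k, hk⟩ := Fin.exists_succAbove_eq hj.symm
      have : g.curryLeft v (j.removeNth w) = 0 := by
        rw [AlternatingMap.curryLeft_apply_apply]
        refine g.map_eq_zero_of_eq _ (i := 0) (j := k.succ) ?_ (Fin.succ_ne_zero k).symm
        simp [Fin.removeNth, hk, hi]
      rw [LinearMap.smulRight_apply, AlternatingMap.smul_apply, this, smul_zero, smul_zero]
    · simp
  have h1 := AlternatingMap.apply_projAlong_comp (g - θ) c v h0 w
  have h2 : θ (fun i => projAlong c v (w i)) = 0 := by
    rw [hθ, AlternatingMap.alternatizeUncurryFin_apply]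
    refine Finset.sum_eq_zero fun i _ => ?_
    rw [LinearMap.smulRight_apply, apply_projAlong hv, zero_smul, AlternatingMap.zero_apply,
      smul_zero]
  rw [AlternatingMap.sub_apply, AlternatingMap.sub_apply, h2, sub_zero] at h1
  rw [h1]; simp

/-- Membership of all values of an alternating map in a submodule can be tested on tuples in
`ker c` and on tuples consisting of `v` and elements of `ker c`. -/
lemma AlternatingMap.apply_mem_of_ker {p : ℕ} (g : W [⋀^Fin p]→ₗ[K] M) (D : Submodule K M)
    {c : W →ₗ[K] K} {v : W} (hv : c v = 1)
    (h0 : ∀ w : Fin p → W, (∀ i, c (w i) = 0) → g w ∈ D)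
    (h1 : ∀ (w : Fin p → W) (i : Fin p), w i = v → (∀ j, j ≠ i → c (w j) = 0) → g w ∈ D)
    (w : Fin p → W) : g w ∈ D := by
  cases p with
  | zero => exact h0 w (fun i => i.elim0)
  | succ p =>
    rw [g.apply_eq_add_alternatize hv w, AlternatingMap.alternatizeUncurryFin_apply]
    refine D.add_mem (h0 _ fun i => apply_projAlong hv _) (D.sum_mem fun i _ => ?_)
    rw [LinearMap.smulRight_apply, AlternatingMap.smul_apply]
    refine zsmul_mem (D.smul_mem _ ?_) _
    rw [← g.curryLeft_projAlong_comp c v, AlternatingMap.curryLeft_apply_apply]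
    refine h1 _ 0 (by simp) ?_
    intro j
    refine Fin.cases (fun h => absurd rfl h) (fun j _ => ?_) j
    rw [Matrix.cons_val_succ]
    exact apply_projAlong hv _

lemma AlternatingMap.exists_eq_compAlternatingMap {ι : Type} (g : W [⋀^ι]→ₗ[K] N) (f : M →ₗ[K] N)
    (hf : Function.Injective f) (h : ∀ w, g w ∈ LinearMap.range f) :
    ∃ g' : W [⋀^ι]→ₗ[K] M, f.compAlternatingMap g' = g := by
  refine ⟨(LinearEquiv.ofInjective f hf).symm.toLinearMap.compAlternatingMap
    (g.codRestrict _ h), ?_⟩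
  ext w
  exact congrArg Subtype.val ((LinearEquiv.ofInjective f hf).apply_symm_apply ⟨g w, h w⟩)

end Alternating

section Divisibility

variable {K : Type} [CommRing K] {W S : Type} [AddCommGroup W] [Module K W]
  [CommRing S] [Algebra K S]

lemma AlternatingMap.exists_eq_smul [IsDomain S] {ι : Type} (g : W [⋀^ι]→ₗ[K] S) {a : S}
    (ha : a ≠ 0) (h : ∀ w, a ∣ g w) : ∃ g' : W [⋀^ι]→ₗ[K] S, g = a • g' := by
  obtain ⟨g', hg'⟩ := g.exists_eq_compAlternatingMap (LinearMap.mulLeft K a)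
    (mul_right_injective₀ ha) (fun w => by
      obtain ⟨b, hb⟩ := h w
      exact ⟨b, hb.symm⟩)
  exact ⟨g', by rw [← hg']; rfl⟩

lemma AlternatingMap.dvd_apply_of_ker {p : ℕ} (g : W [⋀^Fin p]→ₗ[K] S) (a : S)
    {c : W →ₗ[K] K} {v : W} (hv : c v = 1)
    (h0 : ∀ w : Fin p → W, (∀ i, c (w i) = 0) → a ∣ g w)
    (h1 : ∀ (w : Fin p → W) (i : Fin p), w i = v → (∀ j, j ≠ i → c (w j) = 0) → a ∣ g w)
    (w : Fin p → W) : a ∣ g w := by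
  have := g.apply_mem_of_ker (LinearMap.range (LinearMap.mulLeft K a)) hv
    (fun w hw => (h0 w hw).imp fun b hb => hb.symm)
    (fun w i hi hw => (h1 w i hi hw).imp fun b hb => hb.symm) w
  exact this.imp fun b hb => hb.symm

end Divisibility

section Evaluation

variable {K S : Type} [Field K] [CommRing S] [Algebra K S] {W D N : Type} [AddCommGroup W]
  [Module K W] [AddCommGroup D] [Module S D] [Module K D] [IsScalarTower K S D]
  [AddCommGroup N] [Module S N] [Module K N] [IsScalarTower K S N]

/-- Restriction of an `S`-alternating map along a `K`-linear map. -/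
def AlternatingMap.restrictAlong {ι : Type} (G : D [⋀^ι]→ₗ[S] N) (φ : W →ₗ[K] D) :
    W [⋀^ι]→ₗ[K] N :=
  { (G.toMultilinearMap.restrictScalars K).compLinearMap (fun _ => φ) with
    map_eq_zero_of_eq' := fun _ _ _ hv hij =>
      G.map_eq_zero_of_eq _ (congrArg φ hv) hij }

@[simp] lemma AlternatingMap.restrictAlong_apply {ι : Type} (G : D [⋀^ι]→ₗ[S] N)
    (φ : W →ₗ[K] D) (v : ι → W) : G.restrictAlong φ v = G (fun i => φ (v i)) := rfl

/-- Evaluation of alternating maps at increasing tuples of basis vectors. -/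
def altEval (S N : Type) [CommRing S] [Algebra K S] [AddCommGroup N] [Module S N] [Module K N]
    [IsScalarTower K S N] {I : Type} [LinearOrder I] (b : Module.Basis I K W) (p : ℕ) :
    (W [⋀^Fin p]→ₗ[K] N) →ₗ[S] (Set.powersetCard I p → N) where
  toFun f s := f (b ∘ Set.powersetCard.ofFinEmbEquiv.symm s)
  map_add' _ _ := rfl
  map_smul' _ _ := rfl

lemma altEval_bijective {I : Type} [LinearOrder I] (b : Module.Basis I K W) (p : ℕ) :
    Function.Bijective (altEval S N b p) := by
  have key : ∀ f : W [⋀^Fin p]→ₗ[K] N, ∀ s, exteriorPower.alternatingMapLinearEquiv f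
      (b.exteriorPower p s) = altEval S N b p f s := by
    intro f s
    rw [exteriorPower.basis_apply, exteriorPower.ιMulti_family,
      exteriorPower.alternatingMapLinearEquiv_apply_ιMulti]
    rfl
  constructor
  · refine (injective_iff_map_eq_zero _).2 fun f hf => ?_
    apply (exteriorPower.alternatingMapLinearEquiv (R := K) (M := W) (N := N) (n := p)).injective
    rw [map_zero]
    refine (b.exteriorPower p).ext fun s => ?_
    rw [key, hf]; rfl
  · intro g
    refine ⟨exteriorPower.alternatingMapLinearEquiv.symm ((b.exteriorPower p).constr K g), ?_⟩
    ext s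
    rw [← key, LinearEquiv.apply_symm_apply, Module.Basis.constr_basis]

instance AlternatingMap.free_of_finiteDimensional [FiniteDimensional K W] (p : ℕ) :
    Module.Free S (W [⋀^Fin p]→ₗ[K] S) :=
  Module.Free.of_equiv (LinearEquiv.ofBijective _
    (altEval_bijective (S := S) (N := S) (Module.finBasis K W) p)).symm

instance AlternatingMap.finite_of_finiteDimensional [FiniteDimensional K W] (p : ℕ) :
    Module.Finite S (W [⋀^Fin p]→ₗ[K] S) :=
  Module.Finite.equiv (LinearEquiv.ofBijective _
    (altEval_bijective (S := S) (N := S) (Module.finBasis K W) p)).symm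

end Evaluation

section LogForms

variable {K : Type} [Field K] {ℓ : ℕ}

lemma dotLin_apply (c v : Fin ℓ → K) : dotLin c v = ∑ i, c i * v i := by
  simp [dotLin]

lemma dotLin_single (c : Fin ℓ → K) (i : Fin ℓ) : dotLin c (Pi.single i 1) = c i := by
  simp [dotLin_apply, Pi.single_apply]

lemma exists_dotLin_eq_one {c : Fin ℓ → K} (hc : c ≠ 0) : ∃ v, dotLin c v = 1 := by
  obtain ⟨i, hi⟩ := Function.ne_iff.1 hc
  refine ⟨(c i)⁻¹ • Pi.single i 1, ?_⟩
  rw [map_smul, dotLin_single, smul_eq_mul, inv_mul_cancel₀ hi]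

/-- Constant vectors as functionals on `S^ℓ`. -/
def constDual (K : Type) [Field K] (ℓ : ℕ) :
    (Fin ℓ → K) →ₗ[K] Module.Dual (PS K ℓ) (Fin ℓ → PS K ℓ) where
  toFun v := ∑ k, v k • LinearMap.proj k
  map_add' v w := by simp [add_smul, Finset.sum_add_distrib]
  map_smul' t v := by simp [mul_smul, Finset.smul_sum]

lemma constDual_apply (v : Fin ℓ → K) (f : Fin ℓ → PS K ℓ) :
    constDual K ℓ v f = ∑ k, v k • f k := by
  simp [constDual]

lemma constDual_apply_C (v c : Fin ℓ → K) :
    constDual K ℓ v (fun i => C (c i)) = algebraMap K _ (dotLin c v) := by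
  rw [constDual_apply, dotLin_apply, map_sum]
  refine Finset.sum_congr rfl fun k _ => ?_
  rw [Algebra.smul_def, algebraMap_eq, ← map_mul, mul_comm]

/-- A polynomial `p`-form as an alternating map on `K^ℓ` with polynomial values. -/
def formAlt (K : Type) [Field K] (ℓ p : ℕ) :
    ⋀[PS K ℓ]^p (Fin ℓ → PS K ℓ) →ₗ[PS K ℓ] ((Fin ℓ → K) [⋀^Fin p]→ₗ[K] PS K ℓ) where
  toFun η := (((LinearMap.applyₗ η).comp (exteriorPower.pairingDual (PS K ℓ) (Fin ℓ → PS K ℓ) p)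
    ).compAlternatingMap (exteriorPower.ιMulti _ p)).restrictAlong (constDual K ℓ)
  map_add' η ξ := by ext v; simp
  map_smul' s η := by ext1 v; simp

lemma formAlt_apply (p : ℕ) (η : ⋀[PS K ℓ]^p (Fin ℓ → PS K ℓ)) (v : Fin p → Fin ℓ → K) :
    formAlt K ℓ p η v = exteriorPower.pairingDual (PS K ℓ) (Fin ℓ → PS K ℓ) p
      (exteriorPower.ιMulti _ p fun i => constDual K ℓ (v i)) η := rfl

lemma formAlt_ιMulti (p : ℕ) (f : Fin p → Fin ℓ → PS K ℓ) (v : Fin p → Fin ℓ → K) :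
    formAlt K ℓ p (exteriorPower.ιMulti _ p f) v =
      (Matrix.of fun i j => constDual K ℓ (v j) (f i)).det := by
  rw [formAlt_apply, exteriorPower.pairingDual_ιMulti_ιMulti]

lemma formAlt_bijective (p : ℕ) : Function.Bijective (formAlt K ℓ p) := by
  have h : ⇑(altEval (PS K ℓ) (PS K ℓ) (Pi.basisFun K (Fin ℓ)) p) ∘ formAlt K ℓ p =
      ((Pi.basisFun (PS K ℓ) (Fin ℓ)).exteriorPower p).equivFun := by
    ext1 η
    ext1 s
    rw [Function.comp_apply, Module.Basis.equivFun_apply, exteriorPower.basis_repr_apply]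
    change formAlt K ℓ p η _ = _
    rw [formAlt_apply, exteriorPower.ιMultiDual, exteriorPower.ιMulti_family]
    congr 3
    ext1 i
    refine LinearMap.ext fun f => ?_
    simp [constDual_apply, Pi.single_apply]
  have hb := altEval_bijective (S := PS K ℓ) (N := PS K ℓ) (Pi.basisFun K (Fin ℓ)) p
  have hc : Function.Bijective
      (⇑(altEval (PS K ℓ) (PS K ℓ) (Pi.basisFun K (Fin ℓ)) p) ∘ formAlt K ℓ p) := by
    rw [h]; exact LinearEquiv.bijective _
  exact (Function.Bijective.of_comp_iff' hb _).1 hc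

/-- Multiplication by `dα` maps `p`-forms to `(p+1)`-forms. -/
def dMul (c : Fin ℓ → K) (p : ℕ) : ⋀[PS K ℓ]^p (Fin ℓ → PS K ℓ) →ₗ[PS K ℓ]
    ⋀[PS K ℓ]^(p + 1) (Fin ℓ → PS K ℓ) :=
  (LinearMap.mulLeft (PS K ℓ) (dP c)).restrict fun η hη => by
    rw [LinearMap.mulLeft_apply, ExteriorAlgebra.exteriorPower, pow_succ']
    exact Submodule.mul_mem_mul ⟨_, rfl⟩ hη

lemma formAlt_dMul (c : Fin ℓ → K) (p : ℕ) (η : ⋀[PS K ℓ]^p (Fin ℓ → PS K ℓ)) :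
    formAlt K ℓ (p + 1) (dMul c p η) =
      AlternatingMap.alternatizeUncurryFin ((dotLin c).smulRight (formAlt K ℓ p η)) := by
  ext1 v
  rw [AlternatingMap.alternatizeUncurryFin_apply]
  have hη : η ∈ Submodule.span (PS K ℓ) (Set.range (exteriorPower.ιMulti (PS K ℓ) p)) := by
    rw [exteriorPower.ιMulti_span]; trivial
  induction hη using Submodule.span_induction with
  | zero => simp
  | add x y _ _ hx hy =>
    simp only [map_add, AlternatingMap.add_apply, LinearMap.smulRight_apply, smul_add,
      Finset.sum_add_distrib] at hx hy ⊢
    rw [hx, hy]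
  | smul a x _ hx =>
    simp only [map_smul, AlternatingMap.smul_apply, LinearMap.smulRight_apply] at hx ⊢
    rw [hx, Finset.smul_sum]
    refine Finset.sum_congr rfl fun i _ => ?_
    rw [smul_comm a, smul_comm a]
  | mem x hx =>
    obtain ⟨f, rfl⟩ := hx
    have e : dMul c p (exteriorPower.ιMulti (PS K ℓ) p f) =
        exteriorPower.ιMulti (PS K ℓ) (p + 1)
          (Matrix.vecCons (fun i => C (c i)) f : Fin (p + 1) → Fin ℓ → PS K ℓ) := by
      apply Subtype.ext
      rw [exteriorPower.ιMulti_apply_coe, ExteriorAlgebra.ιMulti_succ_apply]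
      rfl
    rw [e, formAlt_ιMulti, Matrix.det_succ_row_zero]
    refine Finset.sum_congr rfl fun i _ => ?_
    rw [LinearMap.smulRight_apply, AlternatingMap.smul_apply, formAlt_ιMulti]
    simp only [Matrix.of_apply, Matrix.cons_val_zero, constDual_apply_C]
    rw [mul_assoc, ← Algebra.smul_def, zsmul_eq_mul]
    push_cast
    rfl

/-- Polynomial models of logarithmic forms, as alternating maps. -/
def lf (T : Finset (Fin ℓ → K)) (m : (Fin ℓ → K) → ℕ) (p : ℕ) :
    Submodule (PS K ℓ) ((Fin ℓ → K) [⋀^Fin p]→ₗ[K] PS K ℓ) where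
  carrier := {η | ∀ c ∈ T, ∀ v : Fin p → Fin ℓ → K, (∀ i, dotLin c (v i) = 0) →
    linP c ^ m c ∣ η v}
  add_mem' hη hξ c hc v hv := dvd_add (hη c hc v hv) (hξ c hc v hv)
  zero_mem' _ _ _ _ := dvd_zero _
  smul_mem' s _ hη c hc v hv := Dvd.dvd.mul_left (hη c hc v hv) s

lemma mem_lf {T : Finset (Fin ℓ → K)} {m : (Fin ℓ → K) → ℕ} {p : ℕ}
    {η : (Fin ℓ → K) [⋀^Fin p]→ₗ[K] PS K ℓ} :
    η ∈ lf T m p ↔ ∀ c ∈ T, ∀ v : Fin p → Fin ℓ → K, (∀ i, dotLin c (v i) = 0) →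
      linP c ^ m c ∣ η v := Iff.rfl

lemma AlternatingMap.dvd_alternatize_iff {W S : Type} [AddCommGroup W] [Module K W] [CommRing S]
    [Algebra K S] {c : W →ₗ[K] K} {v₀ : W} (hv₀ : c v₀ = 1) {p : ℕ}
    (g : W [⋀^Fin p]→ₗ[K] S) (a : S) :
    (∀ w, a ∣ AlternatingMap.alternatizeUncurryFin (c.smulRight g) w) ↔
      ∀ v : Fin p → W, (∀ i, c (v i) = 0) → a ∣ g v := by
  constructor
  · intro h v hv
    have := h (Matrix.vecCons v₀ v)
    rw [AlternatingMap.alternatizeUncurryFin_apply, Fin.sum_univ_succ] at this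
    simpa [hv, hv₀, Fin.removeNth] using this
  · intro h w
    refine AlternatingMap.dvd_apply_of_ker _ a hv₀ ?_ ?_ w
    · intro w hw
      rw [AlternatingMap.alternatizeUncurryFin_apply]
      simp [hw]
    · intro w i hi hw
      rw [AlternatingMap.alternatizeUncurryFin_apply, Finset.sum_eq_single i]
      · rw [zsmul_eq_mul]
        refine Dvd.dvd.mul_left ?_ _
        rw [LinearMap.smulRight_apply, hi, hv₀, one_smul]
        exact h _ fun j => hw _ (Fin.succAbove_ne i j)
      · intro j _ hj
        rw [LinearMap.smulRight_apply, hw j hj, zero_smul, AlternatingMap.zero_apply, smul_zero]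
      · simp

lemma linP_ne_zero {c : Fin ℓ → K} (hc : c ≠ 0) : linP c ≠ 0 := by
  intro h
  apply hc
  ext i
  have := congrArg (MvPolynomial.eval (Pi.single i 1)) h
  simpa [linP, Pi.single_apply] using this

lemma mem_Omega_iff (A : Arrangement K ℓ) (m : (Fin ℓ → K) → ℕ) (p : ℕ)
    (η : ⋀[PS K ℓ]^p (Fin ℓ → PS K ℓ)) :
    (η : ExtF K ℓ) ∈ Omega A m p ↔ formAlt K ℓ p η ∈ lf A.hyps m p := by
  have h0 : (η : ExtF K ℓ) ∈ formsP K ℓ p := η.2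
  rw [Omega, Submodule.mem_inf, and_iff_right h0, mem_lf]
  simp only [Submodule.mem_iInf]
  refine forall₂_congr fun c hc => ?_
  obtain ⟨v₀, hv₀⟩ := exists_dotLin_eq_one (A.ne_zero c hc)
  rw [← AlternatingMap.dvd_alternatize_iff hv₀, ← formAlt_dMul]
  constructor
  · rintro ⟨ξ, hξ, h⟩ w
    have h' : linP c ^ m c • (⟨ξ, hξ⟩ : ⋀[PS K ℓ]^(p + 1) (Fin ℓ → PS K ℓ)) = dMul c p η :=
      Subtype.ext h
    rw [← h', map_smul, AlternatingMap.smul_apply, smul_eq_mul]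
    exact dvd_mul_right _ _
  · intro h
    obtain ⟨g, hg⟩ := AlternatingMap.exists_eq_smul _
      (pow_ne_zero (m c) (linP_ne_zero (A.ne_zero c hc))) h
    obtain ⟨ξ, rfl⟩ := (formAlt_bijective (p + 1)).2 g
    rw [← map_smul] at hg
    have := (formAlt_bijective (p + 1)).1 hg
    exact ⟨ξ, ξ.2, (congrArg Subtype.val this).symm⟩

/-- The two models of logarithmic forms agree. -/
def omegaEquiv (A : Arrangement K ℓ) (m : (Fin ℓ → K) → ℕ) (p : ℕ) :
    Omega A m p ≃ₗ[PS K ℓ] lf A.hyps m p :=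
  LinearEquiv.ofBijective
    (((formAlt K ℓ p).comp (Submodule.inclusion (inf_le_left : Omega A m p ≤ formsP K ℓ p))
      ).codRestrict (lf A.hyps m p) fun η => (mem_Omega_iff A m p ⟨η, η.2.1⟩).1 η.2) (by
    constructor
    · intro η ξ h
      have := (formAlt_bijective p).1 (congrArg Subtype.val h)
      exact Submodule.inclusion_injective _ this
    · rintro ⟨g, hg⟩
      obtain ⟨ξ, rfl⟩ := (formAlt_bijective p).2 g
      exact ⟨⟨ξ, (mem_Omega_iff A m p ξ).2 hg⟩, rfl⟩)

lemma omegaEquiv_apply (A : Arrangement K ℓ) (m : (Fin ℓ → K) → ℕ) (p : ℕ) (η : Omega A m p) :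
    (omegaEquiv A m p η : (Fin ℓ → K) [⋀^Fin p]→ₗ[K] PS K ℓ) = formAlt K ℓ p ⟨η, η.2.1⟩ := rfl

lemma formAlt_one_apply (η : ⋀[PS K ℓ]^1 (Fin ℓ → PS K ℓ)) (v : Fin 1 → Fin ℓ → K) :
    formAlt K ℓ 1 η v = constDual K ℓ (v 0) (ExteriorAlgebra.ιInv (η : ExtF K ℓ)) := by
  have hη : η ∈ Submodule.span (PS K ℓ) (Set.range (exteriorPower.ιMulti (PS K ℓ) 1)) := by
    rw [exteriorPower.ιMulti_span]; trivial
  induction hη using Submodule.span_induction with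
  | zero => simp
  | add x y _ _ hx hy => simp [hx, hy]
  | smul a x _ hx => simp [hx]
  | mem x hx =>
    obtain ⟨f, rfl⟩ := hx
    rw [formAlt_ιMulti, exteriorPower.ιMulti_apply_coe, ExteriorAlgebra.ιMulti_apply]
    simp [ExteriorAlgebra.ι_leftInverse _]

lemma IsHomogForm.isHomogeneous_formAlt {d : ℕ} {η : ⋀[PS K ℓ]^1 (Fin ℓ → PS K ℓ)}
    (h : IsHomogForm 1 d (η : ExtF K ℓ)) (v : Fin 1 → Fin ℓ → K) :
    (formAlt K ℓ 1 η v).IsHomogeneous d := by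
  rw [formAlt_one_apply]
  generalize (η : ExtF K ℓ) = ξ at h
  rw [IsHomogForm] at h
  induction h using AddSubgroup.closure_induction with
  | zero => simpa using isHomogeneous_zero _ _ _
  | add x y _ _ hx hy => rw [map_add, map_add]; exact hx.add hy
  | neg x _ hx =>
    rw [map_neg, map_neg]
    exact (homogeneousSubmodule (Fin ℓ) K d).neg_mem hx
  | mem x hx =>
    obtain ⟨f, l, hf, hl, rfl⟩ := hx
    obtain ⟨i, rfl⟩ := List.length_eq_one_iff.1 hl
    rw [wedgeList, List.map_singleton, List.prod_singleton, map_smul,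
      ExteriorAlgebra.ι_leftInverse, map_smul, constDual_apply]
    have : (∑ k, v 0 k • (Pi.single i (1 : PS K ℓ) : Fin ℓ → PS K ℓ) k) = C (v 0 i) := by
      rw [Finset.sum_eq_single i] <;> simp +contextual [Algebra.smul_def, algebraMap_eq]
    rw [this, smul_eq_mul]
    simpa using hf.mul (isHomogeneous_C (Fin ℓ) (v 0 i))

end LogForms

section

variable {k : Type} [CommRing k] (S : Type) [CommRing S] [Algebra k S] {W W' : Type}
  [AddCommGroup W] [Module k W] [AddCommGroup W'] [Module k W']

/-- Restriction of alternating maps along a linear map, as a linear map. -/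
def altComp (f : W →ₗ[k] W') (p : ℕ) :
    (W' [⋀^Fin p]→ₗ[k] S) →ₗ[S] (W [⋀^Fin p]→ₗ[k] S) where
  toFun η := η.compLinearMap f
  map_add' _ _ := rfl
  map_smul' _ _ := rfl

variable {S}

lemma altComp_apply (f : W →ₗ[k] W') (p : ℕ) (η : W' [⋀^Fin p]→ₗ[k] S) (v : Fin p → W) :
    altComp S f p η v = η (fun i => f (v i)) := rfl

end

section LinearForms

variable {K : Type} [Field K] {ℓ : ℕ}

/-- `linP` as a linear map. -/
def linPHom (K : Type) [Field K] (ℓ : ℕ) : (Fin ℓ → K) →ₗ[K] PS K ℓ where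
  toFun := linP
  map_add' c d := by simp [linP, add_mul, Finset.sum_add_distrib]
  map_smul' t c := by
    simp [linP, mul_assoc, Finset.mul_sum, Algebra.smul_def, algebraMap_eq]

lemma linPHom_apply (c : Fin ℓ → K) : linPHom K ℓ c = linP c := rfl

lemma linP_smul (t : K) (c : Fin ℓ → K) : linP (t • c) = C t * linP c := by
  rw [← linPHom_apply, map_smul, Algebra.smul_def]; rfl

lemma linP_single (i : Fin ℓ) : linP (Pi.single i (1 : K)) = X i := by
  rw [linP, Finset.sum_eq_single i] <;> simp +contextual

lemma linP_injective : Function.Injective (linP : (Fin ℓ → K) → PS K ℓ) := by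
  refine (injective_iff_map_eq_zero (linPHom K ℓ)).2 fun c hc => ?_
  by_contra h
  exact linP_ne_zero h hc

lemma linP_isHomogeneous (c : Fin ℓ → K) : (linP c).IsHomogeneous 1 := by
  refine IsHomogeneous.sum _ _ _ fun i _ => ?_
  simpa using (isHomogeneous_C (Fin ℓ) (c i)).mul (isHomogeneous_X K i)

/-- The ideal generated by a space of linear forms. -/
def linIdeal (U : Submodule K (Fin ℓ → K)) : Ideal (PS K ℓ) := Ideal.span (linP '' U)

lemma linIdeal_span (s : Set (Fin ℓ → K)) :
    linIdeal (Submodule.span K s) = Ideal.span (linP '' s) := by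
  refine le_antisymm (Ideal.span_le.2 ?_)
    (Ideal.span_mono (Set.image_mono Submodule.subset_span))
  have : Submodule.span K s ≤
      ((Ideal.span (linP '' s)).restrictScalars K).comap (linPHom K ℓ) :=
    Submodule.span_le.2 fun c hc => Ideal.subset_span ⟨c, hc, rfl⟩
  rintro _ ⟨c, hc, rfl⟩
  exact this hc

lemma linIdeal_eq_ker (U : Submodule K (Fin ℓ → K)) : ∃ φ : PS K ℓ →ₐ[K] PS K ℓ,
    linIdeal U = RingHom.ker φ ∧ ∀ c, linP c ∈ RingHom.ker φ ↔ c ∈ U := by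
  obtain ⟨q, hq1, hq2⟩ : ∃ q : (Fin ℓ → K) →ₗ[K] (Fin ℓ → K), (∀ c ∈ U, q c = 0) ∧
      ∀ c, c - q c ∈ U := by
    refine ⟨LinearMap.id - U.subtype.comp U.subtype.leftInverse, fun c hc => ?_, fun c => ?_⟩
    · have := LinearMap.leftInverse_apply_of_inj U.ker_subtype ⟨c, hc⟩
      simp only [Submodule.subtype_apply] at this
      simp [this]
    · simp
  let φ : PS K ℓ →ₐ[K] PS K ℓ := aeval fun i => linP (q (Pi.single i 1))
  have hφ : ∀ c, φ (linP c) = linP (q c) := by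
    intro c
    have : φ.toLinearMap.comp (linPHom K ℓ) = (linPHom K ℓ).comp q := by
      refine (Pi.basisFun K (Fin ℓ)).ext fun i => ?_
      simp [linPHom_apply, linP_single, φ]
    exact LinearMap.congr_fun this c
  have hk : ∀ c, linP c ∈ RingHom.ker φ ↔ c ∈ U := by
    intro c
    rw [RingHom.mem_ker, hφ]
    constructor
    · intro h
      have : q c = 0 := linP_injective (by rw [h]; exact (map_zero (linPHom K ℓ)).symm)
      simpa [this] using hq2 c
    · intro h
      rw [hq1 c h]; exact map_zero (linPHom K ℓ)
  refine ⟨φ, le_antisymm (Ideal.span_le.2 ?_) ?_, hk⟩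
  · rintro _ ⟨c, hc, rfl⟩
    exact (hk c).2 hc
  · intro f hf
    have h : (Ideal.Quotient.mkₐ K (linIdeal U)) =
        (Ideal.Quotient.mkₐ K (linIdeal U)).comp φ := by
      refine MvPolynomial.algHom_ext fun i => ?_
      rw [AlgHom.comp_apply, ← linP_single, hφ]
      refine Ideal.Quotient.eq.2 ?_
      have : linP (Pi.single i 1) - linP (q (Pi.single i 1)) =
          linP (Pi.single i (1 : K) - q (Pi.single i 1)) := (map_sub (linPHom K ℓ) _ _).symm
      rw [this]
      exact Ideal.subset_span ⟨_, hq2 _, rfl⟩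
    have h1 := AlgHom.congr_fun h f
    rw [AlgHom.comp_apply, (RingHom.mem_ker).1 hf, map_zero] at h1
    exact Ideal.Quotient.eq_zero_iff_mem.1 h1

lemma linIdeal_isPrime (U : Submodule K (Fin ℓ → K)) : (linIdeal U).IsPrime := by
  obtain ⟨φ, h, -⟩ := linIdeal_eq_ker U
  rw [h]; exact RingHom.ker_isPrime _

lemma linP_mem_linIdeal {U : Submodule K (Fin ℓ → K)} {c : Fin ℓ → K} :
    linP c ∈ linIdeal U ↔ c ∈ U := by
  obtain ⟨φ, h, h'⟩ := linIdeal_eq_ker U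
  rw [h, h']

lemma linP_dvd_linP {c d : Fin ℓ → K} : linP c ∣ linP d ↔ ∃ t : K, d = t • c := by
  rw [← Ideal.mem_span_singleton, ← Set.image_singleton, ← linIdeal_span, linP_mem_linIdeal,
    Submodule.mem_span_singleton]
  exact exists_congr fun t => eq_comm

lemma linP_prime {c : Fin ℓ → K} (hc : c ≠ 0) : Prime (linP c) := by
  rw [← Ideal.span_singleton_prime (linP_ne_zero hc), ← Set.image_singleton, ← linIdeal_span]
  exact linIdeal_isPrime _

lemma linP_isRegular {r : ℕ} {c : Fin r → Fin ℓ → K} (hc : LinearIndependent K c) :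
    RingTheory.Sequence.IsRegular (PS K ℓ) (List.ofFn fun i => linP (c i)) := by
  refine ⟨(RingTheory.Sequence.isWeaklyRegular_iff_Fin _ _).2 fun i => ?_, ?_⟩
  · have hi : (i : ℕ) < r := by simpa using i.2
    rw [isSMulRegular_quotient_iff_mem_of_smul_mem]
    have e : Ideal.ofList ((List.ofFn fun i => linP (c i)).take i) =
        linIdeal (Submodule.span K (c '' {j | (j : ℕ) < i})) := by
      rw [linIdeal_span, Ideal.ofList, Set.image_image]
      congr 1
      ext x
      simp only [Set.mem_ofPred_eq, Set.mem_image, List.mem_iff_getElem, List.getElem_take,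
        List.getElem_ofFn, List.length_take, List.length_ofFn]
      constructor
      · rintro ⟨k, hk, rfl⟩
        exact ⟨⟨k, by omega⟩, by simp; omega, rfl⟩
      · rintro ⟨j, hj, rfl⟩
        exact ⟨j, by omega, rfl⟩
    intro x hx
    rw [smul_eq_mul, Ideal.mul_top, e] at hx ⊢
    refine ((linIdeal_isPrime _).mem_or_mem hx).resolve_left fun h => ?_
    have h' : linP (c ⟨i, hi⟩) ∈ linIdeal (Submodule.span K (c '' {j | (j : ℕ) < i})) := by
      simpa using h
    rw [linP_mem_linIdeal] at h'
    exact hc.notMem_span_image (by simp) h'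
  · rw [smul_eq_mul, Ideal.mul_top]
    intro h
    have h1 : Ideal.ofList (List.ofFn fun i => linP (c i)) ≤
        RingHom.ker (MvPolynomial.eval (0 : Fin ℓ → K)) := by
      refine Ideal.span_le.2 fun x hx => ?_
      obtain ⟨i, rfl⟩ := (List.mem_ofFn' _ _).1 hx
      simp [RingHom.mem_ker, linP]
    rw [← h] at h1
    exact RingHom.ker_ne_top _ (top_le_iff.1 h1)

lemma extVanish_of_linearIndependent {P : Ideal (PS K ℓ)} (hP : P ≠ ⊤) {r : ℕ}
    {c : Fin r → Fin ℓ → K} (hc : LinearIndependent K c) (hcP : ∀ i, linP (c i) ∈ P)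
    (i : ℕ) (hi : i < r) : extVanish P (PS K ℓ) i := by
  refine extVanish_of_isRegular hP _ (fun s hs => ?_) (linP_isRegular hc) i (by simpa using hi)
  obtain ⟨i, rfl⟩ := (List.mem_ofFn' _ _).1 hs
  exact hcP i

lemma Arrangement.not_linP_dvd (A : Arrangement K ℓ) {c d : Fin ℓ → K} (hc : c ∈ A.hyps)
    (hd : d ∈ A.hyps) (h : c ≠ d) : ¬ linP c ∣ linP d := by
  rw [linP_dvd_linP]
  rintro ⟨t, ht⟩
  exact A.nonprop d hd c hc h.symm t ht

lemma Arrangement.not_linP_dvd_prod (A : Arrangement K ℓ) {c : Fin ℓ → K} (hc : c ∈ A.hyps)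
    {T : Finset (Fin ℓ → K)} (hT : T ⊆ A.hyps) (hcT : c ∉ T) (k : (Fin ℓ → K) → ℕ) :
    ¬ linP c ∣ ∏ d ∈ T, linP d ^ k d := by
  have hp := linP_prime (A.ne_zero c hc)
  rw [hp.dvd_finsetProd_iff]
  rintro ⟨d, hd, h⟩
  exact A.not_linP_dvd hc (hT hd) (fun h => hcT (h ▸ hd)) (hp.dvd_of_dvd_pow h)

lemma Arrangement.prod_dvd (A : Arrangement K ℓ) {T : Finset (Fin ℓ → K)} (hT : T ⊆ A.hyps)
    (k : (Fin ℓ → K) → ℕ) {x : PS K ℓ} (h : ∀ c ∈ T, linP c ^ k c ∣ x) :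
    ∏ c ∈ T, linP c ^ k c ∣ x := by
  induction T using Finset.induction_on with
  | empty => simp
  | insert c T hcT ih =>
    have hc := hT (Finset.mem_insert_self c T)
    have hT' := (Finset.subset_insert c T).trans hT
    obtain ⟨y, rfl⟩ := ih hT' fun d hd => h d (Finset.mem_insert_of_mem hd)
    rw [Finset.prod_insert hcT, mul_comm]
    exact mul_dvd_mul_left _ ((linP_prime (A.ne_zero c hc)).pow_dvd_of_dvd_mul_left _
      (A.not_linP_dvd_prod hc hT' hcT k) (h c (Finset.mem_insert_self c T)))

/-- A presentation of `lf T m p` as a second syzygy. -/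
def lfSyzygy (T : Finset (Fin ℓ → K)) (m : (Fin ℓ → K) → ℕ) (p : ℕ) :
    (((Fin ℓ → K) [⋀^Fin p]→ₗ[K] PS K ℓ) × (∀ c : T,
      (LinearMap.ker (dotLin (c : Fin ℓ → K))) [⋀^Fin p]→ₗ[K] PS K ℓ)) →ₗ[PS K ℓ]
    (∀ c : T, (LinearMap.ker (dotLin (c : Fin ℓ → K))) [⋀^Fin p]→ₗ[K] PS K ℓ) :=
  LinearMap.pi fun c =>
    (altComp (PS K ℓ) (LinearMap.ker (dotLin (c : Fin ℓ → K))).subtype p).comp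
      (LinearMap.fst _ _ _) -
    (linP (c : Fin ℓ → K) ^ m c) • ((LinearMap.proj c).comp (LinearMap.snd _ _ _))

lemma mem_ker_lfSyzygy {T : Finset (Fin ℓ → K)} {m : (Fin ℓ → K) → ℕ} {p : ℕ} {x} :
    x ∈ LinearMap.ker (lfSyzygy T m p) ↔ ∀ c : T,
      altComp (PS K ℓ) (LinearMap.ker (dotLin (c : Fin ℓ → K))).subtype p x.1 =
        linP (c : Fin ℓ → K) ^ m c • x.2 c := by
  rw [LinearMap.mem_ker, funext_iff]
  exact forall_congr' fun c => sub_eq_zero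

lemma lf_equiv_ker (A : Arrangement K ℓ) (m : (Fin ℓ → K) → ℕ) (p : ℕ) :
    Nonempty (LinearMap.ker (lfSyzygy A.hyps m p) ≃ₗ[PS K ℓ] lf A.hyps m p) := by
  have h1 : ∀ x : LinearMap.ker (lfSyzygy A.hyps m p), x.1.1 ∈ lf A.hyps m p := by
    intro x c hc v hv
    have := DFunLike.congr_fun (mem_ker_lfSyzygy.1 x.2 ⟨c, hc⟩) (fun i => ⟨v i, hv i⟩)
    rw [altComp_apply] at this
    simp only [Submodule.subtype_apply] at this
    rw [this]
    exact dvd_mul_right _ _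
  refine ⟨LinearEquiv.ofBijective (((LinearMap.fst _ _ _).comp
    (LinearMap.ker (lfSyzygy A.hyps m p)).subtype).codRestrict _ h1) ⟨?_, ?_⟩⟩
  · refine (injective_iff_map_eq_zero _).2 fun x hx => ?_
    have hx1 : x.1.1 = 0 := congrArg Subtype.val hx
    refine Subtype.ext (Prod.ext hx1 (funext fun c => ?_))
    have := mem_ker_lfSyzygy.1 x.2 c
    rw [hx1, map_zero] at this
    ext1 v
    have h2 := DFunLike.congr_fun this v
    exact (mul_eq_zero.1 h2.symm).resolve_left (pow_ne_zero _ (linP_ne_zero (A.ne_zero c c.2)))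
  · rintro ⟨η, hη⟩
    have : ∀ c : A.hyps, ∃ ξ : (LinearMap.ker (dotLin (c : Fin ℓ → K))) [⋀^Fin p]→ₗ[K] PS K ℓ,
        altComp (PS K ℓ) (LinearMap.ker (dotLin (c : Fin ℓ → K))).subtype p η =
        linP (c : Fin ℓ → K) ^ m c • ξ := fun c =>
      AlternatingMap.exists_eq_smul _ (pow_ne_zero _ (linP_ne_zero (A.ne_zero c c.2)))
        fun w => hη c c.2 _ fun i => (w i).2
    choose ξ hξ using this
    exact ⟨⟨(η, ξ), mem_ker_lfSyzygy.2 hξ⟩, rfl⟩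

lemma pdLT_ker_of_gldimLE {R : Type} [CommRing R] {M N : Type} [AddCommGroup M] [Module R M]
    [AddCommGroup N] [Module R N] [Module.Projective R M] [Module.Projective R N] {n : ℕ}
    (h : gldimLE R n) (f : M →ₗ[R] N) : pdLT R (LinearMap.ker f) (n - 2 + 1) := by
  have h3 : pdLT R (N ⧸ LinearMap.range f) (n - 2 + 3) := (h _).mono (by omega)
  have h2 : pdLT R (LinearMap.range f) (n - 2 + 2) :=
    pdLT.range_of_projective inferInstance h3
  have := pdLT.ker_of_projective f.surjective_rangeRestrict inferInstance h2
  rwa [LinearMap.ker_rangeRestrict] at this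

lemma pdLT_lf (A : Arrangement K ℓ) (m : (Fin ℓ → K) → ℕ) (p : ℕ) :
    pdLT (PS K ℓ) (lf A.hyps m p) (ℓ - 2 + 1) := by
  obtain ⟨e⟩ := lf_equiv_ker A m p
  exact (pdLT_ker_of_gldimLE (gldimLE_mvPolynomial K ℓ) (lfSyzygy A.hyps m p)).of_equiv e

lemma extVanish_lf_one (A : Arrangement K ℓ) (m : (Fin ℓ → K) → ℕ) (p : ℕ) {P : Ideal (PS K ℓ)}
    (h : ∀ i < 2, extVanish P (PS K ℓ) i) : extVanish P (lf A.hyps m p) 1 := by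
  obtain ⟨e⟩ := lf_equiv_ker A m p
  exact extVanish.of_equiv e.symm (extVanish.ker (lfSyzygy A.hyps m p) h)

end LinearForms

section FreeForms

lemma AlternatingMap.exists_linearMap_mul_eq {k W S Z ι : Type} [CommRing k] [AddCommGroup W]
    [Module k W] [CommRing S] [IsDomain S] [Algebra k S] [AddCommGroup Z] [Module S Z]
    (h : Z →ₗ[S] (W [⋀^ι]→ₗ[k] S)) {a : S} (ha : a ≠ 0) (hr : ∀ z v, a ∣ h z v) :
    ∃ h' : Z →ₗ[S] (W [⋀^ι]→ₗ[k] S), ∀ z v, a * h' z v = h z v := by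
  choose g hg using fun z => (h z).exists_eq_smul ha (hr z)
  have hg' : ∀ z v, a * g z v = h z v := fun z v => by rw [hg z]; rfl
  refine ⟨{ toFun := g, map_add' := fun x y => ?_, map_smul' := fun s x => ?_ }, hg'⟩
  · ext1 v
    refine mul_left_cancel₀ ha ?_
    rw [hg', AlternatingMap.add_apply, mul_add, hg', hg', map_add, AlternatingMap.add_apply]
  · ext1 v
    refine mul_left_cancel₀ ha ?_
    rw [hg', RingHom.id_apply, AlternatingMap.smul_apply, map_smul, AlternatingMap.smul_apply,
      ← hg', smul_eq_mul, smul_eq_mul, mul_left_comm]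

lemma AlternatingMap.apply_mem_of_span {S D N : Type} [CommRing S] [AddCommGroup D] [Module S D]
    [AddCommGroup N] [Module S N] {p : ℕ} (G : D [⋀^Fin p]→ₗ[S] N) (X : Set D)
    (J : Submodule S N) (h : ∀ v : Fin p → D, (∀ i, v i ∈ X) → G v ∈ J) (v : Fin p → D)
    (hv : ∀ i, v i ∈ Submodule.span S X) : G v ∈ J := by
  have key : ∀ s : Finset (Fin p), ∀ v : Fin p → D, (∀ i ∈ s, v i ∈ Submodule.span S X) →
      (∀ i ∉ s, v i ∈ X) → G v ∈ J := by
    intro s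
    induction s using Finset.induction_on with
    | empty => intro v _ hv; exact h v fun i => hv i (by simp)
    | insert a s ha ih =>
      intro v hv1 hv2
      have hu : ∀ x ∈ Submodule.span S X, G (Function.update v a x) ∈ J := by
        intro x hx
        induction hx using Submodule.span_induction with
        | zero => rw [G.map_update_zero]; exact J.zero_mem
        | add x y _ _ hx hy => rw [G.map_update_add]; exact J.add_mem hx hy
        | smul t x _ hx => rw [G.map_update_smul]; exact J.smul_mem _ hx
        | mem x hx =>
          refine ih _ (fun i hi => ?_) (fun i hi => ?_)
          · rw [Function.update_of_ne (fun hia : i = a => ha (hia ▸ hi))]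
            exact hv1 i (Finset.mem_insert_of_mem hi)
          · by_cases hia : i = a
            · subst hia; simpa using hx
            · rw [Function.update_of_ne hia]
              exact hv2 i (by simp [hia, hi])
      simpa using hu (v a) (hv1 a (Finset.mem_insert_self a s))
  exact key Finset.univ v (fun i _ => hv i) (fun i hi => absurd (Finset.mem_univ i) hi)

variable {K : Type} [Field K] {ℓ : ℕ}

lemma AlternatingMap.finset_sum_apply {S D N ι κ : Type} [CommRing S] [AddCommGroup D] [Module S D]
    [AddCommGroup N] [Module S N] (s : Finset κ) (f : κ → D [⋀^ι]→ₗ[S] N) (v : ι → D) :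
    (∑ i ∈ s, f i) v = ∑ i ∈ s, f i v :=
  map_sum (⟨⟨fun g => g v, rfl⟩, fun _ _ => rfl⟩ : (D [⋀^ι]→ₗ[S] N) →+ N) f s

/-- The constant one-form `dα`. -/
def dForm (c : Fin ℓ → K) : (Fin ℓ → K) [⋀^Fin 1]→ₗ[K] PS K ℓ :=
  AlternatingMap.ofSubsingleton K _ _ 0 ((Algebra.linearMap K (PS K ℓ)).comp (dotLin c))

lemma dForm_apply (c : Fin ℓ → K) (v : Fin 1 → Fin ℓ → K) :
    dForm c v = C (dotLin c (v 0)) := rfl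

lemma smul_dForm_mem_lf (A : Arrangement K ℓ) (m : (Fin ℓ → K) → ℕ) {T : Finset (Fin ℓ → K)}
    (c : Fin ℓ → K) (hT : ∀ d ∈ A.hyps, d ≠ c → d ∈ T) :
    (∏ d ∈ T, linP d ^ m d) • dForm c ∈ lf A.hyps m 1 := by
  intro d hd v hv
  rw [AlternatingMap.smul_apply, smul_eq_mul, dForm_apply]
  by_cases h : d = c
  · subst h
    rw [hv 0, map_zero, mul_zero]; exact dvd_zero _
  · exact Dvd.dvd.mul_right (Finset.dvd_prod_of_mem _ (hT d hd h)) _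

lemma dForm_eq_sum (c : Fin ℓ → K) : dForm c = ∑ j, (C (c j) : PS K ℓ) • dForm (Pi.single j 1) := by
  ext1 v
  rw [dForm_apply, dotLin_apply, map_sum]
  simp [AlternatingMap.finset_sum_apply, dForm_apply, dotLin_apply, Pi.single_apply]

/-- The extension of a form to an alternating map on the dual of `S^ℓ`. -/
def dualAlt (K : Type) [Field K] (ℓ p : ℕ) : ((Fin ℓ → K) [⋀^Fin p]→ₗ[K] PS K ℓ) →ₗ[PS K ℓ]
    (Module.Dual (PS K ℓ) (Fin ℓ → PS K ℓ) [⋀^Fin p]→ₗ[PS K ℓ] PS K ℓ) where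
  toFun η := ((LinearMap.applyₗ ((LinearEquiv.ofBijective _ (formAlt_bijective p)).symm η)).comp
    (exteriorPower.pairingDual (PS K ℓ) (Fin ℓ → PS K ℓ) p)).compAlternatingMap
      (exteriorPower.ιMulti _ p)
  map_add' η ξ := by ext v; simp
  map_smul' s η := by ext1 v; simp

lemma dualAlt_constDual {p : ℕ} (η : (Fin ℓ → K) [⋀^Fin p]→ₗ[K] PS K ℓ) (v : Fin p → Fin ℓ → K) :
    dualAlt K ℓ p η (fun i => constDual K ℓ (v i)) = η v :=
  DFunLike.congr_fun ((LinearEquiv.ofBijective _ (formAlt_bijective p)).apply_symm_apply η) v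

/-- `AlternatingMap.restrictAlong` as a linear map. -/
def restrictAlongHom {W D : Type} [AddCommGroup W] [Module K W] [AddCommGroup D]
    [Module (PS K ℓ) D] [Module K D] [IsScalarTower K (PS K ℓ) D] (φ : W →ₗ[K] D) (p : ℕ) :
    (D [⋀^Fin p]→ₗ[PS K ℓ] PS K ℓ) →ₗ[PS K ℓ] (W [⋀^Fin p]→ₗ[K] PS K ℓ) where
  toFun f := f.restrictAlong φ
  map_add' _ _ := rfl
  map_smul' _ _ := rfl

instance (ι : Type) [Finite ι] (p : ℕ) :
    Module.Projective (PS K ℓ) ((ι → PS K ℓ) [⋀^Fin p]→ₗ[PS K ℓ] PS K ℓ) := by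
  have : Module.Projective (PS K ℓ) (⋀[PS K ℓ]^p (ι → PS K ℓ) →ₗ[PS K ℓ] PS K ℓ) := inferInstance
  exact Module.Projective.of_equiv
    (exteriorPower.alternatingMapLinearEquiv (R := PS K ℓ) (M := ι → PS K ℓ) (N := PS K ℓ)
      (n := p)).symm

lemma Arrangement.exists_dual_basis (A : Arrangement K ℓ) (m : (Fin ℓ → K) → ℕ)
    (h : Module.Free (PS K ℓ) (lf A.hyps m 1)) :
    ∃ (ι : Type) (_ : Fintype ι) (Θ : (Fin ℓ → K) →ₗ[K] (ι → PS K ℓ))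
      (δ : (ι → PS K ℓ) →ₗ[PS K ℓ] Module.Dual (PS K ℓ) (Fin ℓ → PS K ℓ)),
      (∀ v, δ (Θ v) = Qpoly A m • constDual K ℓ v) ∧
      (∀ c ∈ A.hyps, ∀ v, dotLin c v = 0 → ∀ i, linP c ^ m c ∣ Θ v i) ∧
      (∀ c ∈ A.hyps, ∀ s, linP c ^ m c ∣ δ s (fun j => C (c j))) := by
  let θ := Module.Free.chooseBasis (PS K ℓ) (lf A.hyps m 1)
  let ι := Module.Free.ChooseBasisIndex (PS K ℓ) (lf A.hyps m 1)
  have hmem : ∀ c : Fin ℓ → K, Qpoly A m • dForm c ∈ lf A.hyps m 1 := fun c =>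
    smul_dForm_mem_lf A m c fun d hd _ => hd
  let q : Fin ℓ → lf A.hyps m 1 := fun j => ⟨Qpoly A m • dForm (Pi.single j 1), hmem _⟩
  let Θ : (Fin ℓ → K) →ₗ[K] (ι → PS K ℓ) := LinearMap.pi fun i =>
    (AlternatingMap.ofSubsingleton K _ _ (0 : Fin 1)).symm (θ i).1
  have hΘ : ∀ v i, Θ v i = (θ i).1 (fun _ => v) := fun v i => rfl
  let δ : (ι → PS K ℓ) →ₗ[PS K ℓ] Module.Dual (PS K ℓ) (Fin ℓ → PS K ℓ) :=
    Fintype.linearCombination (PS K ℓ) fun i => ∑ j, θ.repr (q j) i • LinearMap.proj j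
  have hδ : ∀ s f, δ s f = ∑ i, s i * ∑ j, θ.repr (q j) i * f j := by
    intro s f
    simp [δ, Fintype.linearCombination_apply, LinearMap.sum_apply]
  refine ⟨ι, inferInstance, Θ, δ, fun v => ?_, fun c hc v hv i => ?_, fun c hc s => ?_⟩
  · refine LinearMap.ext fun f => ?_
    rw [hδ, LinearMap.smul_apply, constDual_apply]
    have h1 : ∀ j, ∑ i, θ.repr (q j) i * Θ v i = Qpoly A m * C (v j) := by
      intro j
      have := congrArg (fun x : lf A.hyps m 1 => x.1 (fun _ => v)) (θ.sum_repr (q j))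
      simp only [AddSubmonoidClass.coe_finsetSum, AlternatingMap.finset_sum_apply, Submodule.coe_smul,
        AlternatingMap.smul_apply, smul_eq_mul] at this
      simp only [hΘ]
      rw [this]
      change Qpoly A m * dForm _ _ = _
      rw [dForm_apply]
      simp [dotLin_apply, Pi.single_apply]
    calc ∑ i, Θ v i * ∑ j, θ.repr (q j) i * f j
        = ∑ j, (∑ i, θ.repr (q j) i * Θ v i) * f j := by
          simp_rw [Finset.mul_sum, Finset.sum_mul]
          rw [Finset.sum_comm]
          exact Finset.sum_congr rfl fun j _ => Finset.sum_congr rfl fun i _ => by ring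
      _ = Qpoly A m • ∑ k, v k • f k := by
          rw [smul_eq_mul, Finset.mul_sum]
          refine Finset.sum_congr rfl fun j _ => ?_
          rw [h1, Algebra.smul_def, algebraMap_eq]; ring
  · exact (θ i).2 c hc _ fun _ => hv
  · rw [hδ]
    refine Finset.dvd_sum fun i _ => Dvd.dvd.mul_left ?_ _
    let q' : lf A.hyps m 1 := ⟨(∏ d ∈ A.hyps.erase c, linP d ^ m d) • dForm c,
      smul_dForm_mem_lf A m c fun d hd hdc => Finset.mem_erase.2 ⟨hdc, hd⟩⟩
    have e : ∑ j, (C (c j) : PS K ℓ) • q j = linP c ^ m c • q' := by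
      apply Subtype.ext
      change ((∑ j, (C (c j) : PS K ℓ) • q j : lf A.hyps m 1) : (Fin ℓ → K) [⋀^Fin 1]→ₗ[K] PS K ℓ) =
        linP c ^ m c • (∏ d ∈ A.hyps.erase c, linP d ^ m d) • dForm c
      rw [smul_smul, Finset.mul_prod_erase _ (fun d => linP d ^ m d) hc, dForm_eq_sum c,
        Finset.smul_sum, AddSubmonoidClass.coe_finsetSum]
      refine Finset.sum_congr rfl fun j _ => ?_
      rw [smul_comm]; rfl
    have e2 := congrArg (fun x => θ.repr x i) e
    simp only [map_sum, map_smul, Finsupp.coe_finsetSum, Finset.sum_apply, Finsupp.smul_apply,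
      smul_eq_mul] at e2
    refine ⟨θ.repr q' i, ?_⟩
    rw [← e2]
    exact Finset.sum_congr rfl fun j _ => mul_comm _ _

/-- If the coefficients of `η` along `ker c` are divisible by `c ^ m c` for all `c`, then so are its
values on vectors satisfying the dual divisibility condition. -/
lemma Arrangement.dvd_dualAlt (A : Arrangement K ℓ) (m : (Fin ℓ → K) → ℕ) {p : ℕ}
    (η : lf A.hyps m p) (x : Fin p → Module.Dual (PS K ℓ) (Fin ℓ → PS K ℓ))
    (hx : ∀ c ∈ A.hyps, ∀ i, linP c ^ m c ∣ x i (fun j => C (c j))) :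
    Qpoly A m ∣ dualAlt K ℓ p η.1 x := by
  refine A.prod_dvd subset_rfl m fun c hc => ?_
  obtain ⟨v₀, hv₀⟩ := exists_dotLin_eq_one (A.ne_zero c hc)
  let X : Set (Module.Dual (PS K ℓ) (Fin ℓ → PS K ℓ)) :=
    {x | ∃ v, dotLin c v = 0 ∧ x = constDual K ℓ v} ∪
      {x | ∃ y, x = linP c ^ m c • y}
  rw [← Ideal.mem_span_singleton]
  refine AlternatingMap.apply_mem_of_span (dualAlt K ℓ p η.1) X _ ?_ x ?_
  · intro x hx
    rw [Ideal.mem_span_singleton]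
    by_cases hx' : ∀ i, ∃ v, dotLin c v = 0 ∧ x i = constDual K ℓ v
    · choose v hv hxv using hx'
      rw [funext hxv, dualAlt_constDual]
      exact η.2 c hc v hv
    · push Not at hx'
      obtain ⟨i, hi⟩ := hx'
      obtain ⟨y, hy⟩ := (hx i).resolve_left fun ⟨v, hv, hxv⟩ => hi v hv hxv
      rw [← Function.update_eq_self i x, hy, AlternatingMap.map_update_smul]
      exact dvd_mul_right _ _
  · intro i
    have e : x i = ∑ j, x i (Pi.single j 1) •
          constDual K ℓ (projAlong (dotLin c) v₀ (Pi.single j 1)) +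
        x i (fun j => C (c j)) • constDual K ℓ v₀ := by
      have e1 : x i (fun j => C (c j)) = ∑ j, x i (Pi.single j 1) * C (c j) := by
        rw [LinearMap.pi_apply_eq_sum_univ]
        refine Finset.sum_congr rfl fun j _ => ?_
        rw [smul_eq_mul, mul_comm]
        congr 2
        ext1 k
        simp [Pi.single_apply, eq_comm]
      have e2 : x i = ∑ j, x i (Pi.single j 1) • constDual K ℓ (Pi.single j 1) := by
        refine (Pi.basisFun (PS K ℓ) (Fin ℓ)).ext fun k => ?_
        simp [constDual_apply, Pi.single_apply, LinearMap.sum_apply]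
      rw [e1, Finset.sum_smul, ← Finset.sum_add_distrib]
      conv_lhs => rw [e2]
      refine Finset.sum_congr rfl fun j _ => ?_
      rw [mul_smul, ← smul_add, projAlong_apply, map_sub, map_smul, dotLin_single,
        ← algebraMap_eq, algebraMap_smul, sub_add_cancel]
    rw [e]
    refine Submodule.add_mem _ (Submodule.sum_mem _ fun j _ => Submodule.smul_mem _ _
      (Submodule.subset_span (Or.inl ⟨_, apply_projAlong hv₀ _, rfl⟩))) ?_
    obtain ⟨r, hr⟩ := hx c hc i
    rw [hr, mul_smul]
    exact Submodule.subset_span (Or.inr ⟨_, rfl⟩)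

section

variable {ι : Type} {Θ : (Fin ℓ → K) →ₗ[K] (ι → PS K ℓ)}

lemma Arrangement.pow_dvd_apply (A : Arrangement K ℓ) (m : (Fin ℓ → K) → ℕ)
    (hΘ : ∀ c ∈ A.hyps, ∀ v, dotLin c v = 0 → ∀ i, linP c ^ m c ∣ Θ v i) {p : ℕ}
    (f : (ι → PS K ℓ) [⋀^Fin p]→ₗ[PS K ℓ] PS K ℓ) {c : Fin ℓ → K} (hc : c ∈ A.hyps)
    (v : Fin p → Fin ℓ → K) (hv : ∀ i, dotLin c (v i) = 0) :
    (linP c ^ m c) ^ p ∣ f fun i => Θ (v i) := by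
  choose s hs using fun i => hΘ c hc (v i) (hv i)
  have : (fun i => Θ (v i)) = fun i => (fun _ => linP c ^ m c) i • s i := by
    ext1 i; ext1 j; exact hs i j
  rw [this, f.map_smul_univ]
  simp

lemma Arrangement.prod_pow_dvd_apply (A : Arrangement K ℓ) (m : (Fin ℓ → K) → ℕ)
    (hΘ : ∀ c ∈ A.hyps, ∀ v, dotLin c v = 0 → ∀ i, linP c ^ m c ∣ Θ v i) {p : ℕ}
    (f : (ι → PS K ℓ) [⋀^Fin p]→ₗ[PS K ℓ] PS K ℓ) (v : Fin p → Fin ℓ → K) :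
    Qpoly A m ^ p ∣ Qpoly A m * f fun i => Θ (v i) := by
  rw [Qpoly, ← Finset.prod_pow]
  simp_rw [← pow_mul]
  refine A.prod_dvd subset_rfl (fun c => m c * p) fun c hc => ?_
  obtain ⟨v₀, hv₀⟩ := exists_dotLin_eq_one (A.ne_zero c hc)
  rw [pow_mul]
  refine AlternatingMap.dvd_apply_of_ker (Qpoly A m • restrictAlongHom (ℓ := ℓ) Θ p f) _ hv₀
    (fun w hw => Dvd.dvd.mul_left (A.pow_dvd_apply m hΘ f hc w hw) _) (fun w i hi hw => ?_) v
  have hs' : ∀ k, ∃ s, Θ (w k) = (if k = i then 1 else linP c ^ m c) • s := by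
    intro k
    by_cases hk : k = i
    · exact ⟨Θ (w k), by simp [hk]⟩
    · choose s hs using hΘ c hc (w k) (hw k hk)
      exact ⟨s, by simp only [hk, if_false]; ext1 j; exact hs j⟩
  choose s hs using hs'
  have hp : p = (p - 1) + 1 := by have := i.2; omega
  change _ ∣ Qpoly A m * f fun k => Θ (w k)
  rw [funext hs, f.map_smul_univ (fun k => if k = i then 1 else linP c ^ m c)]
  have : ∏ k, (if k = i then 1 else linP c ^ m c) = (linP c ^ m c) ^ (p - 1) := by
    simp [Finset.prod_ite, Finset.filter_ne']
  rw [this, smul_eq_mul, ← mul_assoc]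
  refine Dvd.dvd.mul_right ?_ _
  conv_lhs => rw [hp, pow_succ']
  exact mul_dvd_mul_right (Finset.dvd_prod_of_mem (fun d => linP d ^ m d) hc) _

end

/-- If the logarithmic `1`-forms are free then all modules of logarithmic forms are
projective. -/
theorem Arrangement.projective_lf_of_free (A : Arrangement K ℓ) (m : (Fin ℓ → K) → ℕ)
    (h : Module.Free (PS K ℓ) (lf A.hyps m 1)) (p : ℕ) :
    Module.Projective (PS K ℓ) (lf A.hyps m p) := by
  obtain ⟨ι, _, Θ, δ, hδΘ, hΘ, hδ⟩ := A.exists_dual_basis m h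
  have hQ : Qpoly A m ≠ 0 := Finset.prod_ne_zero_iff.2 fun c hc =>
    pow_ne_zero _ (linP_ne_zero (A.ne_zero c hc))
  obtain ⟨a, ha⟩ := AlternatingMap.exists_linearMap_mul_eq
    (((altComp (PS K ℓ) δ p).comp (dualAlt K ℓ p)).comp (lf A.hyps m p).subtype) hQ
    fun η s => A.dvd_dualAlt m η (fun i => δ (s i)) fun c hc i => hδ c hc (s i)
  obtain ⟨b, hb⟩ := AlternatingMap.exists_linearMap_mul_eq
    (Qpoly A m • restrictAlongHom (ℓ := ℓ) Θ p) (pow_ne_zero p hQ)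
    fun f v => A.prod_pow_dvd_apply m hΘ f v
  replace ha : ∀ η s, Qpoly A m * a η s = dualAlt K ℓ p η.1 (fun i => δ (s i)) := ha
  replace hb : ∀ f v, Qpoly A m ^ p * b f v = Qpoly A m * f (fun i => Θ (v i)) := hb
  have hbm : ∀ f, b f ∈ lf A.hyps m p := by
    intro f c hc v hv
    have h1 := hb f v
    obtain ⟨r, hr⟩ := A.pow_dvd_apply m hΘ f hc v hv
    rw [hr, Qpoly, ← Finset.mul_prod_erase _ (fun d => linP d ^ m d) hc, mul_pow] at h1
    have h2 : (∏ d ∈ A.hyps.erase c, linP d ^ m d) ^ p * b f v =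
        linP c ^ m c * ((∏ d ∈ A.hyps.erase c, linP d ^ m d) * r) := by
      refine mul_left_cancel₀ (pow_ne_zero p (pow_ne_zero (m c)
        (linP_ne_zero (A.ne_zero c hc)))) ?_
      linear_combination h1
    refine (linP_prime (A.ne_zero c hc)).pow_dvd_of_dvd_mul_left _ (fun hd => ?_)
      (Dvd.intro _ h2.symm)
    exact A.not_linP_dvd_prod hc (Finset.erase_subset c A.hyps) (Finset.notMem_erase c _) m
      ((linP_prime (A.ne_zero c hc)).dvd_of_dvd_pow hd)
  refine Module.Projective.of_split a (b.codRestrict _ hbm) (LinearMap.ext fun η => ?_)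
  refine Subtype.ext (AlternatingMap.ext fun v => ?_)
  refine mul_left_cancel₀ (pow_ne_zero p hQ) ?_
  refine (hb (a η) v).trans ((ha η fun i => Θ (v i)).trans ?_)
  rw [funext fun i => hδΘ (v i)]
  rw [(dualAlt K ℓ p η.1).map_smul_univ (fun _ => Qpoly A m), dualAlt_constDual]
  simp

end FreeForms

section Generic

variable {S : Type} [CommRing S] {E F : Type} [AddCommGroup E] [Module S E] [AddCommGroup F]
  [Module S F] {N N' : Submodule S E}

lemma AlternatingMap.exists_div_restrict [IsDomain S] {k W W' : Type} [CommRing k] [Algebra k S]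
    [AddCommGroup W] [Module k W] [AddCommGroup W'] [Module k W'] {p : ℕ}
    (N : Submodule S (W [⋀^Fin p]→ₗ[k] S)) (f : W' →ₗ[k] W) {a : S} (ha : a ≠ 0)
    (hr : ∀ η ∈ N, ∀ v : Fin p → W', a ∣ η (fun i => f (v i))) :
    ∃ D : N →ₗ[S] (W' [⋀^Fin p]→ₗ[k] S), ∀ η v, a * D η v = η.1 (fun i => f (v i)) :=
  have h (η : N) (v : Fin p → W') : a ∣ (altComp S f p).domRestrict N η v := hr η.1 η.2 v
  AlternatingMap.exists_linearMap_mul_eq (Z := N) ((altComp S f p).domRestrict N) ha h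

lemma exact_rangeRestrict_of_ker (hle : N ≤ N') (r : N' →ₗ[S] F) (hr : ∀ η, r η = 0 ↔ η.1 ∈ N) :
    Function.Exact (Submodule.inclusion hle) r.rangeRestrict := fun η => by
  rw [Subtype.ext_iff]
  refine (hr η).trans ⟨fun hη => ⟨⟨η.1, hη⟩, rfl⟩, ?_⟩
  rintro ⟨ξ, rfl⟩
  exact ξ.2

lemma pdLT.range (hle : N ≤ N') (r : N' →ₗ[S] F) (hr : ∀ η, r η = 0 ↔ η.1 ∈ N) {q : ℕ}
    (h1 : pdLT S N q) (h2 : pdLT S N' (q + 1)) : pdLT S (LinearMap.range r) (q + 1) :=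
  pdLT.right (Submodule.inclusion_injective hle) (exact_rangeRestrict_of_ker hle r hr)
    r.surjective_rangeRestrict h1 h2

lemma mem_range_of_smul_mem (hle : N ≤ N') (r : N' →ₗ[S] F) (hr : ∀ η, r η = 0 ↔ η.1 ∈ N)
    {P : Ideal S} (h1 : extVanish P N 2) (h2 : extVanish P N' 1) (h4 : extVanish P F 0) {ζ : F}
    (hζ : ∀ s ∈ P, s • ζ ∈ LinearMap.range r) : ζ ∈ LinearMap.range r := by
  have h3 : extVanish P (LinearMap.range r) 1 :=
    extVanish.right (Submodule.inclusion_injective hle) (exact_rangeRestrict_of_ker hle r hr)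
      r.surjective_rangeRestrict h2 h1
  have h5 : extVanish P (F ⧸ LinearMap.range r) 0 :=
    extVanish.right (f := (LinearMap.range r).subtype)
      (Submodule.injective_subtype _) (LinearMap.exact_subtype_mkQ _)
      (Submodule.mkQ_surjective _) h4 h3
  rw [extVanish_zero_iff] at h5
  refine (Submodule.Quotient.mk_eq_zero _).1 (h5 (Submodule.Quotient.mk ζ) fun s hs => ?_)
  rw [← Submodule.Quotient.mk_smul, Submodule.Quotient.mk_eq_zero]
  exact hζ s hs

end Generic

section Pullback

variable {K : Type} [Field K] {a b n ℓ : ℕ}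

/-- The coefficient vector of the pullback of a linear form. -/
def pullVec (φ : (Fin a → K) →ₗ[K] (Fin b → K)) (c : Fin b → K) : Fin a → K :=
  fun i => ∑ j, c j * φ (Pi.single i 1) j

lemma dotLin_pullVec (φ : (Fin a → K) →ₗ[K] (Fin b → K)) (c : Fin b → K) (w : Fin a → K) :
    dotLin (pullVec φ c) w = dotLin c (φ w) := by
  have : dotLin (pullVec φ c) = (dotLin c).comp φ := by
    refine (Pi.basisFun K (Fin a)).ext fun i => ?_
    rw [Pi.basisFun_apply, dotLin_single, LinearMap.comp_apply, dotLin_apply]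
    rfl
  rw [this]; rfl

/-- The homomorphism of polynomial rings given by pullback along a linear map. -/
def pullHom (φ : (Fin a → K) →ₗ[K] (Fin b → K)) : PS K b →ₐ[K] PS K a :=
  aeval fun j => ∑ i, C (φ (Pi.single i 1) j) * X i

lemma pullHom_linP (φ : (Fin a → K) →ₗ[K] (Fin b → K)) (c : Fin b → K) :
    pullHom φ (linP c) = linP (pullVec φ c) := by
  simp only [pullHom, linP, map_sum, map_mul, aeval_X, pullVec, Finset.mul_sum, Finset.sum_mul,
    algHom_C, algebraMap_eq]
  rw [Finset.sum_comm]
  exact Finset.sum_congr rfl fun i _ => Finset.sum_congr rfl fun j _ => by ring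

/-- A hyperplane `ker c₀` together with a linear parametrization `e`, where the coordinate ring of
the hyperplane is an algebra by means of restriction. -/
structure IsHypData [Algebra (PS K ℓ) (PS K n)] (c₀ : Fin ℓ → K)
    (e : (Fin n → K) →ₗ[K] (Fin ℓ → K)) : Prop where
  ne_zero : c₀ ≠ 0
  injective : Function.Injective e
  range_eq : LinearMap.range e = LinearMap.ker (dotLin c₀)
  algebraMap_apply : ∀ f, algebraMap (PS K ℓ) (PS K n) f = pullHom e f

namespace IsHypData

variable [Algebra (PS K ℓ) (PS K n)] {c₀ : Fin ℓ → K} {e : (Fin n → K) →ₗ[K] (Fin ℓ → K)}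

lemma dotLin_e (h : IsHypData c₀ e) (w : Fin n → K) : dotLin c₀ (e w) = 0 := by
  have : e w ∈ LinearMap.ker (dotLin c₀) := h.range_eq ▸ ⟨w, rfl⟩
  exact this

lemma exists_eq_e (h : IsHypData c₀ e) {v : Fin ℓ → K} (hv : dotLin c₀ v = 0) :
    ∃ w, e w = v := by
  have : v ∈ LinearMap.range e := h.range_eq ▸ hv
  exact this

lemma algebraMap_linP (h : IsHypData c₀ e) (c : Fin ℓ → K) :
    algebraMap (PS K ℓ) (PS K n) (linP c) = linP (pullVec e c) := by
  rw [h.algebraMap_apply, pullHom_linP]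

lemma exists_retraction (h : IsHypData c₀ e) {u₀ : Fin ℓ → K} (hu₀ : dotLin c₀ u₀ = 1) :
    ∃ r : (Fin ℓ → K) →ₗ[K] (Fin n → K), (∀ w, r (e w) = w) ∧ r u₀ = 0 ∧
      ∀ v, e (r v) = projAlong (dotLin c₀) u₀ v := by
  obtain ⟨r, hr⟩ := e.exists_leftInverse_of_injective (LinearMap.ker_eq_bot.2 h.injective)
  have hr' : ∀ w, r (e w) = w := LinearMap.congr_fun hr
  refine ⟨r.comp (projAlong (dotLin c₀) u₀), fun w => ?_, ?_, fun v => ?_⟩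
  · simp [h.dotLin_e, hr']
  · simp [hu₀]
  · obtain ⟨w, hw⟩ := h.exists_eq_e (apply_projAlong hu₀ v)
    rw [LinearMap.comp_apply, ← hw, hr']

lemma exists_section (h : IsHypData c₀ e) : ∃ σ : PS K n →ₐ[K] PS K ℓ,
    (∀ f, algebraMap (PS K ℓ) (PS K n) (σ f) = f) ∧
    ∀ f, linP c₀ ∣ f - σ (algebraMap (PS K ℓ) (PS K n) f) := by
  obtain ⟨u₀, hu₀⟩ := exists_dotLin_eq_one h.ne_zero
  obtain ⟨r, hr, -, hr'⟩ := h.exists_retraction hu₀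
  have hX : ∀ {k : ℕ} (i : Fin k), (X i : PS K k) = linP (Pi.single i 1) := fun i =>
    (linP_single i).symm
  refine ⟨pullHom r, fun f => ?_, fun f => ?_⟩
  · rw [h.algebraMap_apply]
    have : (pullHom e).comp (pullHom r) = AlgHom.id K _ := by
      refine MvPolynomial.algHom_ext fun i => ?_
      rw [AlgHom.comp_apply, hX, pullHom_linP, pullHom_linP]
      refine congrArg linP (funext fun j => ?_)
      rw [← dotLin_single (pullVec e _), dotLin_pullVec, dotLin_pullVec, hr, dotLin_single]
    exact AlgHom.congr_fun this f
  · rw [h.algebraMap_apply, ← Ideal.mem_span_singleton, ← Ideal.Quotient.eq]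
    have : (Ideal.Quotient.mkₐ K (Ideal.span {linP c₀})) =
        (Ideal.Quotient.mkₐ K (Ideal.span {linP c₀})).comp ((pullHom r).comp (pullHom e)) := by
      refine MvPolynomial.algHom_ext fun i => ?_
      rw [AlgHom.comp_apply, AlgHom.comp_apply, hX, pullHom_linP, pullHom_linP]
      refine Ideal.Quotient.eq.2 (Ideal.mem_span_singleton.2 ⟨C (u₀ i), ?_⟩)
      rw [mul_comm, ← linP_smul, sub_eq_iff_eq_add, ← linPHom_apply, ← linPHom_apply (K := K),
        ← linPHom_apply (K := K), ← map_add]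
      refine congrArg linP (funext fun j => ?_)
      rw [Pi.add_apply, ← dotLin_single (pullVec r _), dotLin_pullVec, dotLin_pullVec, hr',
        projAlong_apply, map_sub, map_smul, dotLin_single, dotLin_single]
      simp [dotLin_apply, Pi.single_apply, mul_comm]
    exact AlgHom.congr_fun this f

lemma algebraMap_surjective (h : IsHypData c₀ e) :
    Function.Surjective (algebraMap (PS K ℓ) (PS K n)) := fun f => by
  obtain ⟨σ, hσ, -⟩ := h.exists_section
  exact ⟨σ f, hσ f⟩

lemma algebraMap_eq_zero_iff (h : IsHypData c₀ e) (f : PS K ℓ) :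
    algebraMap (PS K ℓ) (PS K n) f = 0 ↔ linP c₀ ∣ f := by
  obtain ⟨σ, hσ, hσ'⟩ := h.exists_section
  constructor
  · intro hf
    have := hσ' f
    rwa [hf, map_zero, sub_zero] at this
  · rintro ⟨g, rfl⟩
    have : pullVec e c₀ = 0 := funext fun j => by
      rw [← dotLin_single (pullVec e _), dotLin_pullVec, h.dotLin_e]; rfl
    rw [map_mul, h.algebraMap_linP, this, ← linPHom_apply, map_zero, zero_mul]

end IsHypData

end Pullback

section

variable {K : Type} {ℓ : ℕ} {c₀ : Fin ℓ → K}

lemma mdel_self (m : (Fin ℓ → K) → ℕ) : mdel m c₀ c₀ = m c₀ - 1 := by simp [mdel]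

lemma mdel_of_ne (m : (Fin ℓ → K) → ℕ) {c : Fin ℓ → K} (h : c ≠ c₀) : mdel m c₀ c = m c := by
  simp [mdel, h]

lemma mdel_le (m : (Fin ℓ → K) → ℕ) (c : Fin ℓ → K) : mdel m c₀ c ≤ m c := by
  unfold mdel; split_ifs <;> omega

end

section Residue

variable {K : Type} [Field K] {n ℓ : ℕ} [Algebra (PS K ℓ) (PS K n)]
  [IsScalarTower K (PS K ℓ) (PS K n)] {c₀ : Fin ℓ → K} {e : (Fin n → K) →ₗ[K] (Fin ℓ → K)}

/-- Restriction of the coefficients of forms to a hyperplane. -/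
def mapCoeff (K : Type) [Field K] (n ℓ p : ℕ) [Algebra (PS K ℓ) (PS K n)]
    [IsScalarTower K (PS K ℓ) (PS K n)] :
    ((Fin n → K) [⋀^Fin p]→ₗ[K] PS K ℓ) →ₗ[PS K ℓ] ((Fin n → K) [⋀^Fin p]→ₗ[K] PS K n) where
  toFun η := (((Algebra.linearMap (PS K ℓ) (PS K n)).restrictScalars K)).compAlternatingMap η
  map_add' η ξ := by ext v; simp
  map_smul' s η := by ext1 v; simp [Algebra.smul_def]

omit [IsScalarTower K (PS K ℓ) (PS K n)] in
lemma exists_lfDiv (h : IsHypData c₀ e) {T : Finset (Fin ℓ → K)} (hT : c₀ ∈ T)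
    (m : (Fin ℓ → K) → ℕ) (p : ℕ) :
    ∃ D : lf T (mdel m c₀) p →ₗ[PS K ℓ] ((Fin n → K) [⋀^Fin p]→ₗ[K] PS K ℓ),
      ∀ η v, linP c₀ ^ (m c₀ - 1) * D η v = η.1 (fun i => e (v i)) := by
  refine AlternatingMap.exists_div_restrict (lf T (mdel m c₀) p) e
    (pow_ne_zero (m c₀ - 1) (linP_ne_zero h.ne_zero)) fun η hη v => ?_
  have := hη c₀ hT (fun i => e (v i)) fun i => h.dotLin_e (v i)
  rwa [mdel_self] at this

/-- The residue of logarithmic forms along the hyperplane `ker c₀`: restrict the form to the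
hyperplane, divide by the appropriate power of `c₀` and restrict the coefficients. -/
def residue (h : IsHypData c₀ e) {T : Finset (Fin ℓ → K)} (hT : c₀ ∈ T)
    (m : (Fin ℓ → K) → ℕ) (p : ℕ) :
    lf T (mdel m c₀) p →ₗ[PS K ℓ] ((Fin n → K) [⋀^Fin p]→ₗ[K] PS K n) :=
  (mapCoeff K n ℓ p).comp (exists_lfDiv h hT m p).choose

variable (h : IsHypData c₀ e) {T : Finset (Fin ℓ → K)} (hT : c₀ ∈ T)
  (m : (Fin ℓ → K) → ℕ) {p : ℕ}

include h in
lemma residue_spec (η : lf T (mdel m c₀) p) (v : Fin p → Fin n → K) :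
    ∃ g, η.1 (fun i => e (v i)) = linP c₀ ^ (m c₀ - 1) * g ∧
      residue h hT m p η v = algebraMap (PS K ℓ) (PS K n) g :=
  ⟨_, ((exists_lfDiv h hT m p).choose_spec η v).symm, rfl⟩

lemma residue_apply {η : lf T (mdel m c₀) p} {v : Fin p → Fin n → K} {g : PS K ℓ}
    (hg : η.1 (fun i => e (v i)) = linP c₀ ^ (m c₀ - 1) * g) :
    residue h hT m p η v = algebraMap (PS K ℓ) (PS K n) g := by
  obtain ⟨g', hg', hr⟩ := residue_spec h hT m η v
  rw [hr, mul_left_cancel₀ (pow_ne_zero _ (linP_ne_zero h.ne_zero)) (hg'.symm.trans hg)]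

lemma lf_mono {T : Finset (Fin ℓ → K)} {m m' : (Fin ℓ → K) → ℕ} (hm : ∀ c ∈ T, m' c ≤ m c) (p : ℕ) :
    lf T m p ≤ lf T m' p := fun _ hη c hc v hv =>
  (pow_dvd_pow _ (hm c hc)).trans (hη c hc v hv)

/-- The kernel of the residue map. -/
lemma residue_eq_zero_iff (hm : 0 < m c₀) (η : lf T (mdel m c₀) p) :
    residue h hT m p η = 0 ↔ η.1 ∈ lf T m p := by
  have hpow : linP c₀ ^ m c₀ = linP c₀ ^ (m c₀ - 1) * linP c₀ := by
    rw [← pow_succ]; congr 1; omega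
  constructor
  · intro hη c hc v hv
    by_cases hcc : c = c₀
    · subst hcc
      choose w hw using fun i => h.exists_eq_e (hv i)
      obtain ⟨g, hg, hr⟩ := residue_spec h hT m η w
      rw [hη, AlternatingMap.zero_apply, eq_comm, h.algebraMap_eq_zero_iff] at hr
      rw [← funext hw, hg, hpow]
      exact mul_dvd_mul_left _ hr
    · have := η.2 c hc v hv
      rwa [mdel_of_ne m hcc] at this
  · intro hη
    ext1 v
    obtain ⟨g, hg, hr⟩ := residue_spec h hT m η v
    rw [hr, AlternatingMap.zero_apply, h.algebraMap_eq_zero_iff]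
    have := hη c₀ hT _ fun i => h.dotLin_e (v i)
    rw [hg, hpow] at this
    exact (mul_dvd_mul_iff_left (pow_ne_zero _ (linP_ne_zero h.ne_zero))).1 this

lemma pdLT_range_residue (hm : 0 < m c₀) {q : ℕ} (h1 : pdLT (PS K ℓ) (lf T m p) q)
    (h2 : pdLT (PS K ℓ) (lf T (mdel m c₀) p) (q + 1)) :
    pdLT (PS K ℓ) (LinearMap.range (residue h hT m p)) (q + 1) :=
  pdLT.range (lf_mono (fun c _ => mdel_le m c) p) (residue h hT m p)
    (residue_eq_zero_iff h hT m hm) h1 h2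

/-- A form which is annihilated by a deep enough ideal modulo residues is a residue. -/
theorem mem_range_residue_of_smul_mem (A : Arrangement K ℓ) (hT : c₀ ∈ A.hyps) (hm : 0 < m c₀)
    {P : Ideal (PS K ℓ)} (hP : P ≠ ⊤) {r : ℕ} {c : Fin r → Fin ℓ → K}
    (hc : LinearIndependent K c) (hcP : ∀ i, linP (c i) ∈ P) {q : ℕ} (hq : q + 3 ≤ r)
    (hpd : pdLT (PS K ℓ) (lf A.hyps m p) (q + 1))
    {ζ : (Fin n → K) [⋀^Fin p]→ₗ[K] PS K n}
    (hζ : ∀ s ∈ P, s • ζ ∈ LinearMap.range (residue h hT m p)) :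
    ζ ∈ LinearMap.range (residue h hT m p) := by
  have hS := extVanish_of_linearIndependent hP hc hcP
  have h1 : extVanish P (lf A.hyps m p) 2 := extVanish.of_pdLT hS q hpd 2 (by omega)
  have h2 : extVanish P (lf A.hyps (mdel m c₀) p) 1 :=
    extVanish_lf_one A _ p fun i hi => hS i (by omega)
  have h4 : extVanish P ((Fin n → K) [⋀^Fin p]→ₗ[K] PS K n) 0 := by
    rw [extVanish_zero_iff]
    intro ξ hξ
    obtain ⟨i, hi⟩ : ∃ i, algebraMap (PS K ℓ) (PS K n) (linP (c i)) ≠ 0 := by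
      by_contra! hcon
      simp only [h.algebraMap_eq_zero_iff, linP_dvd_linP] at hcon
      choose t ht using hcon
      let i : Fin 2 → Fin r := ![⟨0, by omega⟩, ⟨1, by omega⟩]
      have hi : Function.Injective i := by
        intro x y
        fin_cases x <;> fin_cases y <;> simp [i]
      have h2 := hc.comp i hi
      have h3 : c ∘ i = ![c (i 0), c (i 1)] := by ext j; fin_cases j <;> rfl
      rw [h3, LinearIndependent.pair_iff' (hc.ne_zero _)] at h2
      refine h2 (t (i 1) / t (i 0)) ?_
      have h0 : t (i 0) ≠ 0 := fun h0 => hc.ne_zero (i 0) (by rw [ht, h0, zero_smul])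
      rw [ht (i 0), ht (i 1), smul_smul, div_mul_cancel₀ _ h0]
    ext1 v
    have := DFunLike.congr_fun (hξ _ (hcP i)) v
    rw [AlternatingMap.smul_apply, Algebra.smul_def, AlternatingMap.zero_apply] at this
    exact (mul_eq_zero.1 this).resolve_left hi
  exact mem_range_of_smul_mem (lf_mono (fun c _ => mdel_le m c) p) (residue h hT m p)
    (residue_eq_zero_iff h hT m hm) h1 h2 h4 hζ

end Residue

section Homogeneous

variable {K σ : Type} [Field K]

lemma homogeneousComponent_mul_of_isHomogeneous {f : MvPolynomial σ K} {d : ℕ}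
    (hf : f.IsHomogeneous d) (s : MvPolynomial σ K) (n : ℕ) :
    homogeneousComponent n (s * f) = if d ≤ n then homogeneousComponent (n - d) s * f else 0 := by
  have h (i : ℕ) : homogeneousComponent n (homogeneousComponent i s * f) =
      if i + d = n then homogeneousComponent i s * f else 0 := by
    rw [homogeneousComponent_of_mem ((homogeneousComponent_isHomogeneous i s).mul hf)]
    simp only [eq_comm]
  conv_lhs => rw [← sum_homogeneousComponent s, Finset.sum_mul, map_sum]
  simp_rw [h]
  split_ifs with hd
  · have : ∀ i, i + d = n ↔ i = n - d := fun i => by omega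
    simp_rw [this, Finset.sum_ite_eq', Finset.mem_range]
    split_ifs with hi
    · rfl
    · rw [homogeneousComponent_eq_zero _ _ (by omega), zero_mul]
  · exact Finset.sum_eq_zero fun i _ => if_neg (by omega)

lemma MvPolynomial.IsHomogeneous.of_mul_left {f s : MvPolynomial σ K} {d n : ℕ}
    (hf : f.IsHomogeneous d) (hf0 : f ≠ 0) (hs0 : s ≠ 0) (h : (s * f).IsHomogeneous n) :
    d ≤ n ∧ s.IsHomogeneous (n - d) := by
  have h1 := homogeneousComponent_mul_of_isHomogeneous hf s n
  rw [homogeneousComponent_of_mem h, if_pos rfl] at h1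
  split_ifs at h1 with hd
  · refine ⟨hd, ?_⟩
    rw [mul_right_cancel₀ hf0 h1]
    exact homogeneousComponent_isHomogeneous _ _
  · exact absurd h1 (mul_ne_zero hs0 hf0)

lemma MvPolynomial.IsHomogeneous.eq_C {s : MvPolynomial σ K} (h : s.IsHomogeneous 0) :
    ∃ t : K, s = C t := by
  refine ⟨coeff 0 s, ?_⟩
  rw [← homogeneousComponent_zero, homogeneousComponent_of_mem h, if_pos rfl]

lemma MvPolynomial.IsHomogeneous.eq_zero_of_constantCoeff_ne_zero {s : MvPolynomial σ K} {n : ℕ}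
    (h : s.IsHomogeneous n) (h0 : constantCoeff s ≠ 0) : n = 0 := by
  by_contra hn
  refine h0 (h.coeff_eq_zero ?_)
  simpa using Ne.symm hn

variable {W ι : Type} [AddCommGroup W] [Module K W] [Fintype ι] {p : ℕ}

/-- The coordinates of a homogeneous form in a homogeneous basis are homogeneous. -/
lemma repr_isHomogeneous {N : Submodule (MvPolynomial σ K) (W [⋀^Fin p]→ₗ[K] MvPolynomial σ K)}
    (b : Module.Basis ι (MvPolynomial σ K) N) {D : ι → ℕ}
    (hb : ∀ i v, ((b i).1 v).IsHomogeneous (D i)) {x : N} {d : ℕ}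
    (hx : ∀ v, (x.1 v).IsHomogeneous d) (i : ι) :
    (d < D i → b.repr x i = 0) ∧ (D i ≤ d → (b.repr x i).IsHomogeneous (d - D i)) := by
  let s : ι → MvPolynomial σ K := fun i =>
    if D i ≤ d then homogeneousComponent (d - D i) (b.repr x i) else 0
  have happ (t : ι → MvPolynomial σ K) (v : Fin p → W) :
      (∑ i, t i • b i).1 v = ∑ i, t i * (b i).1 v := by
    rw [AddSubmonoidClass.coe_finsetSum, AlternatingMap.finset_sum_apply]
    rfl
  have hs : ∑ i, s i • b i = x := by
    refine Subtype.ext (AlternatingMap.ext fun v => ?_)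
    rw [happ]
    conv_rhs => rw [← if_pos (rfl : d = d) (α := MvPolynomial σ K) (t := x.1 v) (e := 0),
      ← homogeneousComponent_of_mem (hx v), ← b.sum_repr x, happ, map_sum]
    refine Finset.sum_congr rfl fun i _ => ?_
    rw [homogeneousComponent_mul_of_isHomogeneous (hb i v)]
    simp only [s]
    split_ifs <;> simp
  have hr : b.repr x i = s i := by rw [← hs, b.repr_sum_self]
  rw [hr]
  constructor
  · intro h
    exact if_neg (by omega)
  · intro h
    simp only [s, if_pos h]
    exact homogeneousComponent_isHomogeneous _ _

end Homogeneous

section Ideals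

/-- A projective ideal which contains a power of a prime element is generated by a power of
that element. -/
lemma Ideal.eq_span_pow_of_projective {R : Type} [CommRing R] [IsDomain R] {y : R} (hy : Prime y)
    (J : Ideal R) [Module.Projective R J] {N : ℕ} (hN : y ^ N ∈ J) :
    ∃ j ≤ N, J = Ideal.span {y ^ j} := by
  have hyN : ∀ j, J ≤ Ideal.span {y ^ j} → j ≤ N := fun j hj =>
    (pow_dvd_pow_iff hy.ne_zero hy.not_isUnit).1 (Ideal.mem_span_singleton.1 (hj hN))
  have h0 : J ≤ Ideal.span {y ^ 0} := by simp
  let j := Nat.findGreatest (fun j => J ≤ Ideal.span {y ^ j}) N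
  have hj : J ≤ Ideal.span {y ^ j} := Nat.findGreatest_spec (P := fun j => J ≤ Ideal.span {y ^ j})
    (Nat.zero_le N) h0
  refine ⟨j, hyN j hj, le_antisymm hj ?_⟩
  obtain ⟨x, hx, hxj⟩ : ∃ x ∈ J, ¬ y ^ (j + 1) ∣ x := by
    by_contra! hcon
    have h1 : J ≤ Ideal.span {y ^ (j + 1)} := fun x hx => Ideal.mem_span_singleton.2 (hcon x hx)
    have := Nat.le_findGreatest (P := fun j => J ≤ Ideal.span {y ^ j}) (hyN _ h1) h1
    change j + 1 ≤ j at this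
    omega
  obtain ⟨x', rfl⟩ := Ideal.mem_span_singleton.1 (hj hx)
  have hx' : ¬ y ∣ x' := fun h => hxj (by rw [pow_succ]; exact mul_dvd_mul_left _ h)
  obtain ⟨s, hs⟩ := Module.projective_def'.1 (inferInstance : Module.Projective R J)
  rw [Ideal.span_singleton_le_iff_mem]
  obtain ⟨z, hz⟩ : ∃ z : J, (z : R) = y ^ N := ⟨⟨_, hN⟩, rfl⟩
  have hdvd : ∀ g : J, y ^ (N - j) ∣ s z g := by
    intro g
    have h1 : y ^ N * s ⟨_, hx⟩ g = y ^ j * x' * s z g := by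
      rw [← smul_eq_mul, ← smul_eq_mul (y ^ j * x'), ← Finsupp.smul_apply, ← Finsupp.smul_apply,
        ← map_smul, ← map_smul]
      congr 2
      exact Subtype.ext (by simp [hz, mul_comm])
    rw [← Nat.add_sub_cancel' (hyN j hj), pow_add, mul_assoc, mul_assoc] at h1
    have h2 := mul_left_cancel₀ (pow_ne_zero _ hy.ne_zero) h1
    exact hy.pow_dvd_of_dvd_mul_left _ hx' (Dvd.intro _ h2)
  choose a ha using hdvd
  have h1 := congrArg Subtype.val (LinearMap.congr_fun hs z)
  rw [LinearMap.comp_apply, Finsupp.linearCombination_apply, Finsupp.sum] at h1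
  simp only [AddSubmonoidClass.coe_finsetSum, id, LinearMap.id_apply, Submodule.coe_smul,
    smul_eq_mul] at h1
  have h2 : y ^ j = ∑ g ∈ (s z).support, a g * g.1 := by
    refine mul_left_cancel₀ (pow_ne_zero (N - j) hy.ne_zero) ?_
    rw [← pow_add, Nat.sub_add_cancel (hyN j hj), Finset.mul_sum, ← hz, ← h1]
    exact Finset.sum_congr rfl fun g _ => by rw [ha, mul_assoc]
  rw [h2]
  exact J.sum_mem fun g _ => J.mul_mem_left _ g.2

lemma pdLT.of_retract {S M N : Type} [CommRing S] [AddCommGroup M] [Module S M] [AddCommGroup N]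
    [Module S N] {f : M →ₗ[S] N} {g : N →ₗ[S] M} (hfg : g.comp f = LinearMap.id) {n : ℕ}
    (h : pdLT S N n) : pdLT S M n :=
  CategoryTheory.Retract.hasProjectiveDimensionLT (X := ModuleCat.of S M) (Y := ModuleCat.of S N)
    ⟨ModuleCat.ofHom f, ModuleCat.ofHom g, by rw [← ModuleCat.ofHom_comp, hfg]; rfl⟩ n

end Ideals

section Exponents

variable {K : Type} [Field K] {ℓ : ℕ}

lemma FreeWithExp.exists_basis {A : Arrangement K ℓ} {m : (Fin ℓ → K) → ℕ} {d : Fin ℓ → ℕ}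
    (h : FreeWithExp A m d) : ∃ b : Module.Basis (Fin ℓ) (PS K ℓ) (lf A.hyps m 1),
      ∀ i v, ((b i).1 v).IsHomogeneous (msum A m - d i) := by
  obtain ⟨b, hb, hd, hli, hsp⟩ := h
  have hli' : LinearIndependent (PS K ℓ) (fun i => (⟨b i, hb i⟩ : Omega A m 1)) :=
    LinearIndependent.of_comp (Omega A m 1).subtype hli
  have hsp' : ⊤ ≤ Submodule.span (PS K ℓ) (Set.range fun i => (⟨b i, hb i⟩ : Omega A m 1)) := by
    rintro x -
    have := hsp x.2
    rw [show Set.range b = (Omega A m 1).subtype '' Set.range fun i => (⟨b i, hb i⟩ : Omega A m 1)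
      by rw [← Set.range_comp]; rfl, Submodule.span_image] at this
    obtain ⟨x', hx', hxx⟩ := this
    rwa [← Subtype.ext hxx]
  refine ⟨(Module.Basis.mk hli' hsp').map (omegaEquiv A m 1), fun i v => ?_⟩
  rw [Module.Basis.map_apply, Module.Basis.mk_apply, omegaEquiv_apply]
  exact (hd i).isHomogeneous_formAlt v

end Exponents

section RankTwo

variable {K : Type} [Field K] {n ℓ : ℕ} [Algebra (PS K ℓ) (PS K n)]
  {c₀ : Fin ℓ → K} {e : (Fin n → K) →ₗ[K] (Fin ℓ → K)}
  {A : Arrangement K ℓ} {c' : Fin n → K}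

lemma IsHypData.pullVec_ne_zero (h : IsHypData c₀ e) (hT : c₀ ∈ A.hyps) {c : Fin ℓ → K}
    (hc : c ∈ A.hyps) (hne : c ≠ c₀) : pullVec e c ≠ 0 := fun h0 => by
  refine A.not_linP_dvd hT hc hne.symm ?_
  rw [← h.algebraMap_eq_zero_iff, h.algebraMap_linP, h0, ← linPHom_apply, map_zero]

/-- An arrangement all of whose hyperplanes contain the codimension two subspace given by the
hyperplane `ker c'` of the distinguished hyperplane. -/
structure IsRankTwo [Algebra (PS K ℓ) (PS K n)] (A : Arrangement K ℓ) (c₀ : Fin ℓ → K)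
    (e : (Fin n → K) →ₗ[K] (Fin ℓ → K)) (c' : Fin n → K) : Prop where
  hyp : IsHypData c₀ e
  mem : c₀ ∈ A.hyps
  ne_zero : c' ≠ 0
  exists_smul : ∀ c ∈ A.hyps, ∃ t : K, pullVec e c = t • c'
  exists_ne : ∃ c ∈ A.hyps, c ≠ c₀

/-- The total multiplicity of the hyperplanes different from the distinguished one. -/
def restMult (A : Arrangement K ℓ) (m : (Fin ℓ → K) → ℕ) (c₀ : Fin ℓ → K) : ℕ :=
  ∑ c ∈ A.hyps.erase c₀, m c

namespace IsRankTwo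

lemma algebraMap_prod (h : IsRankTwo A c₀ e c') (m : (Fin ℓ → K) → ℕ) {U : Finset (Fin ℓ → K)}
    (hU : U ⊆ A.hyps.erase c₀) : ∃ τ : K, τ ≠ 0 ∧
      algebraMap (PS K ℓ) (PS K n) (∏ c ∈ U, linP c ^ m c) =
        C τ * linP c' ^ ∑ c ∈ U, m c := by
  induction U using Finset.induction_on with
  | empty => exact ⟨1, one_ne_zero, by simp⟩
  | insert c U hcU ih =>
    obtain ⟨τ, hτ, ih⟩ := ih ((Finset.subset_insert _ _).trans hU)
    have hc := Finset.mem_erase.1 (hU (Finset.mem_insert_self c U))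
    obtain ⟨t, ht⟩ := h.exists_smul c hc.2
    have ht0 : t ≠ 0 := by
      rintro rfl
      exact h.hyp.pullVec_ne_zero h.mem hc.2 hc.1 (by rw [ht, zero_smul])
    refine ⟨t ^ m c * τ, mul_ne_zero (pow_ne_zero _ ht0) hτ, ?_⟩
    rw [Finset.prod_insert hcU, Finset.sum_insert hcU, map_mul, map_pow, h.hyp.algebraMap_linP, ht,
      linP_smul, ih, map_mul, map_pow]
    ring

lemma prod_mdel (hT : c₀ ∈ A.hyps) (m : (Fin ℓ → K) → ℕ) :
    ∏ c ∈ A.hyps, linP c ^ mdel m c₀ c =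
      linP c₀ ^ (m c₀ - 1) * ∏ c ∈ A.hyps.erase c₀, linP c ^ m c := by
  rw [← Finset.mul_prod_erase _ _ hT, mdel_self]
  congr 1
  exact Finset.prod_congr rfl fun c hc => by rw [mdel_of_ne m (Finset.ne_of_mem_erase hc)]

lemma dotLin_e (h : IsRankTwo A c₀ e c') {c : Fin ℓ → K} (hc : c ∈ A.hyps) {w : Fin n → K}
    (hw : dotLin c' w = 0) : dotLin c (e w) = 0 := by
  obtain ⟨t, ht⟩ := h.exists_smul c hc
  rw [← dotLin_pullVec, ht]
  rw [dotLin_apply] at hw ⊢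
  simp only [Pi.smul_apply, smul_eq_mul, mul_assoc, ← Finset.mul_sum, hw, mul_zero]

variable [IsScalarTower K (PS K ℓ) (PS K n)] {p : ℕ}

lemma pow_dvd_residue (h : IsRankTwo A c₀ e c') (m : (Fin ℓ → K) → ℕ)
    (θ : lf A.hyps (mdel m c₀) p) (v : Fin p → Fin n → K) (hv : ∀ i, dotLin c' (v i) = 0) :
    linP c' ^ restMult A m c₀ ∣ residue h.hyp h.mem m p θ v := by
  obtain ⟨g, hg, hr⟩ := residue_spec h.hyp h.mem m θ v
  have h1 := A.prod_dvd subset_rfl (mdel m c₀) fun c hc =>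
    θ.2 c hc (fun i => e (v i)) fun i => h.dotLin_e hc (hv i)
  rw [hg, prod_mdel h.mem, mul_dvd_mul_iff_left
    (pow_ne_zero _ (linP_ne_zero h.hyp.ne_zero))] at h1
  obtain ⟨τ, -, hτ⟩ := h.algebraMap_prod m subset_rfl
  have h2 := map_dvd (algebraMap (PS K ℓ) (PS K n)) h1
  rw [hτ, ← hr] at h2
  exact (Dvd.intro_left _ rfl).trans h2

omit [IsScalarTower K (PS K ℓ) (PS K n)] in
/-- Replacing a form by its pullback to a plane transversal to the center. -/
lemma exists_transversal (h : IsRankTwo A c₀ e c') (m : (Fin ℓ → K) → ℕ) {u : Fin n → K}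
    (hu : dotLin c' u = 1) (θ : lf A.hyps (mdel m c₀) 1) :
    ∃ θ' : lf A.hyps (mdel m c₀) 1, ∀ w : Fin 1 → Fin n → K,
      θ'.1 (fun i => e (w i)) = dotLin c' (w 0) • θ.1 (fun _ => e u) := by
  obtain ⟨u₀, hu₀⟩ := exists_dotLin_eq_one h.hyp.ne_zero
  obtain ⟨r, hr, hr0, hr'⟩ := h.hyp.exists_retraction hu₀
  let P : (Fin ℓ → K) →ₗ[K] (Fin ℓ → K) :=
    (dotLin c₀).smulRight u₀ + ((dotLin c').comp r).smulRight (e u)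
  have hP (v : Fin ℓ → K) : P v = dotLin c₀ v • u₀ + dotLin c' (r v) • e u := rfl
  have hcP : ∀ c ∈ A.hyps, ∀ v, dotLin c (P v) = dotLin c v := by
    intro c hc v
    have h1 : dotLin c' (r v - dotLin c' (r v) • u) = 0 := by simp [hu]
    have h2 := h.dotLin_e hc h1
    rw [map_sub, map_sub, map_smul, map_smul, hr', projAlong_apply, map_sub, map_smul,
      sub_eq_zero] at h2
    rw [hP, map_add, map_smul, map_smul, ← h2]
    abel
  refine ⟨⟨altComp (PS K ℓ) P 1 θ.1, fun c hc v hv => ?_⟩, fun w => ?_⟩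
  · exact θ.2 c hc (fun i => P (v i)) fun i => by rw [hcP c hc, hv]
  · rw [altComp_apply]
    have : (fun i => P (e (w i))) = Function.update (fun _ => e u) 0 (dotLin c' (w 0) • e u) := by
      funext i
      rw [Subsingleton.elim i 0, Function.update_self, hP, h.hyp.dotLin_e, hr, zero_smul, zero_add]
    rw [this, AlternatingMap.map_update_smul]
    congr 2
    exact Function.update_eq_self (0 : Fin 1) (fun _ => e u)

/-- The ideal of values of residues of one-forms at a vector. -/
def resIdeal (h : IsRankTwo A c₀ e c') (m : (Fin ℓ → K) → ℕ) (u : Fin n → K) : Ideal (PS K n) where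
  carrier := {f | ∃ θ, residue h.hyp h.mem m 1 θ (fun _ => u) = f}
  add_mem' := by
    rintro _ _ ⟨θ, rfl⟩ ⟨θ', rfl⟩
    exact ⟨θ + θ', by rw [map_add]; rfl⟩
  zero_mem' := ⟨0, by rw [map_zero]; rfl⟩
  smul_mem' := by
    rintro r _ ⟨θ, rfl⟩
    obtain ⟨s, rfl⟩ := h.hyp.algebraMap_surjective r
    exact ⟨s • θ, by rw [map_smul, AlternatingMap.smul_apply, Algebra.smul_def, smul_eq_mul]⟩

lemma mem_resIdeal {h : IsRankTwo A c₀ e c'} {m : (Fin ℓ → K) → ℕ} {u : Fin n → K} {f : PS K n} :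
    f ∈ h.resIdeal m u ↔ ∃ θ, residue h.hyp h.mem m 1 θ (fun _ => u) = f := Iff.rfl

lemma exists_residue_eq (h : IsRankTwo A c₀ e c') (m : (Fin ℓ → K) → ℕ) {u : Fin n → K}
    (hu : dotLin c' u = 1) {f : PS K n} (hf : f ∈ h.resIdeal m u) :
    ∃ θ : lf A.hyps (mdel m c₀) 1,
      (∀ w : Fin 1 → Fin n → K, dotLin c' (w 0) = 0 → θ.1 (fun i => e (w i)) = 0) ∧
      ∀ w, residue h.hyp h.mem m 1 θ w = C (dotLin c' (w 0)) * f := by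
  obtain ⟨θ, rfl⟩ := hf
  obtain ⟨θ', hθ'⟩ := h.exists_transversal m hu θ
  refine ⟨θ', fun w hw => by rw [hθ', hw, zero_smul], fun w => ?_⟩
  obtain ⟨g, hg, hr⟩ := residue_spec h.hyp h.mem m θ (fun _ => u)
  rw [hr, residue_apply h.hyp h.mem m (g := C (dotLin c' (w 0)) * g), map_mul]
  · rw [← algebraMap_eq, ← algebraMap_eq, ← IsScalarTower.algebraMap_apply]
  · rw [hθ', hg, smul_eq_C_mul]
    ring

lemma exists_pow_mem_resIdeal (h : IsRankTwo A c₀ e c') {m : (Fin ℓ → K) → ℕ}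
    (hm : ∀ c ∈ A.hyps, 0 < m c) {u : Fin n → K} (hu : dotLin c' u = 1) :
    ∃ N < restMult A m c₀, linP c' ^ N ∈ h.resIdeal m u := by
  obtain ⟨L, hL, hLne⟩ := h.exists_ne
  have hLmem : L ∈ A.hyps.erase c₀ := Finset.mem_erase.2 ⟨hLne, hL⟩
  refine ⟨∑ c ∈ (A.hyps.erase c₀).erase L, m c, ?_, ?_⟩
  · rw [restMult, ← Finset.add_sum_erase _ _ hLmem]
    have := hm L hL
    omega
  · obtain ⟨τ, hτ, hprod⟩ := h.algebraMap_prod m (Finset.erase_subset L (A.hyps.erase c₀))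
    obtain ⟨t, ht⟩ := h.exists_smul L hL
    have ht0 : t ≠ 0 := by
      rintro rfl
      exact h.hyp.pullVec_ne_zero h.mem hL hLne (by rw [ht, zero_smul])
    have hLu : dotLin L (e u) = t := by
      rw [← dotLin_pullVec, ht, dotLin_apply]
      rw [dotLin_apply] at hu
      simp only [Pi.smul_apply, smul_eq_mul, mul_assoc, ← Finset.mul_sum, hu, mul_one]
    have key : C (τ * t) * linP c' ^ (∑ c ∈ (A.hyps.erase c₀).erase L, m c) ∈
        h.resIdeal m u := by
      refine mem_resIdeal.2 ⟨⟨_, smul_dForm_mem_lf A (mdel m c₀) (T := A.hyps.erase L) L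
        fun d hd hne => Finset.mem_erase.2 ⟨hne, hd⟩⟩, ?_⟩
      rw [residue_apply h.hyp h.mem m
        (g := (∏ c ∈ (A.hyps.erase c₀).erase L, linP c ^ m c) * C t), map_mul, hprod,
        ← algebraMap_eq, ← algebraMap_eq, ← IsScalarTower.algebraMap_apply, map_mul]
      · ring
      · rw [AlternatingMap.smul_apply, smul_eq_mul, dForm_apply, hLu,
          ← Finset.mul_prod_erase (A.hyps.erase L) _ (Finset.mem_erase.2 ⟨hLne.symm, h.mem⟩),
          mdel_self, mul_assoc, Finset.erase_right_comm]
        congr 2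
        exact Finset.prod_congr rfl fun c hc => by
          rw [mdel_of_ne m (Finset.ne_of_mem_erase (Finset.mem_of_mem_erase hc))]
    have h2 := (h.resIdeal m u).mul_mem_left (C (τ * t)⁻¹) key
    rwa [← mul_assoc, ← C_mul, inv_mul_cancel₀ (mul_ne_zero hτ ht0), C_1, one_mul] at h2

end IsRankTwo

end RankTwo

section Generic

lemma AlternatingMap.exists_linearMap_fin_one {k W N : Type} [CommRing k] [AddCommGroup W]
    [Module k W] [AddCommGroup N] [Module k N] (g : W [⋀^Fin 1]→ₗ[k] N) :
    ∃ f : W →ₗ[k] N, ∀ v, g v = f (v 0) :=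
  ⟨(AlternatingMap.ofSubsingleton k W N (0 : Fin 1)).symm g, fun v =>
    (DFunLike.congr_fun ((AlternatingMap.ofSubsingleton k W N (0 : Fin 1)).apply_symm_apply g)
      v).symm⟩

lemma pdLT.of_retract_submodule {S F F' : Type} [CommRing S] [AddCommGroup F] [Module S F]
    [AddCommGroup F'] [Module S F'] {M : Submodule S F} {J : Submodule S F'} (f : F' →ₗ[S] F)
    (g : F →ₗ[S] F') (hf : ∀ x ∈ J, f x ∈ M) (hg : ∀ x ∈ M, g x ∈ J) (hgf : ∀ x ∈ J, g (f x) = x)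
    {r : ℕ} (h : pdLT S M r) : pdLT S J r :=
  pdLT.of_retract (f := f.restrict hf) (g := g.restrict hg)
    (LinearMap.ext fun x => Subtype.ext (hgf x x.2)) h

end Generic

section RankTwo

variable {K : Type} [Field K] {n ℓ : ℕ} [Algebra (PS K ℓ) (PS K n)]
  {c₀ : Fin ℓ → K} {e : (Fin n → K) →ₗ[K] (Fin ℓ → K)}
  {A : Arrangement K ℓ} {c' : Fin n → K}

lemma IsHypData.isHomogeneous_algebraMap (h : IsHypData c₀ e) {f : PS K ℓ} {d : ℕ}
    (hf : f.IsHomogeneous d) : (algebraMap (PS K ℓ) (PS K n) f).IsHomogeneous d := by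
  rw [h.algebraMap_apply, ← one_mul d]
  refine hf.aeval _ fun j => IsHomogeneous.sum _ _ _ fun i _ => ?_
  simpa using (isHomogeneous_C (Fin n) (e (Pi.single i 1) j)).mul (isHomogeneous_X K i)

lemma msum_eq_add_restMult {K : Type} {ℓ : ℕ} [Field K] {A : Arrangement K ℓ} {c₀ : Fin ℓ → K}
    (h : c₀ ∈ A.hyps) (m : (Fin ℓ → K) → ℕ) : msum A m = m c₀ + restMult A m c₀ :=
  (Finset.add_sum_erase _ _ h).symm

lemma restMult_mdel {K : Type} {ℓ : ℕ} [Field K] (A : Arrangement K ℓ) (c₀ : Fin ℓ → K)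
    (m : (Fin ℓ → K) → ℕ) : restMult A (mdel m c₀) c₀ = restMult A m c₀ :=
  Finset.sum_congr rfl fun _ hc => mdel_of_ne m (Finset.ne_of_mem_erase hc)

namespace IsRankTwo

/-- Logarithmic one-forms of an arrangement of rank at least two have positive degree. -/
lemma degree_pos (h : IsRankTwo A c₀ e c') {m : (Fin ℓ → K) → ℕ} (hm : ∀ c ∈ A.hyps, 0 < m c)
    {θ : lf A.hyps m 1} (h0 : θ ≠ 0) {D : ℕ} (hθ : ∀ v, (θ.1 v).IsHomogeneous D) : 0 < D := by
  by_contra hD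
  obtain rfl : D = 0 := by omega
  obtain ⟨f, hf⟩ := θ.1.exists_linearMap_fin_one
  have hf' (v) : f v = θ.1 (fun _ => v) := (hf fun _ => v).symm
  have hker : ∀ c ∈ A.hyps, ∀ v, dotLin c v = 0 → f v = 0 := by
    intro c hc v hv
    obtain ⟨t, ht⟩ := (hθ (fun _ => v)).eq_C
    have h1 := (dvd_pow_self _ (hm c hc).ne').trans (θ.2 c hc (fun _ => v) fun _ => hv)
    rw [hf', ht]
    rw [ht] at h1
    by_contra ht0
    refine (linP_prime (A.ne_zero c hc)).not_isUnit (isUnit_of_dvd_unit h1 ?_)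
    exact (Ne.isUnit fun h2 => ht0 (by rw [h2, C_0])).map C
  obtain ⟨L, hL, hLne⟩ := h.exists_ne
  obtain ⟨w, hw⟩ := exists_dotLin_eq_one (h.hyp.pullVec_ne_zero h.mem hL hLne)
  rw [dotLin_pullVec] at hw
  refine h0 (Subtype.ext (AlternatingMap.ext fun v => ?_))
  have h1 := hker L hL _ (apply_projAlong hw (v 0))
  rw [projAlong_apply, map_sub, map_smul, hker c₀ h.mem _ (h.hyp.dotLin_e w), smul_zero,
    sub_zero] at h1
  rw [hf, h1]
  rfl

variable [IsScalarTower K (PS K ℓ) (PS K n)]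

lemma resIdeal_eq_span (h : IsRankTwo A c₀ e c') {m : (Fin ℓ → K) → ℕ}
    (hm : ∀ c ∈ A.hyps, 0 < m c) {u : Fin n → K} (hu : dotLin c' u = 1)
    (h1 : Module.Projective (PS K ℓ) (lf A.hyps m 1))
    (h2 : Module.Projective (PS K ℓ) (lf A.hyps (mdel m c₀) 1)) :
    ∃ j < restMult A m c₀, h.resIdeal m u = Ideal.span {linP c' ^ j} := by
  obtain ⟨N, hN, hNJ⟩ := h.exists_pow_mem_resIdeal hm hu
  have h3 : pdLT (PS K ℓ) (LinearMap.range (residue h.hyp h.mem m 1)) 2 :=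
    pdLT_range_residue h.hyp h.mem m (hm c₀ h.mem) (pdLT_one_iff.2 h1)
      ((pdLT_one_iff.2 h2).mono one_le_two)
  let f : PS K n →ₗ[PS K ℓ] ((Fin n → K) [⋀^Fin 1]→ₗ[K] PS K n) :=
    { toFun := fun x => x • dForm c'
      map_add' := fun x y => add_smul x y _
      map_smul' := fun s x => by
        ext1 v
        simp [Algebra.smul_def, mul_assoc] }
  let g : ((Fin n → K) [⋀^Fin 1]→ₗ[K] PS K n) →ₗ[PS K ℓ] PS K n :=
    { toFun := fun ζ => ζ (fun _ => u)
      map_add' := fun _ _ => rfl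
      map_smul' := fun _ _ => rfl }
  have h4 : pdLT (PS K ℓ) (h.resIdeal m u) 2 := by
    refine pdLT.of_retract_submodule (J := (h.resIdeal m u).restrictScalars (PS K ℓ)) f g
      (fun x hx => ?_) ?_ (fun x _ => ?_) h3
    · obtain ⟨θ, -, hθ⟩ := h.exists_residue_eq m hu hx
      refine ⟨θ, AlternatingMap.ext fun w => ?_⟩
      rw [hθ]
      exact mul_comm _ _
    · rintro _ ⟨θ, rfl⟩
      exact ⟨θ, rfl⟩
    · change x * C (dotLin c' u) = x
      rw [hu, C_1, mul_one]
  have h5 : pdLT (PS K n) (h.resIdeal m u) 1 :=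
    pdLT.change_rings h.hyp.algebraMap_surjective h.hyp.algebraMap_eq_zero_iff
      (linP_ne_zero h.hyp.ne_zero) 0 h4 n (gldimLE_mvPolynomial K n _)
  have := pdLT_one_iff.1 h5
  obtain ⟨j, hj, hJ⟩ := Ideal.eq_span_pow_of_projective (linP_prime h.ne_zero) _ hNJ
  exact ⟨j, by omega, hJ⟩

lemma degree_le_of_residue (h : IsRankTwo A c₀ e c') (m : (Fin ℓ → K) → ℕ)
    {θ : lf A.hyps (mdel m c₀) 1} {D : ℕ} (hθ : ∀ v, (θ.1 v).IsHomogeneous D)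
    {w : Fin 1 → Fin n → K} {r : ℕ} {x : PS K n}
    (hx : residue h.hyp h.mem m 1 θ w = linP c' ^ r * x) (hx0 : x ≠ 0) :
    m c₀ - 1 + r ≤ D ∧ x.IsHomogeneous (D - (m c₀ - 1) - r) := by
  obtain ⟨g, hg, hr⟩ := residue_spec h.hyp h.mem m θ w
  have hy : linP c' ^ r ≠ 0 := pow_ne_zero _ (linP_ne_zero h.ne_zero)
  have hg0 : g ≠ 0 := by
    rintro rfl
    rw [map_zero, hx] at hr
    exact mul_ne_zero hy hx0 hr
  have h1 := hθ fun i => e (w i)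
  rw [hg, mul_comm] at h1
  have hpow {b : ℕ} (c : Fin b → K) (k : ℕ) : (linP c ^ k).IsHomogeneous k := by
    simpa using (linP_isHomogeneous c).pow k
  obtain ⟨h2, h3⟩ := (hpow c₀ _).of_mul_left (pow_ne_zero _ (linP_ne_zero h.hyp.ne_zero)) hg0 h1
  have h4 := h.hyp.isHomogeneous_algebraMap h3
  rw [← hr, hx, mul_comm] at h4
  obtain ⟨h5, h6⟩ := (hpow c' r).of_mul_left hy hx0 h4
  exact ⟨by omega, h6⟩

end IsRankTwo

end RankTwo

section RankTwo

variable {K : Type} [Field K] {n ℓ : ℕ} [Algebra (PS K ℓ) (PS K n)]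
  {c₀ : Fin ℓ → K} {e : (Fin n → K) →ₗ[K] (Fin ℓ → K)}
  {A : Arrangement K ℓ} {c' : Fin n → K}

namespace IsRankTwo

lemma two_le (h : IsRankTwo A c₀ e c') : 2 ≤ ℓ := by
  by_contra! hl
  have : Subsingleton (Fin ℓ) := ⟨fun a b => Fin.ext (by omega)⟩
  obtain ⟨L, hL, hLne⟩ := h.exists_ne
  obtain ⟨i, hi⟩ := Function.ne_iff.1 h.hyp.ne_zero
  refine A.nonprop L hL c₀ h.mem hLne (L i / c₀ i) (funext fun j => ?_)
  rw [Subsingleton.elim j i, Pi.smul_apply, smul_eq_mul, div_mul_cancel₀ _ hi]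

variable [IsScalarTower K (PS K ℓ) (PS K n)]

lemma residue_eq_zero (h : IsRankTwo A c₀ e c') {m : (Fin ℓ → K) → ℕ} {u : Fin n → K}
    (hu : dotLin c' u = 1) {θ : lf A.hyps (mdel m c₀) 1}
    (h1 : residue h.hyp h.mem m 1 θ (fun _ => u) = 0)
    (h2 : ∀ v, dotLin c' v = 0 → residue h.hyp h.mem m 1 θ (fun _ => v) = 0) :
    residue h.hyp h.mem m 1 θ = 0 := by
  obtain ⟨f, hf⟩ := (residue h.hyp h.mem m 1 θ).exists_linearMap_fin_one
  rw [hf] at h1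
  simp only [hf] at h2
  refine AlternatingMap.ext fun v => ?_
  have h3 := h2 _ (apply_projAlong hu (v 0))
  rw [projAlong_apply, map_sub, map_smul, h1, smul_zero, sub_zero] at h3
  rw [hf, h3]
  rfl

theorem resIdeal_eq (h : IsRankTwo A c₀ e c') {m : (Fin ℓ → K) → ℕ}
    (hm : ∀ c ∈ A.hyps, 0 < m c) {u : Fin n → K} (hu : dotLin c' u = 1) {d1 d2 : ℕ}
    (hd : FreeWithExp A m (expVec d1 d2)) (hd' : FreeWithExp A (mdel m c₀) (expVec (d1 - 1) d2)) :
    ∃ j, j + d2 = restMult A m c₀ ∧ h.resIdeal m u = Ideal.span {linP c' ^ j} := by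
  obtain ⟨b, hb⟩ := hd.exists_basis
  obtain ⟨b', hb'⟩ := hd'.exists_basis
  obtain ⟨j, hj, hJ⟩ := h.resIdeal_eq_span hm hu (Module.Projective.of_basis b)
    (Module.Projective.of_basis b')
  refine ⟨j, ?_, hJ⟩
  have hm0 := hm c₀ h.mem
  rw [msum_eq_add_restMult h.mem] at hb hb'
  rw [restMult_mdel, mdel_self] at hb'
  have hy : linP c' ^ j ≠ 0 := pow_ne_zero _ (linP_ne_zero h.ne_zero)
  have hdvd (θ : lf A.hyps (mdel m c₀) 1) :
      ∃ x, residue h.hyp h.mem m 1 θ (fun _ => u) = linP c' ^ j * x :=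
    Ideal.mem_span_singleton.1 (hJ ▸ mem_resIdeal.2 ⟨θ, rfl⟩)
  choose x hx using fun i => hdvd (b' i)
  obtain ⟨i₀, hi₀⟩ : ∃ i, constantCoeff (x i) ≠ 0 := by
    obtain ⟨θ, hθ⟩ : linP c' ^ j ∈ h.resIdeal m u := hJ ▸ Ideal.mem_span_singleton_self _
    rw [← b'.sum_repr θ, map_sum, AlternatingMap.finset_sum_apply] at hθ
    simp only [map_smul, AlternatingMap.smul_apply, hx, Algebra.smul_def,
      mul_left_comm _ (linP c' ^ j)] at hθ
    rw [← Finset.mul_sum, mul_eq_left₀ hy] at hθ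
    by_contra! hcon
    have := congrArg constantCoeff hθ
    simp [hcon] at this
  have hx0 : x i₀ ≠ 0 := fun h0 => hi₀ (by rw [h0, map_zero])
  obtain ⟨hle, hhom⟩ := h.degree_le_of_residue m (hb' i₀) (hx i₀) hx0
  have hdeg := hhom.eq_zero_of_constantCoeff_ne_zero hi₀
  have hl := h.two_le
  let i₁ : Fin ℓ := ⟨1, by omega⟩
  have hi₁ : (expVec d1 d2 : Fin ℓ → ℕ) i₁ = d2 := by simp [expVec, i₁]
  have hi₁' : (expVec (d1 - 1) d2 : Fin ℓ → ℕ) i₁ = d2 := by simp [expVec, i₁]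
  have hpos := h.degree_pos hm (b.ne_zero i₁) (hb i₁)
  rw [hi₁] at hpos
  have hother {a : ℕ} (i : Fin ℓ) (hi : (i : ℕ) ≠ 0) (hii : i ≠ i₁) :
      (expVec a d2 : Fin ℓ → ℕ) i = 0 := by
    have : (i : ℕ) ≠ 1 := fun hh => hii (Fin.ext hh)
    simp [expVec, hi, this]
  by_cases h1 : i₀ = i₁
  · rw [h1, hi₁'] at hle hdeg
    omega
  by_cases h0 : (i₀ : ℕ) = 0
  swap
  · rw [hother i₀ h0 h1] at hdeg hle
    omega
  have he₀ : (expVec d1 d2 : Fin ℓ → ℕ) i₀ = d1 := by simp [expVec, h0]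
  have he₀' : (expVec (d1 - 1) d2 : Fin ℓ → ℕ) i₀ = d1 - 1 := by simp [expVec, h0]
  rw [he₀'] at hdeg hle
  by_contra hne
  rcases lt_or_gt_of_ne hne with hlt | hgt
  · -- the first basis element of `(A, m)` is a multiple of that of the deletion
    let θ : lf A.hyps (mdel m c₀) 1 := ⟨(b i₀).1, lf_mono (fun c _ => mdel_le m c) 1 (b i₀).2⟩
    have hr := repr_isHomogeneous b' hb' (x := θ) (hb i₀)
    have hr0 : ∀ i, i ≠ i₀ → b'.repr θ i = 0 := by
      intro i hi
      refine (hr i).1 ?_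
      rw [he₀]
      by_cases hii : i = i₁
      · rw [hii, hi₁']
        omega
      · rw [hother i (fun hh => hi (Fin.ext (hh.trans h0.symm))) hii]
        omega
    have hθ : θ = b'.repr θ i₀ • b' i₀ := by
      conv_lhs => rw [← b'.sum_repr θ]
      exact Finset.sum_eq_single i₀ (fun i _ hi => by rw [hr0 i hi, zero_smul]) (by simp)
    have hr1 := (hr i₀).2 (by rw [he₀, he₀']; omega)
    rw [he₀, he₀', show m c₀ + restMult A m c₀ - d1 -
      (m c₀ - 1 + restMult A m c₀ - (d1 - 1)) = 0 by omega] at hr1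
    obtain ⟨t, ht⟩ := hr1.eq_C
    have hres := congrArg (residue h.hyp h.mem m 1) hθ
    rw [(residue_eq_zero_iff h.hyp h.mem m hm0 θ).2 (b i₀).2, map_smul, ht] at hres
    have hres' := DFunLike.congr_fun hres (fun _ => u)
    rw [AlternatingMap.smul_apply, AlternatingMap.zero_apply, hx, Algebra.smul_def,
      ← algebraMap_eq, ← IsScalarTower.algebraMap_apply, eq_comm, mul_eq_zero, mul_eq_zero] at hres'
    simp only [hy, hx0, or_false, map_eq_zero] at hres'
    rw [ht, hres', C_0, zero_smul] at hθ
    have hv : (b i₀).1 = 0 := congrArg (fun z : lf A.hyps (mdel m c₀) 1 => z.1) hθ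
    exact b.ne_zero i₀ (Subtype.ext hv)
  · -- the second basis element of the deletion is of too small degree
    have hb1 := hb' i₁
    rw [hi₁'] at hb1
    have hz : residue h.hyp h.mem m 1 (b' i₁) = 0 := by
      refine h.residue_eq_zero hu ?_ fun v hv => ?_
      · by_contra hcon
        have := (h.degree_le_of_residue m hb1 (hx i₁)
          (right_ne_zero_of_mul (hx i₁ ▸ hcon))).1
        omega
      · by_contra hcon
        obtain ⟨z, hz⟩ := h.pow_dvd_residue m (b' i₁) (fun _ => v) fun _ => hv
        have := (h.degree_le_of_residue m hb1 hz (right_ne_zero_of_mul (hz ▸ hcon))).1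
        omega
    let ξ : lf A.hyps m 1 := ⟨(b' i₁).1, (residue_eq_zero_iff h.hyp h.mem m hm0 _).1 hz⟩
    have hξ : ξ = 0 := by
      refine b.ext_elem fun i => ?_
      rw [map_zero, Finsupp.zero_apply]
      refine (repr_isHomogeneous b hb (x := ξ) hb1 i).1 ?_
      by_cases hi : i = i₀
      · rw [hi, he₀]
        omega
      · by_cases hii : i = i₁
        · rw [hii, hi₁]
          omega
        · rw [hother i (fun hh => hi (Fin.ext (hh.trans h0.symm))) hii]
          omega
    have hv : (b' i₁).1 = 0 := congrArg (fun z : lf A.hyps m 1 => z.1) hξ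
    exact b'.ne_zero i₁ (Subtype.ext hv)

end IsRankTwo

end RankTwo

section Bounded

variable {K : Type} [Field K] {n ℓ : ℕ}

lemma smul_prod_mem_lf (T : Finset (Fin ℓ → K)) (m : (Fin ℓ → K) → ℕ) {p : ℕ}
    (η : (Fin ℓ → K) [⋀^Fin p]→ₗ[K] PS K ℓ) : (∏ c ∈ T, linP c ^ m c) • η ∈ lf T m p :=
  fun c hc v _ => by
    rw [AlternatingMap.smul_apply, smul_eq_mul]
    exact (Finset.dvd_prod_of_mem (fun c => linP c ^ m c) hc).mul_right _

/-- The divisibility properties characterizing residues along a codimension two subspace: all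
values are divisible by `c' ^ g`, and those on the hyperplane `ker c'` by `c' ^ N`. -/
def IsBounded (c' : Fin n → K) (g N : ℕ) {p : ℕ} (ζ : (Fin n → K) [⋀^Fin p]→ₗ[K] PS K n) : Prop :=
  (∀ v, linP c' ^ g ∣ ζ v) ∧ ∀ v : Fin p → Fin n → K, (∀ i, dotLin c' (v i) = 0) →
    linP c' ^ N ∣ ζ v

variable [Algebra (PS K ℓ) (PS K n)] {c₀ : Fin ℓ → K} {e : (Fin n → K) →ₗ[K] (Fin ℓ → K)}
  {A : Arrangement K ℓ} {c' : Fin n → K}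

/-- Extension of a form along a retraction onto the hyperplane. -/
lemma IsHypData.exists_extend (h : IsHypData c₀ e) {p : ℕ}
    (ζ : (Fin n → K) [⋀^Fin p]→ₗ[K] PS K n) : ∃ ξ : (Fin ℓ → K) [⋀^Fin p]→ₗ[K] PS K ℓ,
      ∀ v : Fin p → Fin n → K, algebraMap (PS K ℓ) (PS K n) (ξ (fun i => e (v i))) = ζ v := by
  obtain ⟨u₀, hu₀⟩ := exists_dotLin_eq_one h.ne_zero
  obtain ⟨r, hr, -, -⟩ := h.exists_retraction hu₀
  obtain ⟨σ, hσ, -⟩ := h.exists_section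
  refine ⟨σ.toLinearMap.compAlternatingMap (ζ.compLinearMap r), fun v => ?_⟩
  refine (hσ _).trans ?_
  simp [hr]

variable [IsScalarTower K (PS K ℓ) (PS K n)]

namespace IsRankTwo

lemma smul_mem_range_residue (h : IsRankTwo A c₀ e c') (m : (Fin ℓ → K) → ℕ) {p : ℕ}
    (ζ : (Fin n → K) [⋀^Fin p]→ₗ[K] PS K n) :
    linP c' ^ restMult A m c₀ • ζ ∈ LinearMap.range (residue h.hyp h.mem m p) := by
  obtain ⟨τ, hτ, hprod⟩ := h.algebraMap_prod m subset_rfl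
  obtain ⟨ξ, hξ⟩ := h.hyp.exists_extend ((C τ⁻¹ : PS K n) • ζ)
  refine ⟨⟨_, smul_prod_mem_lf A.hyps (mdel m c₀) ξ⟩, AlternatingMap.ext fun v => ?_⟩
  rw [residue_apply h.hyp h.mem m (g := (∏ c ∈ A.hyps.erase c₀, linP c ^ m c) *
    ξ (fun i => e (v i))), map_mul, hξ, hprod, AlternatingMap.smul_apply, AlternatingMap.smul_apply,
    smul_eq_mul, smul_eq_mul]
  · have : C τ * C τ⁻¹ = (1 : PS K n) := by rw [← C_mul, mul_inv_cancel₀ hτ, C_1]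
    rw [restMult, mul_mul_mul_comm, this, one_mul]
  · rw [AlternatingMap.smul_apply, prod_mdel h.mem, smul_eq_mul, mul_assoc]

lemma dvd_residue (h : IsRankTwo A c₀ e c') (m : (Fin ℓ → K) → ℕ) {u : Fin n → K}
    (hu : dotLin c' u = 1) {j : ℕ} (hJ : h.resIdeal m u = Ideal.span {linP c' ^ j})
    (hj : j ≤ restMult A m c₀) {p : ℕ} (η : lf A.hyps (mdel m c₀) p) (v : Fin p → Fin n → K) :
    linP c' ^ j ∣ residue h.hyp h.mem m p η v := by
  refine AlternatingMap.dvd_apply_of_ker _ _ hu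
    (fun w hw => (pow_dvd_pow _ hj).trans (h.pow_dvd_residue m η w hw)) (fun w i hi hw => ?_) v
  let θ : (Fin ℓ → K) [⋀^Fin 1]→ₗ[K] PS K ℓ := AlternatingMap.ofSubsingleton K _ _ (0 : Fin 1)
    (η.1.toMultilinearMap.toLinearMap (fun i => e (w i)) i)
  have hθ (x : Fin 1 → Fin ℓ → K) : θ x = η.1 (Function.update (fun i => e (w i)) i (x 0)) := rfl
  have hmem : θ ∈ lf A.hyps (mdel m c₀) 1 := by
    intro c hc x hx
    rw [hθ]
    refine η.2 c hc _ fun k => ?_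
    by_cases hk : k = i
    · subst hk
      rw [Function.update_self]
      exact hx 0
    · rw [Function.update_of_ne hk]
      exact h.dotLin_e hc (hw k hk)
  obtain ⟨g, hg, hr⟩ := residue_spec h.hyp h.mem m η w
  have h1 : residue h.hyp h.mem m 1 ⟨θ, hmem⟩ (fun _ => u) = algebraMap _ _ g := by
    refine residue_apply h.hyp h.mem m ?_
    rw [← hg]
    refine (hθ _).trans (congrArg η.1 ?_)
    rw [← hi, Function.update_eq_self_iff]
  rw [hr, ← h1, ← Ideal.mem_span_singleton, ← hJ]
  exact ⟨_, rfl⟩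

/-- Residues along a codimension two subspace. -/
theorem mem_range_residue_iff (h : IsRankTwo A c₀ e c') (m : (Fin ℓ → K) → ℕ) {u : Fin n → K}
    (hu : dotLin c' u = 1) {j : ℕ} (hJ : h.resIdeal m u = Ideal.span {linP c' ^ j})
    (hj : j ≤ restMult A m c₀) {p : ℕ} (ζ : (Fin n → K) [⋀^Fin p]→ₗ[K] PS K n) :
    ζ ∈ LinearMap.range (residue h.hyp h.mem m p) ↔ IsBounded c' j (restMult A m c₀) ζ := by
  have hy (k : ℕ) : linP c' ^ k ≠ 0 := pow_ne_zero _ (linP_ne_zero h.ne_zero)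
  constructor
  · rintro ⟨η, rfl⟩
    exact ⟨h.dvd_residue m hu hJ hj η, h.pow_dvd_residue m η⟩
  rintro ⟨h1, h2⟩
  cases p with
  | zero =>
    obtain ⟨ζ', rfl⟩ := ζ.exists_eq_smul (hy _) fun w => h2 w fun i => i.elim0
    exact h.smul_mem_range_residue m ζ'
  | succ q =>
    obtain ⟨ζ₁, hζ₁⟩ := (ζ.compLinearMap (projAlong (dotLin c') u)).exists_eq_smul (hy _)
      fun w => h2 _ fun i => apply_projAlong hu (w i)
    obtain ⟨ζ₂, hζ₂⟩ := (ζ.curryLeft u).exists_eq_smul (hy j) fun w => h1 _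
    obtain ⟨θ, -, hθ⟩ := h.exists_residue_eq m hu (hJ ▸ Ideal.mem_span_singleton_self _)
    obtain ⟨ξ, hξ⟩ := h.hyp.exists_extend ζ₂
    obtain ⟨f, hf⟩ := θ.1.exists_linearMap_fin_one
    have : IsScalarTower K (PS K ℓ) ((Fin ℓ → K) [⋀^Fin q]→ₗ[K] PS K ℓ) :=
      ⟨fun a s f => AlternatingMap.ext fun v => smul_assoc a s (f v)⟩
    have hmem : AlternatingMap.alternatizeUncurryFin (f.smulRight ξ) ∈
        lf A.hyps (mdel m c₀) (q + 1) := by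
      intro c hc v hv
      rw [AlternatingMap.alternatizeUncurryFin_apply]
      refine Finset.dvd_sum fun i _ => ?_
      rw [zsmul_eq_mul]
      refine Dvd.dvd.mul_left (Dvd.dvd.mul_right ?_ _) _
      rw [← hf fun _ => v i]
      exact θ.2 c hc _ fun _ => hv i
    have key : ζ = linP c' ^ restMult A m c₀ • ζ₁ +
        residue h.hyp h.mem m (q + 1) ⟨_, hmem⟩ := by
      refine AlternatingMap.ext fun v => ?_
      rw [AlternatingMap.add_apply, ← hζ₁, ζ.apply_eq_add_alternatize hu v]
      congr 1
      choose g hg hr using fun w : Fin n → K => residue_spec h.hyp h.mem m θ (fun _ => w)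
      rw [residue_apply h.hyp h.mem m
        (g := ∑ i : Fin (q + 1), (-1 : ℤ) ^ (i : ℕ) • (g (v i) * ξ (fun k => e (i.removeNth v k)))),
        AlternatingMap.alternatizeUncurryFin_apply, map_sum]
      · refine Finset.sum_congr rfl fun i _ => ?_
        rw [map_zsmul, map_mul, hξ, ← hr, hθ, hζ₂]
        simp [smul_eq_C_mul, mul_assoc]
      · rw [AlternatingMap.alternatizeUncurryFin_apply, Finset.mul_sum]
        refine Finset.sum_congr rfl fun i _ => ?_
        rw [mul_smul_comm, ← mul_assoc, ← hg, hf]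
        rfl
    rw [key]
    exact Submodule.add_mem _ (h.smul_mem_range_residue m ζ₁) ⟨_, rfl⟩

end IsRankTwo

end Bounded

section Generic

variable {S F : Type} [CommRing S] [AddCommGroup F] [Module S F]

/-- An element outside a submodule has a multiple whose residue class has prime annihilator. -/
lemma Submodule.exists_isPrime_smul_mem_iff [IsNoetherianRing S] (M : Submodule S F) {x : F}
    (hx : x ∉ M) : ∃ (s : S) (P : Ideal S), P.IsPrime ∧ ∀ t, t ∈ P ↔ t • s • x ∈ M := by
  let y : Submodule.span S {M.mkQ x} := ⟨M.mkQ x, Submodule.mem_span_singleton_self _⟩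
  have hy : y ≠ 0 := fun h => hx ((Submodule.Quotient.mk_eq_zero _).1 (congrArg Subtype.val h))
  obtain ⟨P, hP, -⟩ := exists_le_isAssociatedPrime_of_isNoetherianRing S y hy
  obtain ⟨hP, ⟨z, hz⟩, hPz⟩ := isAssociatedPrime_iff.1 hP
  obtain ⟨s, rfl⟩ := Submodule.mem_span_singleton.1 hz
  refine ⟨s, P, hP, fun t => ?_⟩
  rw [hPz, Submodule.mem_colon_singleton, Submodule.mem_bot, Subtype.ext_iff]
  refine Iff.trans ?_ (Submodule.Quotient.mk_eq_zero M)
  rfl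

end Generic

section Restriction

variable {K : Type} [Field K] {n ℓ : ℕ}

/-- The localization of an arrangement at the codimension two subspace given by the hyperplane
`ker c'` of the hyperplane parametrized by `e`. -/
def locRestr (A : Arrangement K ℓ) (e : (Fin n → K) →ₗ[K] (Fin ℓ → K)) (c' : Fin n → K) :
    Arrangement K ℓ where
  hyps := A.hyps.filter (fun c => ∃ t : K, pullVec e c = t • c')
  ne_zero := fun c hc => A.ne_zero c (Finset.mem_filter.mp hc).1
  nonprop := fun c hc c'' hc'' =>
    A.nonprop c (Finset.mem_filter.mp hc).1 c'' (Finset.mem_filter.mp hc'').1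

lemma mem_locRestr {A : Arrangement K ℓ} {e : (Fin n → K) →ₗ[K] (Fin ℓ → K)} {c' : Fin n → K}
    {c : Fin ℓ → K} : c ∈ (locRestr A e c').hyps ↔ c ∈ A.hyps ∧ ∃ t : K, pullVec e c = t • c' :=
  Finset.mem_filter

lemma pullVec_add_smul (e : (Fin n → K) →ₗ[K] (Fin ℓ → K)) (a b : K) (c d : Fin ℓ → K) :
    pullVec e (a • c + b • d) = a • pullVec e c + b • pullVec e d := by
  ext i
  simp [pullVec, add_mul, Finset.sum_add_distrib, Finset.mul_sum, mul_assoc]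

variable [Algebra (PS K ℓ) (PS K n)] {c₀ : Fin ℓ → K} {e : (Fin n → K) →ₗ[K] (Fin ℓ → K)}
  {A : Arrangement K ℓ} {B : Arrangement K n}

lemma IsHypData.pullVec_self (h : IsHypData c₀ e) : pullVec e c₀ = 0 := by
  ext j
  rw [← dotLin_single (pullVec e _), dotLin_pullVec, h.dotLin_e]
  rfl

variable [IsScalarTower K (PS K ℓ) (PS K n)] {T T' : Finset (Fin ℓ → K)} {p : ℕ}

lemma range_residue_anti (h : IsHypData c₀ e) (hT' : c₀ ∈ T') (hTT' : T' ⊆ T)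
    (m : (Fin ℓ → K) → ℕ) : LinearMap.range (residue h (hTT' hT') m p) ≤
      LinearMap.range (residue h hT' m p) := by
  rintro _ ⟨η, rfl⟩
  refine ⟨⟨η.1, fun c hc => η.2 c (hTT' hc)⟩, AlternatingMap.ext fun v => ?_⟩
  obtain ⟨g, hg, hr⟩ := residue_spec h (hTT' hT') m η v
  rw [hr]
  exact residue_apply h hT' m hg

lemma prod_smul_mem_range_residue (h : IsHypData c₀ e) (hT' : c₀ ∈ T') (hTT' : T' ⊆ T)
    (m : (Fin ℓ → K) → ℕ) {ζ : (Fin n → K) [⋀^Fin p]→ₗ[K] PS K n}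
    (hζ : ζ ∈ LinearMap.range (residue h hT' m p)) :
    (∏ c ∈ T \ T', linP c ^ m c) • ζ ∈ LinearMap.range (residue h (hTT' hT') m p) := by
  obtain ⟨η, rfl⟩ := hζ
  have hmem : (∏ c ∈ T \ T', linP c ^ m c) • η.1 ∈ lf T (mdel m c₀) p := by
    intro c hc v hv
    rw [AlternatingMap.smul_apply, smul_eq_mul]
    by_cases hcT : c ∈ T'
    · exact (η.2 c hcT v hv).mul_left _
    · refine Dvd.dvd.mul_right ?_ _
      rw [mdel_of_ne m (ne_of_mem_of_not_mem hT' hcT).symm]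
      exact Finset.dvd_prod_of_mem (fun c => linP c ^ m c) (Finset.mem_sdiff.2 ⟨hc, hcT⟩)
  refine ⟨⟨_, hmem⟩, AlternatingMap.ext fun v => ?_⟩
  obtain ⟨g, hg, hr⟩ := residue_spec h hT' m η v
  rw [AlternatingMap.smul_apply, hr, Algebra.smul_def, ← map_mul]
  refine residue_apply h (hTT' hT') m ?_
  rw [AlternatingMap.smul_apply, hg, smul_eq_mul]
  ring

lemma mem_range_residue_singleton (h : IsHypData c₀ e) (m : (Fin ℓ → K) → ℕ)
    (ζ : (Fin n → K) [⋀^Fin p]→ₗ[K] PS K n) :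
    ζ ∈ LinearMap.range (residue h (Finset.mem_singleton_self c₀) m p) := by
  obtain ⟨ξ, hξ⟩ := h.exists_extend ζ
  have hmem : linP c₀ ^ (m c₀ - 1) • ξ ∈ lf {c₀} (mdel m c₀) p := by
    intro c hc v _
    rw [Finset.mem_singleton.1 hc, mdel_self]
    exact dvd_mul_right _ _
  refine ⟨⟨_, hmem⟩, AlternatingMap.ext fun v => ?_⟩
  rw [← hξ]
  exact residue_apply h _ m rfl

/-- Residues of logarithmic forms are characterized by local conditions in codimension two. -/
theorem mem_range_residue_iff_forall (h : IsHypData c₀ e) (hc₀ : c₀ ∈ A.hyps)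
    {m : (Fin ℓ → K) → ℕ} (hm : 0 < m c₀)
    (hB : ∀ c ∈ A.hyps, c ≠ c₀ → ∃ c' ∈ B.hyps, ∃ t : K, pullVec e c = t • c')
    {g N : (Fin n → K) → ℕ}
    (hloc : ∀ c' ∈ B.hyps, ∀ (hT : c₀ ∈ (locRestr A e c').hyps)
      (ζ : (Fin n → K) [⋀^Fin p]→ₗ[K] PS K n),
      ζ ∈ LinearMap.range (residue h hT m p) ↔ IsBounded c' (g c') (N c') ζ)
    (hfree : ∀ x ≠ 0, dotLin c₀ x = 0 → Module.Projective (PS K ℓ) (lf (locArr A x).hyps m p))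
    (hp : p + 3 ≤ ℓ) (hpd : pdLT (PS K ℓ) (lf A.hyps m p) (p + 1))
    (ζ : (Fin n → K) [⋀^Fin p]→ₗ[K] PS K n) :
    ζ ∈ LinearMap.range (residue h hc₀ m p) ↔ ∀ c' ∈ B.hyps, IsBounded c' (g c') (N c') ζ := by
  have hmem (c' : Fin n → K) : c₀ ∈ (locRestr A e c').hyps :=
    mem_locRestr.2 ⟨hc₀, 0, by rw [h.pullVec_self, zero_smul]⟩
  have hsub (c' : Fin n → K) : (locRestr A e c').hyps ⊆ A.hyps := Finset.filter_subset _ _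
  refine ⟨fun hζ c' hc' => (hloc c' hc' (hmem c') ζ).1
    (range_residue_anti h (hmem c') (hsub c') m hζ), fun hζ => ?_⟩
  by_contra hcon
  obtain ⟨s, P, hP, hPζ⟩ := Submodule.exists_isPrime_smul_mem_iff _ hcon
  have hPM : s • ζ ∉ LinearMap.range (residue h hc₀ m p) := fun hmem =>
    hP.ne_top ((Ideal.eq_top_iff_one P).2 ((hPζ 1).2 (by rwa [one_smul])))
  have hbdd {c' : Fin n → K} (hc' : c' ∈ B.hyps) :
      s • ζ ∈ LinearMap.range (residue h (hmem c') m p) :=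
    Submodule.smul_mem _ _ ((hloc c' hc' (hmem c') ζ).2 (hζ c' hc'))
  -- a localization containing all hyperplanes through `P` would detect `s • ζ`
  have key {T' : Finset (Fin ℓ → K)} (hT' : c₀ ∈ T') (hTT' : T' ⊆ A.hyps)
      (hPT' : ∀ c ∈ A.hyps, linP c ∈ P → c ∈ T') :
      s • ζ ∉ LinearMap.range (residue h hT' m p) := fun hT => by
    have h1 := (hPζ _).2 (prod_smul_mem_range_residue h hT' hTT' m hT)
    obtain ⟨c, hc, h2⟩ := (hP.prod_mem_iff).1 h1
    rw [Finset.mem_sdiff] at hc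
    exact hc.2 (hPT' c hc.1 (hP.mem_of_pow_mem _ h2))
  have h₀ : linP c₀ ∈ P := by
    refine (hPζ _).2 ?_
    have : linP c₀ • s • ζ = 0 := AlternatingMap.ext fun v => by
      rw [AlternatingMap.smul_apply, Algebra.smul_def, (h.algebraMap_eq_zero_iff _).2 dvd_rfl,
        zero_mul, AlternatingMap.zero_apply]
    rw [this]
    exact Submodule.zero_mem _
  obtain ⟨c₁, hc₁, hc₁P, hc₁0⟩ : ∃ c₁ ∈ A.hyps, linP c₁ ∈ P ∧ c₁ ≠ c₀ := by
    by_contra! hall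
    exact key (Finset.mem_singleton_self c₀) (Finset.singleton_subset_iff.2 hc₀)
      (fun c hc hcP => Finset.mem_singleton.2 (hall c hc hcP))
      (mem_range_residue_singleton h m _)
  obtain ⟨c', hc', t₁, ht₁⟩ := hB c₁ hc₁ hc₁0
  have ht₁0 : t₁ ≠ 0 := by
    rintro rfl
    exact h.pullVec_ne_zero hc₀ hc₁ hc₁0 (by rw [ht₁, zero_smul])
  obtain ⟨c₂, hc₂, hc₂P, hc₂'⟩ : ∃ c₂ ∈ A.hyps, linP c₂ ∈ P ∧ c₂ ∉ (locRestr A e c').hyps := by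
    by_contra! hall
    exact key (hmem c') (hsub c') hall (hbdd hc')
  by_cases hU : Submodule.span K {c | c ∈ A.hyps ∧ linP c ∈ P} = ⊤
  · obtain ⟨f, hf, -, hli⟩ := Submodule.exists_fun_fin_finrank_span_eq K
      {c : Fin ℓ → K | c ∈ A.hyps ∧ linP c ∈ P}
    refine hPM (mem_range_residue_of_smul_mem h m A hc₀ hm hP.ne_top hli (fun i => (hf i).2)
      (q := p) ?_ hpd fun t ht => (hPζ t).1 ht)
    rw [hU, finrank_top, Module.finrank_fin_fun]
    exact hp
  · obtain ⟨φ, hφ0, hφ⟩ := Submodule.exists_le_ker_of_lt_top _ (lt_top_iff_ne_top.2 hU)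
    let x : Fin ℓ → K := fun i => φ (Pi.single i 1)
    have hx (c : Fin ℓ → K) : ∑ i, c i * x i = φ c := by
      conv_rhs => rw [← Finset.univ_sum_single c, map_sum]
      refine Finset.sum_congr rfl fun i _ => ?_
      rw [← smul_eq_mul, ← map_smul, ← Pi.single_smul, smul_eq_mul, mul_one]
    have hx0 : x ≠ 0 := fun h0 => hφ0 (LinearMap.ext fun c => by rw [← hx, h0]; simp)
    have hPx (c : Fin ℓ → K) (hc : c ∈ A.hyps) (hcP : linP c ∈ P) : c ∈ (locArr A x).hyps :=
      Finset.mem_filter.2 ⟨hc, (hx c).trans (hφ (Submodule.subset_span ⟨hc, hcP⟩))⟩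
    have hsub' : (locArr A x).hyps ⊆ A.hyps := Finset.filter_subset _ _
    have hproj := hfree x hx0 (by
      rw [dotLin_apply]
      exact (Finset.mem_filter.1 (hPx c₀ hc₀ h₀)).2)
    have hli : LinearIndependent K ![c₀, c₁, c₂] := by
      rw [Fintype.linearIndependent_iff]
      intro a ha
      simp only [Fin.sum_univ_three, Matrix.cons_val_zero, Matrix.cons_val_one,
        Matrix.cons_val] at ha
      have h3 := congrArg (pullVec e) ha
      rw [← one_smul K (a 0 • c₀ + a 1 • c₁), pullVec_add_smul, pullVec_add_smul, h.pullVec_self,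
        ht₁, show pullVec e (0 : Fin ℓ → K) = 0 by ext; simp [pullVec], smul_zero, zero_add,
        one_smul, smul_smul] at h3
      have ha2 : a 2 = 0 := by
        by_contra ha2
        refine hc₂' (mem_locRestr.2 ⟨hc₂, -((a 2)⁻¹ * (a 1 * t₁)), ?_⟩)
        rw [neg_smul, mul_smul, ← smul_neg, ← eq_neg_of_add_eq_zero_right h3, smul_smul,
          inv_mul_cancel₀ ha2, one_smul]
      rw [ha2, zero_smul, add_zero, smul_eq_zero, mul_eq_zero] at h3
      have ha1 := (h3.resolve_right (B.ne_zero c' hc')).resolve_right ht₁0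
      rw [ha1, ha2, zero_smul, zero_smul, add_zero, add_zero, smul_eq_zero] at ha
      have ha0 := ha.resolve_right h.ne_zero
      intro i
      fin_cases i
      exacts [ha0, ha1, ha2]
    refine key (hPx c₀ hc₀ h₀) hsub' hPx (mem_range_residue_of_smul_mem h m (locArr A x)
      (hPx c₀ hc₀ h₀) hm hP.ne_top hli (fun i => ?_) (q := 0) le_rfl
      (pdLT_one_iff.2 hproj) fun t ht => range_residue_anti h _ hsub' m ((hPζ t).1 ht))
    fin_cases i
    exacts [h₀, hc₁P, hc₂P]

end Restriction

section Restriction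

variable {K : Type} [Field K] {n ℓ : ℕ} {B : Arrangement K n} {p : ℕ}

lemma Arrangement.forall_isBounded_iff (B : Arrangement K n) {g N ms : (Fin n → K) → ℕ}
    (hg : ∀ c ∈ B.hyps, g c + ms c = N c) (ζ : (Fin n → K) [⋀^Fin p]→ₗ[K] PS K n) :
    (∀ c ∈ B.hyps, IsBounded c (g c) (N c) ζ) ↔
      ∃ ξ ∈ lf B.hyps ms p, (∏ c ∈ B.hyps, linP c ^ g c) • ξ = ζ := by
  have hne (c : Fin n → K) (hc : c ∈ B.hyps) : linP c ^ g c ≠ 0 :=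
    pow_ne_zero _ (linP_ne_zero (B.ne_zero c hc))
  constructor
  · intro hζ
    obtain ⟨ξ, rfl⟩ := ζ.exists_eq_smul (Finset.prod_ne_zero_iff.2 hne)
      fun w => B.prod_dvd subset_rfl g fun c hc => (hζ c hc).1 w
    refine ⟨ξ, fun c hc v hv => ?_, rfl⟩
    have h1 := (hζ c hc).2 v hv
    rw [AlternatingMap.smul_apply, smul_eq_mul, ← hg c hc, pow_add, ← Finset.mul_prod_erase _ _ hc,
      mul_assoc, mul_dvd_mul_iff_left (hne c hc)] at h1
    exact (linP_prime (B.ne_zero c hc)).pow_dvd_of_dvd_mul_left _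
      (B.not_linP_dvd_prod hc (Finset.erase_subset _ _) (Finset.notMem_erase c _) g) h1
  · rintro ⟨ξ, hξ, rfl⟩ c hc
    refine ⟨fun v => ?_, fun v hv => ?_⟩
    · rw [AlternatingMap.smul_apply, smul_eq_mul]
      exact (Finset.dvd_prod_of_mem (fun c => linP c ^ g c) hc).mul_right _
    · rw [AlternatingMap.smul_apply, smul_eq_mul, ← hg c hc, pow_add]
      exact mul_dvd_mul (Finset.dvd_prod_of_mem (fun c => linP c ^ g c) hc) (hξ c hc v hv)

variable [Algebra (PS K ℓ) (PS K n)] {c₀ : Fin ℓ → K} {e : (Fin n → K) →ₗ[K] (Fin ℓ → K)}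
  {A : Arrangement K ℓ}

lemma IsHypData.isRankTwo_locRestr (h : IsHypData c₀ e) (hc₀ : c₀ ∈ A.hyps) {c' : Fin n → K}
    (hc' : c' ≠ 0) (hex : ∃ c ∈ A.hyps, c ≠ c₀ ∧ ∃ t : K, pullVec e c = t • c') :
    IsRankTwo (locRestr A e c') c₀ e c' where
  hyp := h
  mem := mem_locRestr.2 ⟨hc₀, 0, by rw [h.pullVec_self, zero_smul]⟩
  ne_zero := hc'
  exists_smul _ hc := (mem_locRestr.1 hc).2
  exists_ne := by
    obtain ⟨c, hc, hne, ht⟩ := hex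
    exact ⟨c, mem_locRestr.2 ⟨hc, ht⟩, hne⟩

variable [IsScalarTower K (PS K ℓ) (PS K n)]

/-- The projective dimension of the logarithmic forms of the Euler restriction. -/
theorem pdLT_lf_eulerRestriction (h : IsHypData c₀ e) (hc₀ : c₀ ∈ A.hyps)
    {m : (Fin ℓ → K) → ℕ} (hm : ∀ c ∈ A.hyps, 0 < m c)
    (hB : ∀ c ∈ A.hyps, c ≠ c₀ → ∃ c' ∈ B.hyps, ∃ t : K, pullVec e c = t • c')
    (hB' : ∀ c' ∈ B.hyps, ∃ c ∈ A.hyps, c ≠ c₀ ∧ ∃ t : K, pullVec e c = t • c')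
    {ms : (Fin n → K) → ℕ} (hms : ∀ c' ∈ B.hyps, ∃ d1 d2 : ℕ,
      FreeWithExp (locRestr A e c') m (expVec d1 d2) ∧
      FreeWithExp (locRestr A e c') (mdel m c₀) (expVec (d1 - 1) d2) ∧ ms c' = d2)
    (hfree : ∀ x ≠ 0, dotLin c₀ x = 0 → Module.Projective (PS K ℓ) (lf (locArr A x).hyps m p))
    (hp : p + 3 ≤ ℓ) (hpd : pdLT (PS K ℓ) (lf A.hyps m p) (p + 1))
    (hpd' : pdLT (PS K ℓ) (lf A.hyps (mdel m c₀) p) (p + 2)) :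
    pdLT (PS K n) (lf B.hyps ms p) (p + 1) := by
  have hloc : ∀ c' ∈ B.hyps, ∃ g : ℕ, g + ms c' = restMult (locRestr A e c') m c₀ ∧
      ∀ (hT : c₀ ∈ (locRestr A e c').hyps) (ζ : (Fin n → K) [⋀^Fin p]→ₗ[K] PS K n),
        ζ ∈ LinearMap.range (residue h hT m p) ↔
          IsBounded c' g (restMult (locRestr A e c') m c₀) ζ := by
    intro c' hc'
    have h2 := h.isRankTwo_locRestr hc₀ (B.ne_zero c' hc') (hB' c' hc')
    obtain ⟨u, hu⟩ := exists_dotLin_eq_one (B.ne_zero c' hc')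
    obtain ⟨d1, d2, hd, hd', hd2⟩ := hms c' hc'
    obtain ⟨j, hj, hJ⟩ := h2.resIdeal_eq (fun c hc => hm c (mem_locRestr.1 hc).1) hu hd hd'
    exact ⟨j, hd2 ▸ hj, fun _ ζ => h2.mem_range_residue_iff m hu hJ (by omega) ζ⟩
  choose! g hg hloc using hloc
  have key (ζ : (Fin n → K) [⋀^Fin p]→ₗ[K] PS K n) :
      ζ ∈ LinearMap.range (residue h hc₀ m p) ↔
        ∃ ξ ∈ lf B.hyps ms p, (∏ c ∈ B.hyps, linP c ^ g c) • ξ = ζ :=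
    (mem_range_residue_iff_forall h hc₀ (hm c₀ hc₀) hB hloc hfree hp hpd ζ).trans
      (B.forall_isBounded_iff hg ζ)
  have hG : ∏ c ∈ B.hyps, linP c ^ g c ≠ 0 := Finset.prod_ne_zero_iff.2 fun c hc =>
    pow_ne_zero _ (linP_ne_zero (B.ne_zero c hc))
  have : IsScalarTower (PS K ℓ) (PS K n) ((Fin n → K) [⋀^Fin p]→ₗ[K] PS K n) :=
    ⟨fun s r ζ => AlternatingMap.ext fun v => smul_assoc s r (ζ v)⟩
  let f : lf B.hyps ms p →ₗ[PS K ℓ] LinearMap.range (residue h hc₀ m p) :=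
    { toFun := fun ξ => ⟨(∏ c ∈ B.hyps, linP c ^ g c) • ξ.1, (key _).2 ⟨ξ.1, ξ.2, rfl⟩⟩
      map_add' := fun ξ ξ' => Subtype.ext (smul_add _ _ _)
      map_smul' := fun s ξ => Subtype.ext (smul_comm _ s ξ.1) }
  have hf : Function.Bijective f := by
    constructor
    · intro ξ ξ' hξ
      refine Subtype.ext (AlternatingMap.ext fun v => mul_left_cancel₀ hG ?_)
      exact DFunLike.congr_fun (congrArg Subtype.val hξ) v
    · rintro ⟨ζ, hζ⟩
      obtain ⟨ξ, hξ, rfl⟩ := (key ζ).1 hζ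
      exact ⟨⟨ξ, hξ⟩, rfl⟩
  have h4 : pdLT (PS K ℓ) (lf B.hyps ms p) (p + 2) :=
    (pdLT_range_residue h hc₀ m (hm c₀ hc₀) hpd hpd').of_equiv (LinearEquiv.ofBijective f hf).symm
  exact pdLT.change_rings h.algebraMap_surjective h.algebraMap_eq_zero_iff (linP_ne_zero h.ne_zero)
    p h4 n (gldimLE_mvPolynomial K n _)

end Restriction

/-- **Restriction theorem for tameness of multiarrangements.**  If `(A, m)` and
`(A, m - δ_H)` are both tame and `(A, m)` is locally free along `H`, then the Euler
restriction `(A^H, m^*)` is tame. -/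
theorem restriction_theorem_for_tameness_multi
    {K : Type} [Field K] {ℓ : ℕ} (A : Arrangement K ℓ) (hess : Essential A)
    (m : (Fin ℓ → K) → ℕ) (hm : ∀ c ∈ A.hyps, 0 < m c)
    (c0 : Fin ℓ → K) (hc0 : c0 ∈ A.hyps)
    (htame : TameM A m) (hdel_tame : TameM A (mdel m c0))
    (hlf : LocallyFreeAlong A m c0) :
    ∀ (e : (Fin (ℓ - 1) → K) →ₗ[K] (Fin ℓ → K)) (B : Arrangement K (ℓ - 1))
      (ms : (Fin (ℓ - 1) → K) → ℕ),
      IsHypEmbedding c0 e → IsRestrictionOf B A c0 e → IsEulerMult A m c0 e B ms →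
        TameM B ms := by
  intro e B ms he hB hms p _
  rw [pdLE_iff_pdLT]
  suffices hlt : pdLT (PS K (ℓ - 1)) (lf B.hyps ms p) (p + 1) from
    hlt.of_equiv (omegaEquiv B ms p).symm
  by_cases hp : p + 3 ≤ ℓ
  · let _ : Algebra (PS K ℓ) (PS K (ℓ - 1)) := (pullHom e).toRingHom.toAlgebra
    have : IsScalarTower K (PS K ℓ) (PS K (ℓ - 1)) :=
      IsScalarTower.of_algebraMap_eq' (pullHom e).comp_algebraMap.symm
    have h : IsHypData c0 e := ⟨A.ne_zero c0 hc0, he.1, he.2, fun _ => rfl⟩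
    refine pdLT_lf_eulerRestriction h hc0 hm (fun c hc hne => ?_) (fun c' hc' => ?_) hms
      (fun x hx hx0 => ?_) hp (((pdLE_iff_pdLT p).1 (htame p (by omega))).of_equiv
        (omegaEquiv A m p)) ((((pdLE_iff_pdLT p).1 (hdel_tame p (by omega))).of_equiv
          (omegaEquiv A (mdel m c0) p)).mono (Nat.le_succ _))
    · obtain ⟨c', hc', t, -, ht⟩ := hB.1 c hc hne
      exact ⟨c', hc', t, ht⟩
    · obtain ⟨c, hc, hne, t, -, ht⟩ := hB.2 c' hc'
      exact ⟨c, hc, hne, t, ht⟩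
    · rw [dotLin_apply] at hx0
      have : Module.Free (PS K ℓ) (Omega (locArr A x) m 1) := hlf x hx hx0
      exact (locArr A x).projective_lf_of_free m
        (Module.Free.of_equiv (omegaEquiv (locArr A x) m 1)) p
  · exact (pdLT_lf B ms p).mono (by omega)
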